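/- Let N ≥ 2 and m ≥ 1 be integers and let q satisfy q > 1 if N ≤ 2m and 1 < q ≤ (N+2m)/(N−2m) if N > 2m. Let u be a bounded classical solution of the half-space Dirichlet problem (−Δ)^m u = u^q with u ≥ 0, and define v : B → ℝ by v(x) = |x+e₁|^{2m−N} u(φ(x)). Then v is axially symmetric with respect to the x₁-axis: v(x) = v(y) whenever x, y ∈ B satisfy x₁ = y₁ and |x| = |y|. -/

import Mathlib

noncomputable def lap {N : ℕ} (f : EuclideanSpace ℝ (Fin N) → ℝ)
    (x : EuclideanSpace ℝ (Fin N)) : ℝ :=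
  ∑ i : Fin N, iteratedDeriv 2 (fun t : ℝ => f (x + t • EuclideanSpace.single i (1 : ℝ))) 0

noncomputable def polyLap {N : ℕ} (m : ℕ) (f : EuclideanSpace ℝ (Fin N) → ℝ)
    (x : EuclideanSpace ℝ (Fin N)) : ℝ :=
  (-1 : ℝ) ^ m * (lap^[m] f x)

/-- The first coordinate vector `e₁ = (1,0,…,0)` of `ℝ^N`. -/
noncomputable def e1 (N : ℕ) [NeZero N] : EuclideanSpace ℝ (Fin N) :=
  EuclideanSpace.single 0 1

/-- `u` is a bounded classical solution of the half-space Dirichlet problem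
`(-Δ)^m u = u^q`. -/
def IsBCSol (N m : ℕ) [NeZero N] (q : ℝ) (u : EuclideanSpace ℝ (Fin N) → ℝ) : Prop :=
  ContDiffOn ℝ (2 * m : ℕ) u {x : EuclideanSpace ℝ (Fin N) | 0 < x 0} ∧
  ContDiffOn ℝ (2 * m - 1 : ℕ) u {x : EuclideanSpace ℝ (Fin N) | 0 ≤ x 0} ∧
  (∀ j : ℕ, j ≤ 2 * m - 1 → ∃ C : ℝ, ∀ x : EuclideanSpace ℝ (Fin N), 0 ≤ x 0 →
    ‖iteratedFDerivWithin ℝ j u {y : EuclideanSpace ℝ (Fin N) | 0 ≤ y 0} x‖ ≤ C) ∧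
  (∀ x : EuclideanSpace ℝ (Fin N), 0 < x 0 → polyLap m u x = u x ^ q) ∧
  (∀ j : ℕ, j < m → ∀ x : EuclideanSpace ℝ (Fin N), x 0 = 0 →
    iteratedFDerivWithin ℝ j u {y : EuclideanSpace ℝ (Fin N) | 0 ≤ y 0} x (fun _ => e1 N) = 0)

/-- The Kelvin-type map `φ(y) = 2(y+e₁)/|y+e₁|² - e₁`. -/
noncomputable def kelvin (N : ℕ) [NeZero N] (y : EuclideanSpace ℝ (Fin N)) :
    EuclideanSpace ℝ (Fin N) :=
  (2 / ‖y + e1 N‖ ^ 2) • (y + e1 N) - e1 N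

section

open scoped ContDiff Topology
open MeasureTheory Set Filter EuclideanGeometry

lemma smooth_two_le : (2 : WithTop ℕ∞) ≤ ∞ := 
  WithTop.coe_le_coe.2 (le_top : (2 : ℕ∞) ≤ ⊤)

abbrev EE (N : ℕ) := EuclideanSpace ℝ (Fin N)

/-- The `i`-th partial derivative. -/
noncomputable def pd {N : ℕ} (i : Fin N) (f : EE N → ℝ) (x : EE N) : ℝ :=
  fderiv ℝ f x (EuclideanSpace.single i 1)

lemma contDiffAt_pd {N : ℕ} (i : Fin N) {f : EE N → ℝ} {x : EE N} {n : WithTop ℕ∞}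
    (hf : ContDiffAt ℝ (n + 1) f x) : ContDiffAt ℝ n (pd i f) x :=
  (hf.fderiv_right le_rfl).clm_apply contDiffAt_const

lemma contDiff_pd {N : ℕ} (i : Fin N) {f : EE N → ℝ} {n : WithTop ℕ∞}
    (hf : ContDiff ℝ (n + 1) f) : ContDiff ℝ n (pd i f) :=
  contDiff_iff_contDiffAt.2 fun _ => contDiffAt_pd i hf.contDiffAt

lemma smooth_pd {N : ℕ} (i : Fin N) {f : EE N → ℝ} (hf : ContDiff ℝ ∞ f) :
    ContDiff ℝ ∞ (pd i f) := contDiff_pd i (by simpa using hf)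

lemma lap_eq_sum_pd {N : ℕ} {f : EE N → ℝ} {x : EE N} (hf : ContDiffAt ℝ 2 f x) :
    lap f x = ∑ i : Fin N, pd i (pd i f) x := by
  unfold lap
  refine Finset.sum_congr rfl fun i _ => ?_
  rw [iteratedDeriv_succ, iteratedDeriv_one]
  set e : EE N := EuclideanSpace.single i 1
  have hline : ∀ t : ℝ, HasDerivAt (fun t : ℝ => x + t • e) e t := fun t => by
    simpa using ((hasDerivAt_id t).smul_const e).const_add x
  have htend : Tendsto (fun t : ℝ => x + t • e) (𝓝 0) (𝓝 x) := by
    have : Continuous (fun t : ℝ => x + t • e) := by fun_prop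
    simpa using this.tendsto 0
  have h1 : deriv (fun t : ℝ => f (x + t • e)) =ᶠ[𝓝 0] fun t => pd i f (x + t • e) := by
    have hev : ∀ᶠ y in 𝓝 x, DifferentiableAt ℝ f y := by
      filter_upwards [hf.eventually (by simp)] with y hy using hy.differentiableAt (by simp)
    filter_upwards [htend.eventually hev] with t ht
    exact (ht.hasFDerivAt.comp_hasDerivAt t (hline t)).deriv
  rw [h1.deriv_eq]
  have h2 : DifferentiableAt ℝ (pd i f) (x + (0:ℝ) • e) := by
    simp only [zero_smul, add_zero]
    exact (contDiffAt_pd (n := 1) i (by simpa [one_add_one_eq_two] using hf)).differentiableAt (by simp)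
  have := (h2.hasFDerivAt.comp_hasDerivAt (0:ℝ) (hline 0)).deriv
  simp only [Function.comp_def] at this
  rw [this]; simp [pd, e]

lemma lap_congr {N : ℕ} {f g : EE N → ℝ} {x : EE N} (h : f =ᶠ[𝓝 x] g) : lap f x = lap g x := by
  unfold lap
  refine Finset.sum_congr rfl fun i _ => ?_
  have htend : Tendsto (fun t : ℝ => x + t • (EuclideanSpace.single i 1 : EE N)) (𝓝 0) (𝓝 x) := by
    have : Continuous (fun t : ℝ => x + t • (EuclideanSpace.single i 1 : EE N)) := by fun_prop
    simpa using this.tendsto 0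
  have : (fun t : ℝ => f (x + t • (EuclideanSpace.single i 1 : EE N))) =ᶠ[𝓝 0]
      (fun t : ℝ => g (x + t • (EuclideanSpace.single i 1 : EE N))) := htend.eventually h
  exact this.iteratedDeriv_eq 2

lemma lap_congr_ev {N : ℕ} {f g : EE N → ℝ} {x : EE N} (h : f =ᶠ[𝓝 x] g) :
    lap f =ᶠ[𝓝 x] lap g := by
  filter_upwards [h.eventuallyEq_nhds] with y hy using lap_congr hy

lemma lap_iterate_congr {N : ℕ} (k : ℕ) {f g : EE N → ℝ} {x : EE N} (h : f =ᶠ[𝓝 x] g) :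
    lap^[k] f =ᶠ[𝓝 x] lap^[k] g := by
  induction k generalizing f g with
  | zero => exact h
  | succ k ih => simpa using ih (lap_congr_ev h)

lemma lap_fun_eq {N : ℕ} {f : EE N → ℝ} (hf : ContDiff ℝ 2 f) :
    lap f = fun x => ∑ i : Fin N, pd i (pd i f) x :=
  funext fun _ => lap_eq_sum_pd hf.contDiffAt

lemma contDiff_lap {N : ℕ} {f : EE N → ℝ} {n : WithTop ℕ∞} (hf : ContDiff ℝ (n + 2) f) :
    ContDiff ℝ n (lap f) := by
  have h2 : ContDiff ℝ 2 f := hf.of_le (by exact le_add_self)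
  rw [lap_fun_eq h2]
  refine ContDiff.sum fun i _ => contDiff_pd i (contDiff_pd i ?_)
  rwa [add_assoc, one_add_one_eq_two]

lemma smooth_lap {N : ℕ} {f : EE N → ℝ} (hf : ContDiff ℝ ∞ f) : ContDiff ℝ ∞ (lap f) :=
  contDiff_lap (n := ∞) hf

lemma smooth_lap_iterate {N : ℕ} (k : ℕ) {f : EE N → ℝ} (hf : ContDiff ℝ ∞ f) :
    ContDiff ℝ ∞ (lap^[k] f) := by
  induction k generalizing f with
  | zero => exact hf
  | succ k ih => simpa using ih (smooth_lap hf)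

lemma hasCompactSupport_pd {N : ℕ} (i : Fin N) {f : EE N → ℝ} (hf : HasCompactSupport f) :
    HasCompactSupport (pd i f) := by
  exact hf.fderiv_apply (𝕜 := ℝ) _

lemma support_lap_subset {N : ℕ} (f : EE N → ℝ) : tsupport (lap f) ⊆ tsupport f := by
  refine closure_minimal (fun x hx => ?_) (isClosed_tsupport f)
  by_contra h
  apply hx
  rw [lap_congr (notMem_tsupport_iff_eventuallyEq.1 h)]
  unfold lap; simp

lemma support_lap_iterate_subset {N : ℕ} (k : ℕ) (f : EE N → ℝ) :
    tsupport (lap^[k] f) ⊆ tsupport f := by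
  induction k generalizing f with
  | zero => exact subset_rfl
  | succ k ih => exact (by simpa using (ih (lap f)).trans (support_lap_subset f))

lemma hasCompactSupport_lap_iterate {N : ℕ} (k : ℕ) {f : EE N → ℝ} (hf : HasCompactSupport f) :
    HasCompactSupport (lap^[k] f) :=
  hf.of_isClosed_subset (isClosed_tsupport _) (support_lap_iterate_subset k f)

lemma integral_pd_mul {N : ℕ} (i : Fin N) {f g : EE N → ℝ} (hf : ContDiff ℝ 1 f)
    (hg : ContDiff ℝ 1 g) (hs : HasCompactSupport g) :
    ∫ x, f x * pd i g x = -∫ x, pd i f x * g x := by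
  have hs' := hasCompactSupport_pd i hs
  have cf := (contDiff_pd (n := 0) i (by simpa using hf)).continuous
  have cg := (contDiff_pd (n := 0) i (by simpa using hg)).continuous
  refine integral_mul_fderiv_eq_neg_fderiv_mul_of_integrable ?_ ?_ ?_
    (fun x _ => hf.differentiable (by simp) x) (fun x _ => hg.differentiable (by simp) x)
  · exact (cf.mul hg.continuous).integrable_of_hasCompactSupport hs.mul_left
  · exact (hf.continuous.mul cg).integrable_of_hasCompactSupport hs'.mul_left
  · exact (hf.continuous.mul hg.continuous).integrable_of_hasCompactSupport hs.mul_left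

lemma integral_mul_lap {N : ℕ} {f g : EE N → ℝ} (hf : ContDiff ℝ 2 f)
    (hg : ContDiff ℝ 2 g) (hs : HasCompactSupport g) :
    ∫ x, f x * lap g x = ∫ x, lap f x * g x := by
  have hf1 : ContDiff ℝ 1 f := hf.of_le (by norm_num)
  have hg1 : ContDiff ℝ 1 g := hg.of_le (by norm_num)
  have df : ∀ i, ContDiff ℝ 1 (pd i f) := fun i =>
    contDiff_pd i (by simpa [one_add_one_eq_two] using hf)
  have dg : ∀ i, ContDiff ℝ 1 (pd i g) := fun i =>
    contDiff_pd i (by simpa [one_add_one_eq_two] using hg)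
  have ddf : ∀ i, Continuous (pd i (pd i f)) := fun i =>
    (contDiff_pd (n := 0) i (by simpa using df i)).continuous
  have ddg : ∀ i, Continuous (pd i (pd i g)) := fun i =>
    (contDiff_pd (n := 0) i (by simpa using dg i)).continuous
  have sg := fun i => hasCompactSupport_pd i hs
  have ssg := fun i => hasCompactSupport_pd i (sg i)
  rw [lap_fun_eq hf, lap_fun_eq hg]
  simp only [Finset.mul_sum, Finset.sum_mul]
  rw [integral_finsetSum, integral_finsetSum]
  · refine Finset.sum_congr rfl fun i _ => ?_
    rw [integral_pd_mul i hf1 (dg i) (sg i), integral_pd_mul i (df i) hg1 hs, neg_neg]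
  · exact fun i _ => ((ddf i).mul hg.continuous).integrable_of_hasCompactSupport hs.mul_left
  · exact fun i _ => (hf.continuous.mul (ddg i)).integrable_of_hasCompactSupport (ssg i).mul_left

lemma integral_mul_lap_iterate {N : ℕ} (m : ℕ) {f g : EE N → ℝ} (hf : ContDiff ℝ (2 * m : ℕ) f)
    (hg : ContDiff ℝ ∞ g) (hs : HasCompactSupport g) :
    ∫ x, f x * lap^[m] g x = ∫ x, lap^[m] f x * g x := by
  induction m generalizing f with
  | zero => simp
  | succ m ih =>
    have h2 : ContDiff ℝ ((2 * m : ℕ) + 2) f := by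
      have : ((2 * (m + 1) : ℕ) : WithTop ℕ∞) = (2 * m : ℕ) + 2 := by push_cast; ring
      rwa [← this]
    rw [Function.iterate_succ_apply', Function.iterate_succ_apply,
      integral_mul_lap (h2.of_le le_add_self)
        ((smooth_lap_iterate m hg).of_le smooth_two_le)
        (hasCompactSupport_lap_iterate m hs)]
    exact ih (contDiff_lap h2)

/-- The open half-space `{x₁ > 0}`. -/
def hs (N : ℕ) [NeZero N] : Set (EE N) := {x | 0 < x 0}

/-- The closed half-space `{x₁ ≥ 0}`. -/
def chs (N : ℕ) [NeZero N] : Set (EE N) := {x | 0 ≤ x 0}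

@[simp] lemma mem_hs {N : ℕ} [NeZero N] {x : EE N} : x ∈ hs N ↔ 0 < x 0 := Iff.rfl

@[simp] lemma mem_chs {N : ℕ} [NeZero N] {x : EE N} : x ∈ chs N ↔ 0 ≤ x 0 := Iff.rfl

lemma hs_subset_chs {N : ℕ} [NeZero N] : hs N ⊆ chs N := fun _ hx =>
  mem_chs.2 (mem_hs.1 hx).le

lemma continuous_coord {N : ℕ} (i : Fin N) : Continuous (fun x : EE N => x i) := by fun_prop

lemma isOpen_hs {N : ℕ} [NeZero N] : IsOpen (hs N) :=
  isOpen_lt continuous_const (continuous_coord 0)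

lemma measurableSet_hs {N : ℕ} [NeZero N] : MeasurableSet (hs N) := isOpen_hs.measurableSet

lemma uniqueDiffOn_chs {N : ℕ} [NeZero N] : UniqueDiffOn ℝ (chs N) := by
  refine uniqueDiffOn_convex ?_ ⟨e1 N, ?_⟩
  · intro x hx y hy a b ha hb _
    simp only [mem_chs, PiLp.add_apply, PiLp.smul_apply, smul_eq_mul] at *
    positivity
  · have : hs N ⊆ interior (chs N) := interior_maximal hs_subset_chs isOpen_hs
    exact this (by simp [hs, e1])

lemma smooth_coord {N : ℕ} (i : Fin N) {n : WithTop ℕ∞} : ContDiff ℝ n (fun x : EE N => x i) := by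
  fun_prop

namespace IsBCSol

variable {N m : ℕ} [NeZero N] {q : ℝ} {u : EE N → ℝ}

lemma exists_bound (h : IsBCSol N m q u) : ∃ M : ℝ, 0 < M ∧ ∀ x ∈ chs N, |u x| ≤ M := by
  obtain ⟨C, hC⟩ := h.2.2.1 0 (Nat.zero_le _)
  refine ⟨max C 1, by positivity, fun x hx => ?_⟩
  have := hC x hx
  rw [norm_iteratedFDerivWithin_zero, Real.norm_eq_abs] at this
  exact this.trans (le_max_left _ _)

lemma continuousOn (h : IsBCSol N m q u) : ContinuousOn u (chs N) := h.2.1.continuousOn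

lemma exists_bound_pow (h : IsBCSol N m q u) (hm : 0 < m) :
    ∃ C : ℝ, 0 < C ∧ ∀ x ∈ chs N, |u x| ≤ C * x 0 ^ m := by
  obtain ⟨C, hC⟩ := h.2.2.1 m (by omega)
  refine ⟨max C 1, by positivity, fun x hx => ?_⟩
  set x' : EE N := x - x 0 • e1 N with hx'
  have hx'0 : x' 0 = 0 := by simp [hx', e1]
  have hmem : ∀ t : ℝ, 0 ≤ t → x' + t • e1 N ∈ chs N := fun t ht => by
    simp [chs, hx'0, e1, ht]
  let G : ℕ → ℝ → ℝ := fun j t =>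
    iteratedFDerivWithin ℝ j u (chs N) (x' + t • e1 N) (fun _ => e1 N)
  have hG : ∀ j, j < m → ∀ t, 0 ≤ t → HasDerivWithinAt (G j) (G (j + 1) t) (Ici 0) t := by
    intro j hj t ht
    have hd : DifferentiableWithinAt ℝ (iteratedFDerivWithin ℝ j u (chs N)) (chs N)
        (x' + t • e1 N) := by
      refine h.2.1.differentiableOn_iteratedFDerivWithin (m := j) ?_ uniqueDiffOn_chs _ (hmem t ht)
      exact_mod_cast (by omega : j < 2 * m - 1)
    have hl : HasDerivWithinAt (fun t : ℝ => x' + t • e1 N) (e1 N) (Ici 0) t := by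
      simpa using (((hasDerivAt_id t).smul_const (e1 N)).const_add x').hasDerivWithinAt
    have h3 := hd.hasFDerivWithinAt.comp_hasDerivWithinAt t hl (fun t ht => hmem t ht)
    have h4 := (ContinuousMultilinearMap.apply ℝ (fun _ : Fin j => EE N) ℝ
      (fun _ => e1 N)).hasFDerivAt.comp_hasDerivWithinAt t h3
    exact h4
  have key : ∀ k, k ≤ m → ∀ t, 0 ≤ t → |G (m - k) t| ≤ max C 1 * t ^ k := by
    intro k
    induction k with
    | zero =>
      intro _ t ht
      have h1 := (iteratedFDerivWithin ℝ m u (chs N) (x' + t • e1 N)).le_opNorm (fun _ => e1 N)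
      have h2 := hC _ (hmem t ht)
      have h3 : ‖e1 N‖ = 1 := by simp [e1]
      simp only [h3, Finset.prod_const_one, mul_one, Real.norm_eq_abs] at h1
      simpa [G] using Or.inl (h1.trans h2)
    | succ k ih =>
      intro hk t ht
      have h0 : G (m - (k + 1)) 0 = 0 := by
        simpa [G] using! h.2.2.2.2 (m - (k + 1)) (by omega) x' hx'0
      have hb := (convex_Icc (0:ℝ) t).norm_image_sub_le_of_norm_hasDerivWithin_le
        (f := G (m - (k + 1))) (f' := G (m - k)) (C := max C 1 * t ^ k) (x := 0) (y := t)
        (fun s hs => ?_) (fun s hs => ?_) ⟨le_rfl, ht⟩ ⟨ht, le_rfl⟩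
      · rw [h0, sub_zero, sub_zero, Real.norm_eq_abs, Real.norm_eq_abs, abs_of_nonneg ht] at hb
        rw [pow_succ, ← mul_assoc]; exact hb
      · have := hG (m - (k + 1)) (by omega) s hs.1
        rw [show m - (k + 1) + 1 = m - k by omega] at this
        exact this.mono Icc_subset_Ici_self
      · refine (ih (by omega) s hs.1).trans ?_
        gcongr
        · exact hs.1
        · exact hs.2
  have := key m le_rfl (x 0) hx
  simpa [G, hx'] using this

lemma integral_mul_lap_iterate_of_tsupport_subset (h : IsBCSol N m q u) {φ : EE N → ℝ}
    (hφ : ContDiff ℝ ∞ φ)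
    (hc : HasCompactSupport φ) (hsub : tsupport φ ⊆ hs N) :
    ∫ x, u x * lap^[m] φ x = (-1) ^ m * ∫ x, u x ^ q * φ x := by
  obtain ⟨δ, hδ, hK⟩ : ∃ δ : ℝ, 0 < δ ∧ ∀ x ∈ tsupport φ, δ ≤ x 0 := by
    rcases (tsupport φ).eq_empty_or_nonempty with he | hne
    · exact ⟨1, one_pos, by simp [he]⟩
    · obtain ⟨x, hx, hmin⟩ := hc.isCompact.exists_isMinOn hne (continuous_coord (0 : Fin N)).continuousOn
      exact ⟨x 0, hsub hx, fun y hy => hmin hy⟩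
  let χ : EE N → ℝ := fun x => Real.smoothTransition (3 * x 0 / δ - 1)
  have hχ : ContDiff ℝ ∞ χ := by
    refine Real.smoothTransition.contDiff.comp ?_
    have := smooth_coord (0 : Fin N) (n := ∞)
    fun_prop
  let g : EE N → ℝ := fun x => u x * χ x
  have hg : ContDiff ℝ (2 * m : ℕ) g := by
    refine contDiff_iff_contDiffAt.2 fun x => ?_
    rcases lt_or_ge 0 (x 0) with hx | hx
    · refine (h.1.contDiffAt (isOpen_hs.mem_nhds hx)).mul (hχ.contDiffAt.of_le ?_)
      exact WithTop.coe_le_coe.2 (le_top : ((2 * m : ℕ) : ℕ∞) ≤ ⊤)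
    · have : g =ᶠ[𝓝 x] fun _ => 0 := by
        have hop : {y : EE N | y 0 < δ / 3} ∈ 𝓝 x :=
          (isOpen_lt (continuous_coord 0) continuous_const).mem_nhds
            (show x 0 < δ / 3 by linarith)
        filter_upwards [hop] with y hy
        have hy : y 0 < δ / 3 := hy
        have : χ y = 0 := Real.smoothTransition.zero_of_nonpos (by
          rw [sub_nonpos, div_le_one hδ]; linarith)
        simp [g, this]
      exact contDiffAt_const.congr_of_eventuallyEq this
  have hgu : ∀ x ∈ tsupport φ, g =ᶠ[𝓝 x] u := by
    intro x hx
    have hop : {y : EE N | 2 * δ / 3 < y 0} ∈ 𝓝 x :=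
      (isOpen_lt continuous_const (continuous_coord 0)).mem_nhds
        (show 2 * δ / 3 < x 0 by have := hK x hx; linarith)
    filter_upwards [hop] with y hy
    have hy : 2 * δ / 3 < y 0 := hy
    have : χ y = 1 := Real.smoothTransition.one_of_one_le (by
      rw [le_sub_iff_add_le, le_div_iff₀ hδ]; linarith)
    simp [g, this]
  have e1 : ∫ x, u x * lap^[m] φ x = ∫ x, g x * lap^[m] φ x := by
    refine integral_congr_ae (Eventually.of_forall fun x => ?_)
    by_cases hx : x ∈ tsupport φ
    · simp only [(hgu x hx).self_of_nhds]
    · have : lap^[m] φ x = 0 :=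
        image_eq_zero_of_notMem_tsupport fun h => hx (support_lap_iterate_subset m φ h)
      simp [this]
  rw [e1, integral_mul_lap_iterate m hg hφ hc, ← integral_const_mul]
  refine integral_congr_ae (Eventually.of_forall fun x => ?_)
  by_cases hx : x ∈ tsupport φ
  · have h2 := h.2.2.2.1 x (hsub hx)
    simp only [polyLap] at h2
    simp only [(lap_iterate_congr m (hgu x hx)).self_of_nhds, ← h2, ← mul_assoc, ← mul_pow]
    simp
  · simp [image_eq_zero_of_notMem_tsupport hx]

end IsBCSol

lemma smooth_differentiable {E : Type*} [NormedAddCommGroup E] [NormedSpace ℝ E] {f : E → ℝ}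
    (hf : ContDiff ℝ ∞ f) : Differentiable ℝ f := hf.differentiable (by simp)

lemma smooth_deriv {f : ℝ → ℝ} (hf : ContDiff ℝ ∞ f) : ContDiff ℝ ∞ (deriv f) :=
  (contDiff_infty_iff_deriv.1 hf).2

lemma smooth_iteratedDeriv {f : ℝ → ℝ} (hf : ContDiff ℝ ∞ f) (k : ℕ) :
    ContDiff ℝ ∞ (iteratedDeriv k f) := by
  induction k with
  | zero => simpa using hf
  | succ k ih => rw [iteratedDeriv_succ]; exact smooth_deriv ih

lemma pd_mul {N : ℕ} (i : Fin N) {f g : EE N → ℝ} {x : EE N} (hf : DifferentiableAt ℝ f x)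
    (hg : DifferentiableAt ℝ g x) :
    pd i (fun y => f y * g y) x = pd i f x * g x + f x * pd i g x := by
  unfold pd
  rw [fderiv_fun_mul hf hg]
  simp; ring

lemma pd_add {N : ℕ} (i : Fin N) {f g : EE N → ℝ} {x : EE N} (hf : DifferentiableAt ℝ f x)
    (hg : DifferentiableAt ℝ g x) :
    pd i (fun y => f y + g y) x = pd i f x + pd i g x := by
  unfold pd
  rw [fderiv_fun_add hf hg]; rfl

lemma pd_sum {N : ℕ} (i : Fin N) {ι : Type*} (s : Finset ι) {f : ι → EE N → ℝ} {x : EE N}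
    (hf : ∀ j ∈ s, DifferentiableAt ℝ (f j) x) :
    pd i (fun y => ∑ j ∈ s, f j y) x = ∑ j ∈ s, pd i (f j) x := by
  unfold pd
  rw [fderiv_fun_sum hf]; simp

lemma pd_const_mul {N : ℕ} (i : Fin N) (c : ℝ) (f : EE N → ℝ) {x : EE N}
    (hf : DifferentiableAt ℝ f x) : pd i (fun y => c * f y) x = c * pd i f x := by
  unfold pd
  rw [fderiv_const_mul hf]; rfl

lemma lap_sum {N : ℕ} {ι : Type*} (s : Finset ι) {f : ι → EE N → ℝ}
    (hf : ∀ j ∈ s, ContDiff ℝ ∞ (f j)) (x : EE N) :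
    lap (fun y => ∑ j ∈ s, f j y) x = ∑ j ∈ s, lap (f j) x := by
  have h1 : ContDiff ℝ ∞ (fun y => ∑ j ∈ s, f j y) := ContDiff.sum hf
  rw [lap_eq_sum_pd (h1.of_le smooth_two_le).contDiffAt, Finset.sum_congr rfl fun j hj =>
    lap_eq_sum_pd ((hf j hj).of_le smooth_two_le).contDiffAt, Finset.sum_comm]
  refine Finset.sum_congr rfl fun i _ => ?_
  have : pd i (fun y => ∑ j ∈ s, f j y) = fun y => ∑ j ∈ s, pd i (f j) y :=
    funext fun y => pd_sum i s fun j hj => (smooth_differentiable (hf j hj)) y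
  rw [this, pd_sum i s fun j hj => smooth_differentiable (smooth_pd i (hf j hj)) x]

lemma lap_const_mul {N : ℕ} (c : ℝ) {f : EE N → ℝ} (hf : ContDiff ℝ ∞ f) (x : EE N) :
    lap (fun y => c * f y) x = c * lap f x := by
  rw [lap_eq_sum_pd ((contDiff_const.mul hf).of_le smooth_two_le).contDiffAt,
    lap_eq_sum_pd (hf.of_le smooth_two_le).contDiffAt, Finset.mul_sum]
  refine Finset.sum_congr rfl fun i _ => ?_
  have : pd i (fun y => c * f y) = fun y => c * pd i f y :=
    funext fun y => pd_const_mul i c f (smooth_differentiable hf y)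
  rw [this, pd_const_mul i c _ (smooth_differentiable (smooth_pd i hf) x)]

lemma pd_comp_coord {N : ℕ} (i j : Fin N) {ζ : ℝ → ℝ} (hζ : Differentiable ℝ ζ) (x : EE N) :
    pd i (fun y : EE N => ζ (y j)) x = if i = j then deriv ζ (x j) else 0 := by
  have h1 : HasFDerivAt (fun y : EE N => y j) (EuclideanSpace.proj j : EE N →L[ℝ] ℝ) x :=
    (EuclideanSpace.proj j : EE N →L[ℝ] ℝ).hasFDerivAt
  have h2 := (hζ (x j)).hasDerivAt.comp_hasFDerivAt x h1
  unfold pd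
  have h3 : fderiv ℝ (fun y : EE N => ζ (y j)) x = _ := h2.fderiv
  rw [h3]
  by_cases h : i = j
  · subst h; simp
  · simp [h, Ne.symm h]

lemma lap_mul_coord {N : ℕ} [NeZero N] {B : EE N → ℝ} {ζ : ℝ → ℝ} (hB : ContDiff ℝ ∞ B)
    (hζ : ContDiff ℝ ∞ ζ) (x : EE N) :
    lap (fun y => B y * ζ (y 0)) x =
      lap B x * ζ (x 0) + 2 * pd 0 B x * deriv ζ (x 0) + B x * deriv (deriv ζ) (x 0) := by
  have hc : ∀ {η : ℝ → ℝ}, ContDiff ℝ ∞ η → ContDiff ℝ ∞ (fun y : EE N => η (y 0)) :=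
    fun hη => hη.comp (smooth_coord 0)
  rw [lap_eq_sum_pd ((hB.mul (hc hζ)).of_le smooth_two_le).contDiffAt,
    lap_eq_sum_pd (hB.of_le smooth_two_le).contDiffAt, Finset.sum_mul]
  have h1 : ∀ i, pd i (fun y => B y * ζ (y 0)) =
      fun y => pd i B y * ζ (y 0) + B y * (if i = 0 then deriv ζ (y 0) else 0) := fun i =>
    funext fun y => by
      rw [pd_mul i (smooth_differentiable hB y) (smooth_differentiable (hc hζ) y),
        pd_comp_coord i 0 (smooth_differentiable hζ)]
  have h2 : ∀ i, pd i (pd i (fun y => B y * ζ (y 0))) x =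
      pd i (pd i B) x * ζ (x 0) + if i = 0 then
        2 * pd 0 B x * deriv ζ (x 0) + B x * deriv (deriv ζ) (x 0) else 0 := fun i => by
    rw [h1]
    by_cases h : i = 0
    · subst h
      simp only [if_true]
      rw [pd_add, pd_mul, pd_mul, pd_comp_coord, pd_comp_coord]
      · simp only [if_true]; ring
      all_goals first
        | exact smooth_differentiable (smooth_deriv hζ)
        | exact smooth_differentiable hζ
        | exact smooth_differentiable hB _
        | exact smooth_differentiable (hc hζ) _
        | exact smooth_differentiable (hc (smooth_deriv hζ)) _
        | exact smooth_differentiable (smooth_pd _ hB) _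
        | exact smooth_differentiable (hB.mul (hc (smooth_deriv hζ))) _
        | exact smooth_differentiable ((smooth_pd _ hB).mul (hc hζ)) _
    · simp only [h, if_false, mul_zero, add_zero]
      rw [pd_mul, pd_comp_coord]
      · simp [h]
      · exact smooth_differentiable hζ
      · exact smooth_differentiable (smooth_pd _ hB) _
      · exact smooth_differentiable (hc hζ) _
  simp only [h2, Finset.sum_add_distrib, Finset.sum_ite_eq', Finset.mem_univ, if_true]
  ring

lemma smooth_mul_coord {N : ℕ} [NeZero N] {B : EE N → ℝ} {ζ : ℝ → ℝ} (hB : ContDiff ℝ ∞ B)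
    (hζ : ContDiff ℝ ∞ ζ) : ContDiff ℝ ∞ (fun y => B y * ζ (y 0)) :=
  hB.mul (hζ.comp (smooth_coord 0))

/-- Leibniz expansion of an iterated Laplacian of a product `A(y) ζ(y₁)`. -/
lemma exists_lap_iterate_mul_coord {N : ℕ} [NeZero N] (m : ℕ) {A : EE N → ℝ}
    (hA : ContDiff ℝ ∞ A) (hc : HasCompactSupport A) :
    ∃ (ι : Type) (_ : Fintype ι) (κ : ι → ℕ) (B : ι → EE N → ℝ),
      (∀ i, κ i ≤ 2 * m) ∧ (∀ i, ContDiff ℝ ∞ (B i)) ∧ (∀ i, HasCompactSupport (B i)) ∧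
      ∀ ζ : ℝ → ℝ, ContDiff ℝ ∞ ζ → lap^[m] (fun y => A y * ζ (y 0)) =
        fun y => ∑ i, B i y * iteratedDeriv (κ i) ζ (y 0) := by
  induction m with
  | zero => exact ⟨Unit, inferInstance, fun _ => 0, fun _ => A, by simp, by simp [hA],
      by simp [hc], by simp⟩
  | succ m ih =>
    obtain ⟨ι, _, κ, B, hκ, hB, hBc, hexp⟩ := ih
    refine ⟨ι × Fin 3, inferInstance, fun p => κ p.1 + p.2, fun p =>
      ![lap (B p.1), fun y => 2 * pd 0 (B p.1) y, B p.1] p.2, ?_, ?_, ?_, ?_⟩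
    · intro p
      have := hκ p.1
      have := p.2.2
      show κ p.1 + (p.2 : ℕ) ≤ 2 * (m + 1)
      omega
    · rintro ⟨i, j⟩
      fin_cases j
      · exact smooth_lap (hB i)
      · exact contDiff_const.mul (smooth_pd 0 (hB i))
      · exact hB i
    · rintro ⟨i, j⟩
      fin_cases j
      · exact hasCompactSupport_lap_iterate 1 (hBc i)
      · exact (hasCompactSupport_pd 0 (hBc i)).mul_left
      · exact hBc i
    · intro ζ hζ
      rw [Function.iterate_succ_apply', hexp ζ hζ]
      funext y
      rw [lap_sum _ fun i _ => smooth_mul_coord (hB i) (smooth_iteratedDeriv hζ _),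
        Fintype.sum_prod_type]
      refine Finset.sum_congr rfl fun i _ => ?_
      rw [lap_mul_coord (hB i) (smooth_iteratedDeriv hζ _)]
      simp [Fin.sum_univ_three, iteratedDeriv_succ]

/-- Smooth cutoff of `z ^ m`, equal to `z ^ m` for `z ≥ 1` and vanishing for `z ≤ 1/2`. -/
noncomputable def cutPow (m : ℕ) (z : ℝ) : ℝ := z ^ m * Real.smoothTransition (2 * z - 1)

lemma smooth_cutPow (m : ℕ) : ContDiff ℝ ∞ (cutPow m) :=
  (contDiff_id.pow m).mul (Real.smoothTransition.contDiff.comp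
    ((contDiff_const.mul contDiff_id).sub contDiff_const))

lemma cutPow_of_le {m : ℕ} {z : ℝ} (hz : z ≤ 1 / 2) : cutPow m z = 0 := by
  rw [cutPow, Real.smoothTransition.zero_of_nonpos (by linarith), mul_zero]

lemma cutPow_of_ge {m : ℕ} {z : ℝ} (hz : 1 ≤ z) : cutPow m z = z ^ m := by
  rw [cutPow, Real.smoothTransition.one_of_one_le (by linarith), mul_one]

/-- Rescaled version of `cutPow`. -/
noncomputable def cutPowScaled (m : ℕ) (c z : ℝ) : ℝ := (c ^ m)⁻¹ * cutPow m (c * z)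

lemma smooth_cutPowScaled (m : ℕ) (c : ℝ) : ContDiff ℝ ∞ (cutPowScaled m c) :=
  contDiff_const.mul ((smooth_cutPow m).comp (contDiff_const.mul contDiff_id))

lemma cutPowScaled_eq_pow {m : ℕ} {c z : ℝ} (hc : 0 < c) (hz : 1 ≤ c * z) :
    cutPowScaled m c z = z ^ m := by
  rw [cutPowScaled, cutPow_of_ge hz, mul_pow, inv_mul_cancel_left₀ (by positivity)]

lemma iteratedDeriv_cutPowScaled (m k : ℕ) (c z : ℝ) :
    iteratedDeriv k (cutPowScaled m c) z =
      (c ^ m)⁻¹ * (c ^ k * iteratedDeriv k (cutPow m) (c * z)) := by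
  unfold cutPowScaled
  rw [iteratedDeriv_const_mul_field]
  have := congrFun (iteratedDeriv_comp_const_mul (n := k)
    ((smooth_cutPow m).of_le (WithTop.coe_le_coe.2 (le_top : ((k:ℕ):ℕ∞) ≤ ⊤))) c) z
  rw [this]

lemma iteratedDeriv_cutPowScaled_of_gt {m k : ℕ} {c z : ℝ} (hc : 0 < c) (hz : 1 < c * z) :
    iteratedDeriv k (cutPowScaled m c) z = iteratedDeriv k (fun z => z ^ m) z := by
  refine Filter.EventuallyEq.iteratedDeriv_eq k ?_
  have : {w : ℝ | 1 < c * w} ∈ 𝓝 z :=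
    (isOpen_lt continuous_const (by fun_prop)).mem_nhds (show 1 < c * z from hz)
  filter_upwards [this] with w hw
  exact cutPowScaled_eq_pow hc (le_of_lt hw)

lemma exists_bound_iteratedDeriv_cutPow (m k : ℕ) :
    ∃ W : ℝ, 0 ≤ W ∧ ∀ z, 0 ≤ z → z ≤ 1 → |iteratedDeriv k (cutPow m) z| ≤ W := by
  obtain ⟨W, hW⟩ := isCompact_Icc.exists_bound_of_continuousOn (s := Icc (0:ℝ) 1)
    (smooth_iteratedDeriv (smooth_cutPow m) k).continuous.continuousOn
  exact ⟨max W 0, le_max_right _ _, fun z h0 h1 => (hW z ⟨h0, h1⟩).trans (le_max_left _ _)⟩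

namespace IsBCSol

variable {N m : ℕ} [NeZero N] {q : ℝ} {u : EE N → ℝ}

lemma aestronglyMeasurable (h : IsBCSol N m q u) :
    AEStronglyMeasurable u (volume.restrict (hs N)) :=
  (h.continuousOn.mono hs_subset_chs).aestronglyMeasurable measurableSet_hs

lemma continuousOn_rpow (h : IsBCSol N m q u) (hq : 0 ≤ q) :
    ContinuousOn (fun x => u x ^ q) (chs N) :=
  h.continuousOn.rpow_const fun _ _ => Or.inr hq

lemma aestronglyMeasurable_rpow (h : IsBCSol N m q u) (hq : 0 ≤ q) :
    AEStronglyMeasurable (fun x => u x ^ q) (volume.restrict (hs N)) :=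
  ((h.continuousOn_rpow hq).mono hs_subset_chs).aestronglyMeasurable measurableSet_hs

/-- Testing the equation against functions vanishing to order `m` at the boundary. -/
lemma setIntegral_mul_lap_iterate (h : IsBCSol N m q u) (hm : 0 < m) (hq : 0 ≤ q)
    (hpos : ∀ x, 0 ≤ x 0 → 0 ≤ u x) {A : EE N → ℝ} (hA : ContDiff ℝ ∞ A)
    (hc : HasCompactSupport A) :
    ∫ y in hs N, u y * lap^[m] (fun y => A y * y 0 ^ m) y =
      (-1) ^ m * ∫ y in hs N, u y ^ q * (A y * y 0 ^ m) := by
  obtain ⟨M, hM0, hM⟩ := h.exists_bound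
  obtain ⟨C, hC0, hC⟩ := h.exists_bound_pow hm
  obtain ⟨ι, _, κ, B, hκ, hB, hBc, hexp⟩ := exists_lap_iterate_mul_coord m hA hc
  choose W hW0 hW using fun i => exists_bound_iteratedDeriv_cutPow m (κ i)
  have hexpm := hexp (fun z => z ^ m) (contDiff_id.pow m)
  let φ : ℕ → EE N → ℝ := fun n y => A y * cutPowScaled m (n + 1) (y 0)
  have hφs : ∀ n, ContDiff ℝ ∞ (φ n) := fun n => smooth_mul_coord hA (smooth_cutPowScaled m _)
  have hφc : ∀ n, HasCompactSupport (φ n) := fun n => hc.mul_right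
  have hφsub : ∀ n, tsupport (φ n) ⊆ hs N := by
    intro n y hy
    have hcl : IsClosed {y : EE N | 1 / 2 ≤ ((n:ℝ) + 1) * y 0} :=
      isClosed_le continuous_const (by fun_prop)
    have hsub : Function.support (φ n) ⊆ {y : EE N | 1 / 2 ≤ ((n:ℝ) + 1) * y 0} := by
      intro y hy
      by_contra hcon
      refine hy ?_
      have : ((n:ℝ) + 1) * y 0 ≤ 1 / 2 := (not_le.1 hcon).le
      simp [φ, cutPowScaled, cutPow_of_le this]
    have : 1 / 2 ≤ ((n:ℝ) + 1) * y 0 := closure_minimal hsub hcl hy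
    have hn : (0:ℝ) < n + 1 := by positivity
    rw [mem_hs]
    by_contra hcon
    nlinarith
  have hz1 : ∀ n y, y ∉ hs N → φ n y = 0 := fun n y hy =>
    image_eq_zero_of_notMem_tsupport fun h => hy (hφsub n h)
  have hz2 : ∀ n y, y ∉ hs N → lap^[m] (φ n) y = 0 := fun n y hy =>
    image_eq_zero_of_notMem_tsupport fun h => hy (hφsub n (support_lap_iterate_subset m _ h))
  have heq : ∀ n, ∫ y in hs N, u y * lap^[m] (φ n) y =
      (-1) ^ m * ∫ y in hs N, u y ^ q * φ n y := by
    intro n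
    rw [setIntegral_eq_integral_of_forall_compl_eq_zero fun y hy => by rw [hz2 n y hy, mul_zero],
      setIntegral_eq_integral_of_forall_compl_eq_zero fun y hy => by rw [hz1 n y hy, mul_zero]]
    exact h.integral_mul_lap_iterate_of_tsupport_subset (hφs n) (hφc n) (hφsub n)
  have hlarge : ∀ y ∈ hs N, ∀ᶠ n : ℕ in atTop, 1 < ((n:ℝ) + 1) * y 0 := by
    intro y hy
    have : Tendsto (fun n : ℕ => ((n:ℝ) + 1) * y 0) atTop atTop :=
      (tendsto_atTop_add_const_right _ _ tendsto_natCast_atTop_atTop).atTop_mul_const hy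
    exact this.eventually_gt_atTop 1
  have hL : Tendsto (fun n => ∫ y in hs N, u y * lap^[m] (φ n) y) atTop
      (𝓝 (∫ y in hs N, u y * lap^[m] (fun y => A y * y 0 ^ m) y)) := by
    refine tendsto_integral_of_dominated_convergence
      (fun y => ∑ i, |B i y| * (C * W i + M * |iteratedDeriv (κ i) (fun z => z ^ m) (y 0)|))
      ?_ ?_ ?_ ?_
    · intro n
      exact h.aestronglyMeasurable.mul
        (smooth_lap_iterate m (hφs n)).continuous.aestronglyMeasurable
    · refine Integrable.integrableOn ?_
      refine integrable_finsetSum _ fun i _ => ?_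
      have hi : Continuous (iteratedDeriv (κ i) (fun z : ℝ => z ^ m)) :=
        (smooth_iteratedDeriv (contDiff_id.pow m) _).continuous
      refine Continuous.integrable_of_hasCompactSupport ?_ ?_
      · have := (hB i).continuous
        have h2 := hi.comp (continuous_coord (0 : Fin N))
        exact this.abs.mul (continuous_const.add (continuous_const.mul h2.abs))
      · exact HasCompactSupport.mul_right ((hBc i).comp_left (g := fun t => |t|) abs_zero)
    · intro n
      filter_upwards [ae_restrict_mem measurableSet_hs] with y hy
      have hy0 : 0 < y 0 := hy
      have hn : (0:ℝ) < n + 1 := by positivity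
      have hn1 : (1:ℝ) ≤ n + 1 := by linarith [(Nat.cast_nonneg n : (0:ℝ) ≤ n)]
      have hyc := hs_subset_chs hy
      rw [show φ n = fun y => A y * cutPowScaled m (n + 1) (y 0) from rfl,
        hexp _ (smooth_cutPowScaled m _), Finset.mul_sum]
      refine (norm_sum_le _ _).trans (Finset.sum_le_sum fun i _ => ?_)
      rw [Real.norm_eq_abs, abs_mul, abs_mul]
      have hkey : |u y| * |iteratedDeriv (κ i) (cutPowScaled m (n + 1)) (y 0)| ≤
          C * W i + M * |iteratedDeriv (κ i) (fun z => z ^ m) (y 0)| := by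
        have p1 : 0 ≤ C * W i := mul_nonneg hC0.le (hW0 i)
        have p2 : 0 ≤ M * |iteratedDeriv (κ i) (fun z => z ^ m) (y 0)| :=
          mul_nonneg hM0.le (abs_nonneg _)
        rcases lt_or_ge 1 (((n:ℝ) + 1) * y 0) with h1 | h1
        · rw [iteratedDeriv_cutPowScaled_of_gt hn h1]
          have := mul_le_mul_of_nonneg_right (hM y hyc)
            (abs_nonneg (iteratedDeriv (κ i) (fun z => z ^ m) (y 0)))
          linarith
        · rw [iteratedDeriv_cutPowScaled]
          have hw := hW i (((n:ℝ) + 1) * y 0) (by positivity) h1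
          have hu : |u y| ≤ C * (((n:ℝ) + 1) ^ m)⁻¹ := by
            refine (hC y hyc).trans (mul_le_mul_of_nonneg_left ?_ hC0.le)
            rw [← inv_pow]
            refine pow_le_pow_left₀ hy0.le ?_ _
            rw [← one_div, le_div_iff₀ hn]; linarith
          have hk : ((n:ℝ) + 1) ^ κ i ≤ ((n:ℝ) + 1) ^ m * ((n:ℝ) + 1) ^ m := by
            rw [← pow_add, ← two_mul]
            exact pow_le_pow_right₀ hn1 (hκ i)
          rw [abs_mul, abs_mul, abs_of_pos (by positivity : 0 < (((n:ℝ) + 1) ^ m)⁻¹),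
            abs_of_pos (by positivity : 0 < ((n:ℝ) + 1) ^ κ i)]
          have : |u y| * ((((n:ℝ) + 1) ^ m)⁻¹ * (((n:ℝ) + 1) ^ κ i *
              |iteratedDeriv (κ i) (cutPow m) (((n:ℝ) + 1) * y 0)|)) ≤
              (C * (((n:ℝ) + 1) ^ m)⁻¹) * ((((n:ℝ) + 1) ^ m)⁻¹ *
              ((((n:ℝ) + 1) ^ m * ((n:ℝ) + 1) ^ m) * W i)) := by
            gcongr
          refine this.trans ?_
          have e : (C * (((n:ℝ) + 1) ^ m)⁻¹) * ((((n:ℝ) + 1) ^ m)⁻¹ *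
              ((((n:ℝ) + 1) ^ m * ((n:ℝ) + 1) ^ m) * W i)) = C * W i := by
            field_simp
          rw [e]; linarith
      calc |u y| * (|B i y| * |iteratedDeriv (κ i) (cutPowScaled m (n + 1)) (y 0)|)
          = |B i y| * (|u y| * |iteratedDeriv (κ i) (cutPowScaled m (n + 1)) (y 0)|) := by ring
        _ ≤ _ := mul_le_mul_of_nonneg_left hkey (abs_nonneg _)
    · filter_upwards [ae_restrict_mem measurableSet_hs] with y hy
      refine tendsto_const_nhds.congr' ?_
      filter_upwards [hlarge y hy] with n hn
      rw [show φ n = fun y => A y * cutPowScaled m (n + 1) (y 0) from rfl,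
        hexp _ (smooth_cutPowScaled m _), hexpm]
      simp only [iteratedDeriv_cutPowScaled_of_gt (by positivity : (0:ℝ) < n + 1) hn]
  have hR : Tendsto (fun n => ∫ y in hs N, u y ^ q * φ n y) atTop
      (𝓝 (∫ y in hs N, u y ^ q * (A y * y 0 ^ m))) := by
    refine tendsto_integral_of_dominated_convergence
      (fun y => M ^ q * |A y * y 0 ^ m|) ?_ ?_ ?_ ?_
    · intro n
      exact (h.aestronglyMeasurable_rpow hq).mul (hφs n).continuous.aestronglyMeasurable
    · refine Integrable.integrableOn (Integrable.const_mul (Integrable.abs ?_) _)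
      refine Continuous.integrable_of_hasCompactSupport ?_ hc.mul_right
      exact hA.continuous.mul ((continuous_coord 0).pow m)
    · intro n
      filter_upwards [ae_restrict_mem measurableSet_hs] with y hy
      have hy0 : 0 < y 0 := hy
      have hu0 := hpos y hy0.le
      have hn : (0:ℝ) < n + 1 := by positivity
      have hle : |cutPowScaled m (n + 1) (y 0)| ≤ y 0 ^ m := by
        have e : cutPowScaled m (n + 1) (y 0) =
            y 0 ^ m * Real.smoothTransition (2 * ((n + 1) * y 0) - 1) := by
          simp only [cutPowScaled, cutPow, mul_pow]
          field_simp
        rw [e, abs_of_nonneg (mul_nonneg (by positivity) (Real.smoothTransition.nonneg _))]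
        exact mul_le_of_le_one_right (by positivity) (Real.smoothTransition.le_one _)
      rw [Real.norm_eq_abs, abs_mul, abs_of_nonneg (Real.rpow_nonneg hu0 q), abs_mul,
        abs_mul, abs_of_pos (by positivity : 0 < y 0 ^ m)]
      have := (abs_le.1 (hM y (hs_subset_chs hy))).2
      gcongr
    · filter_upwards [ae_restrict_mem measurableSet_hs] with y hy
      refine tendsto_const_nhds.congr' ?_
      filter_upwards [hlarge y hy] with n hn
      simp only [φ, cutPowScaled_eq_pow (by positivity : (0:ℝ) < n + 1) hn.le]
  exact tendsto_nhds_unique (hL.congr heq) (hR.const_mul _)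

end IsBCSol

/-- `∫₀¹ σ^k f(s + tσ) dσ` as a function of `(s,t)`. -/
noncomputable def rI (k : ℕ) (f : ℝ → ℝ) (p : ℝ × ℝ) : ℝ :=
  ∫ σ in (0:ℝ)..1, σ ^ k * f (p.1 + p.2 * σ)

lemma continuous_rI (k : ℕ) {f : ℝ → ℝ} (hf : Continuous f) : Continuous (rI k f) := by
  unfold rI
  refine intervalIntegral.continuous_parametric_intervalIntegral_of_continuous' ?_ 0 1
  fun_prop

lemma hasFDerivAt_rI (k : ℕ) {f : ℝ → ℝ} (hf : ContDiff ℝ ∞ f) (p : ℝ × ℝ) :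
    HasFDerivAt (rI k f) (rI k (deriv f) p • ContinuousLinearMap.fst ℝ ℝ ℝ +
      rI (k + 1) (deriv f) p • ContinuousLinearMap.snd ℝ ℝ ℝ) p := by
  have hf' := (smooth_deriv hf).continuous
  let F' : ℝ × ℝ → ℝ → (ℝ × ℝ →L[ℝ] ℝ) := fun p σ =>
    (σ ^ k * deriv f (p.1 + p.2 * σ)) • ContinuousLinearMap.fst ℝ ℝ ℝ +
      (σ ^ (k + 1) * deriv f (p.1 + p.2 * σ)) • ContinuousLinearMap.snd ℝ ℝ ℝ
  have hF'c : Continuous (fun x : (ℝ × ℝ) × ℝ => F' x.1 x.2) := by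
    have h1 : Continuous (fun x : (ℝ × ℝ) × ℝ => deriv f (x.1.1 + x.1.2 * x.2)) := by fun_prop
    exact (((continuous_snd.pow k).mul h1).smul continuous_const).add
      (((continuous_snd.pow (k + 1)).mul h1).smul continuous_const)
  obtain ⟨C, hC⟩ := ((isCompact_closedBall p 1).prod
    (isCompact_Icc (a := (0:ℝ)) (b := 1))).exists_bound_of_continuousOn hF'c.continuousOn
  have := intervalIntegral.hasFDerivAt_integral_of_dominated_of_fderiv_le (μ := volume)
    (F := fun (p : ℝ × ℝ) (σ : ℝ) => σ ^ k * f (p.1 + p.2 * σ)) (F' := F') (x₀ := p)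
    (a := 0) (b := 1) (bound := fun _ => C) (Metric.closedBall_mem_nhds p one_pos)
    (Eventually.of_forall fun x => (by
      have := hf.continuous; fun_prop : Continuous fun σ : ℝ => σ ^ k * f (x.1 + x.2 * σ)).aestronglyMeasurable)
    ((by
      have := hf.continuous; fun_prop :
        Continuous fun σ : ℝ => σ ^ k * f (p.1 + p.2 * σ)).intervalIntegrable _ _)
    (hF'c.comp (Continuous.prodMk_right p)).aestronglyMeasurable
    (Eventually.of_forall fun t ht x hx => hC (x, t) ⟨hx, by
      rw [uIoc_of_le zero_le_one] at ht; exact ⟨ht.1.le, ht.2⟩⟩)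
    intervalIntegrable_const
    (Eventually.of_forall fun t ht x hx => by
      have h1 : HasFDerivAt (fun p : ℝ × ℝ => p.1 + p.2 * t)
          (ContinuousLinearMap.fst ℝ ℝ ℝ + t • ContinuousLinearMap.snd ℝ ℝ ℝ) x := by
        refine hasFDerivAt_fst.add ?_
        simpa [mul_comm] using (hasFDerivAt_snd (𝕜 := ℝ) (E := ℝ) (F := ℝ) (p := x)).mul_const t
      have h2 := (smooth_differentiable hf (x.1 + x.2 * t)).hasDerivAt.comp_hasFDerivAt x h1
      have h3 := h2.const_mul (t ^ k)
      refine h3.congr_fderiv ?_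
      ext <;> simp [F']
      ring)
  refine this.congr_fderiv ?_
  have hi : ∀ j, IntervalIntegrable (fun t : ℝ => t ^ j * deriv f (p.1 + p.2 * t)) volume 0 1 :=
    fun j => (by fun_prop : Continuous fun t : ℝ => t ^ j * deriv f (p.1 + p.2 * t)).intervalIntegrable _ _
  rw [intervalIntegral.integral_add, intervalIntegral.integral_smul_const,
    intervalIntegral.integral_smul_const]
  · rfl
  · exact (by fun_prop : Continuous fun t : ℝ => (t ^ k * deriv f (p.1 + p.2 * t)) •
      ContinuousLinearMap.fst ℝ ℝ ℝ).intervalIntegrable _ _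
  · exact (by fun_prop : Continuous fun t : ℝ => (t ^ (k + 1) * deriv f (p.1 + p.2 * t)) •
      ContinuousLinearMap.snd ℝ ℝ ℝ).intervalIntegrable _ _

lemma smooth_rI (k : ℕ) {f : ℝ → ℝ} (hf : ContDiff ℝ ∞ f) : ContDiff ℝ ∞ (rI k f) := by
  refine contDiff_infty.2 fun n => ?_
  induction n generalizing k f with
  | zero => exact contDiff_zero.2 (continuous_rI k hf.continuous)
  | succ n ih =>
    refine contDiff_succ_iff_hasFDerivAt.2 ⟨_, ?_, fun x => hasFDerivAt_rI k hf x⟩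
    exact ((ih k (smooth_deriv hf)).smul contDiff_const).add
      ((ih (k + 1) (smooth_deriv hf)).smul contDiff_const)

lemma pow_mul_rI (k : ℕ) (f : ℝ → ℝ) (s t : ℝ) :
    t ^ (k + 1) * rI k f (s, t) = ∫ τ in (0:ℝ)..t, τ ^ k * f (s + τ) := by
  have := intervalIntegral.smul_integral_comp_mul_left (a := 0) (b := 1)
    (fun τ : ℝ => τ ^ k * f (s + τ)) t
  rw [mul_zero, mul_one] at this
  rw [← this, rI, pow_succ', mul_assoc, ← intervalIntegral.integral_const_mul, smul_eq_mul]
  congr 1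
  refine intervalIntegral.integral_congr fun σ _ => ?_
  simp only [mul_pow]; ring

lemma integral_pow_mul_iteratedDeriv (k : ℕ) {h : ℝ → ℝ} (hh : ContDiff ℝ ∞ h) (s t : ℝ) :
    ∫ τ in (0:ℝ)..t, τ ^ k * iteratedDeriv (k + 1) h (s + τ) =
      (-1) ^ (k + 1) * k.factorial * (h s - ∑ j ∈ Finset.range (k + 1),
        iteratedDeriv j h (s + t) * (-t) ^ j / j.factorial) := by
  have hd : ∀ j τ, HasDerivAt (fun τ => iteratedDeriv j h (s + τ))
      (iteratedDeriv (j + 1) h (s + τ)) τ := fun j τ => by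
    have h1 := (smooth_differentiable (smooth_iteratedDeriv hh j) (s + τ)).hasDerivAt
    rw [← iteratedDeriv_succ] at h1
    exact h1.comp_const_add s τ
  have hcont : ∀ j, Continuous fun τ => iteratedDeriv j h (s + τ) := fun j =>
    (smooth_iteratedDeriv hh j).continuous.comp (continuous_const.add continuous_id)
  induction k with
  | zero =>
    simp only [pow_zero, one_mul, zero_add, Finset.range_one, Finset.sum_singleton]
    rw [intervalIntegral.integral_eq_sub_of_hasDerivAt (fun x _ => hd 0 x)
      ((hcont 1).intervalIntegrable _ _)]
    simp
  | succ k ih =>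
    rw [intervalIntegral.integral_mul_deriv_eq_deriv_mul (u := fun τ => τ ^ (k + 1))
      (u' := fun τ => ((k + 1 : ℕ) : ℝ) * τ ^ k) (v := fun τ => iteratedDeriv (k + 1) h (s + τ))
      (fun x _ => by simpa using hasDerivAt_pow (k + 1) x) (fun x _ => hd (k + 1) x)
      ((by fun_prop : Continuous fun τ : ℝ => ((k + 1 : ℕ) : ℝ) * τ ^ k).intervalIntegrable _ _)
      ((hcont _).intervalIntegrable _ _)]
    simp only [mul_assoc]
    rw [intervalIntegral.integral_const_mul, ih, Finset.sum_range_succ _ (k + 1),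
      Nat.factorial_succ]
    have hf : (k.factorial : ℝ) ≠ 0 := by positivity
    have hk : ((k : ℝ) + 1) ≠ 0 := by positivity
    have hsq : ((-1 : ℝ) ^ (k + 1)) * (-1) ^ (k + 1) = 1 := by rw [← mul_pow]; simp
    rw [neg_pow t (k + 1)]
    push_cast
    field_simp
    rw [pow_succ (-1 : ℝ) (k + 1)]
    ring_nf
    ring_nf at hsq
    simp only [hsq]
    ring

lemma exists_iteratedDeriv_eq (m : ℕ) {f : ℝ → ℝ} (hf : ContDiff ℝ ∞ f) :
    ∃ h : ℝ → ℝ, ContDiff ℝ ∞ h ∧ iteratedDeriv m h = f := by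
  induction m with
  | zero => exact ⟨f, hf, by simp⟩
  | succ m ih =>
    obtain ⟨g, hg, hgf⟩ := ih
    have hd : ∀ x, HasDerivAt (fun x => ∫ t in (0:ℝ)..x, g t) (g x) x := fun x =>
      hg.continuous.integral_hasStrictDerivAt 0 x |>.hasDerivAt
    have hde : deriv (fun x => ∫ t in (0:ℝ)..x, g t) = g := funext fun x => (hd x).deriv
    refine ⟨fun x => ∫ t in (0:ℝ)..x, g t, ?_, ?_⟩
    · rw [contDiff_infty_iff_deriv, hde]
      exact ⟨fun x => (hd x).differentiableAt, hg⟩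
    · rw [iteratedDeriv_succ', hde, hgf]

lemma lap_iterate_sum {N : ℕ} (n : ℕ) {ι : Type*} (s : Finset ι) {f : ι → EE N → ℝ}
    (hf : ∀ j ∈ s, ContDiff ℝ ∞ (f j)) :
    lap^[n] (fun y => ∑ j ∈ s, f j y) = fun y => ∑ j ∈ s, lap^[n] (f j) y := by
  induction n with
  | zero => rfl
  | succ n ih =>
    simp only [Function.iterate_succ_apply', ih]
    exact funext fun y => lap_sum s (fun j hj => smooth_lap_iterate n (hf j hj)) y

lemma lap_iterate_const_mul {N : ℕ} (n : ℕ) (c : ℝ) {f : EE N → ℝ} (hf : ContDiff ℝ ∞ f) :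
    lap^[n] (fun y => c * f y) = fun y => c * lap^[n] f y := by
  induction n with
  | zero => rfl
  | succ n ih =>
    simp only [Function.iterate_succ_apply', ih]
    exact funext fun y => lap_const_mul c (smooth_lap_iterate n hf) y

lemma lap_iterate_add {N : ℕ} (n : ℕ) {f g : EE N → ℝ} (hf : ContDiff ℝ ∞ f)
    (hg : ContDiff ℝ ∞ g) :
    lap^[n] (fun y => f y + g y) = fun y => lap^[n] f y + lap^[n] g y := by
  have := lap_iterate_sum n (Finset.univ : Finset (Fin 2)) (f := ![f, g])
    (by intro j _; fin_cases j <;> simpa)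
  simpa [Fin.sum_univ_two] using this

lemma pd_comm {N : ℕ} (i j : Fin N) {f : EE N → ℝ} (hf : ContDiff ℝ ∞ f) (x : EE N) :
    pd i (pd j f) x = pd j (pd i f) x := by
  have h2 : DifferentiableAt ℝ (fderiv ℝ f) x :=
    (hf.fderiv_right (m := 1) (by exact smooth_two_le)).differentiable (by simp) x
  have hs : ∀ i j : Fin N, pd i (pd j f) x = fderiv ℝ (fderiv ℝ f) x
      (EuclideanSpace.single i 1) (EuclideanSpace.single j 1) := fun i j => by
    unfold pd
    rw [fderiv_clm_apply h2 (by fun_prop)]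
    simp
  have hsymm : IsSymmSndFDerivAt ℝ f x :=
    (hf.contDiffAt.of_le smooth_two_le).isSymmSndFDerivAt (by simp)
  rw [hs, hs, hsymm]

lemma lap_pd {N : ℕ} (i : Fin N) {f : EE N → ℝ} (hf : ContDiff ℝ ∞ f) :
    lap (pd i f) = pd i (lap f) := by
  rw [lap_fun_eq (hf.of_le smooth_two_le), lap_fun_eq ((smooth_pd i hf).of_le smooth_two_le)]
  funext x
  rw [pd_sum i _ fun j _ => smooth_differentiable (smooth_pd j (smooth_pd j hf)) x]
  refine Finset.sum_congr rfl fun j _ => ?_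
  rw [pd_comm i j (smooth_pd j hf), show pd i (pd j f) = pd j (pd i f) from
    funext fun y => pd_comm i j hf y]

lemma lap_iterate_pd {N : ℕ} (n : ℕ) (i : Fin N) {f : EE N → ℝ} (hf : ContDiff ℝ ∞ f) :
    lap^[n] (pd i f) = pd i (lap^[n] f) := by
  induction n with
  | zero => rfl
  | succ n ih => rw [Function.iterate_succ_apply', ih, lap_pd i (smooth_lap_iterate n hf),
      Function.iterate_succ_apply']

lemma lap_iterate_eq_zero {N : ℕ} (n : ℕ) {U : Set (EE N)} (hU : IsOpen U) {g : EE N → ℝ}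
    (hg : ∀ x ∈ U, g x = 0) : ∀ x ∈ U, lap^[n] g x = 0 := by
  intro x hx
  have h0 : g =ᶠ[𝓝 x] fun _ => 0 := by
    filter_upwards [hU.mem_nhds hx] with y hy using hg y hy
  rw [(lap_iterate_congr n h0).self_of_nhds]
  have : ∀ n, lap^[n] (fun _ : EE N => (0:ℝ)) = fun _ => 0 := by
    intro n
    induction n with
    | zero => rfl
    | succ n ih => rw [Function.iterate_succ_apply', ih]; funext y; simp [lap]
  rw [this]

lemma pd_eq_zero {N : ℕ} (i : Fin N) {U : Set (EE N)} (hU : IsOpen U) {g : EE N → ℝ}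
    (hg : ∀ x ∈ U, g x = 0) : ∀ x ∈ U, pd i g x = 0 := by
  intro x hx
  have h0 : g =ᶠ[𝓝 x] fun _ => 0 := by
    filter_upwards [hU.mem_nhds hx] with y hy using hg y hy
  unfold pd
  rw [h0.fderiv_eq]; simp

/-- If `Δ^j g = 0` then `Δ^n (y₁^k g) = 0` for `n ≥ k + j`. -/
lemma lap_iterate_mul_pow_eq_zero {N : ℕ} [NeZero N] {U : Set (EE N)} (hU : IsOpen U) (n : ℕ) :
    ∀ (k j : ℕ) (g : EE N → ℝ), ContDiff ℝ ∞ g → (∀ x ∈ U, lap^[j] g x = 0) → k + j ≤ n →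
      ∀ x ∈ U, lap^[n] (fun y => g y * y 0 ^ k) x = 0 := by
  induction n with
  | zero =>
    intro k j g hg h0 hkj x hx
    obtain ⟨rfl, rfl⟩ : k = 0 ∧ j = 0 := by omega
    have : g x = 0 := h0 x hx
    simp [this]
  | succ n ih =>
    intro k j g hg h0 hkj x hx
    rcases Nat.eq_zero_or_pos j with rfl | hj
    · have h0 : ∀ x ∈ U, g x = 0 := h0
      exact lap_iterate_eq_zero (n + 1) hU (fun y hy => by rw [h0 y hy, zero_mul]) x hx
    obtain ⟨j, rfl⟩ : ∃ i, j = i + 1 := ⟨j - 1, by omega⟩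
    have hd1 : deriv (fun z : ℝ => z ^ k) = fun z => (k:ℝ) * z ^ (k - 1) := by
      funext z; simp
    have hd2 : deriv (fun z : ℝ => (k:ℝ) * z ^ (k - 1)) =
        fun z => (k:ℝ) * ((k - 1 : ℕ) * z ^ (k - 1 - 1)) := by
      funext z; rw [deriv_const_mul _ (by fun_prop)]; simp
    have e : lap (fun y => g y * y 0 ^ k) = fun y => (lap g y * y 0 ^ k +
        (2 * k) * (pd 0 g y * y 0 ^ (k - 1))) + (k * (k - 1 : ℕ)) * (g y * y 0 ^ (k - 1 - 1)) := by
      funext y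
      rw [lap_mul_coord (ζ := fun z => z ^ k) hg (contDiff_id.pow k), hd1, hd2]
      ring
    have hpow : ∀ l, ContDiff ℝ ∞ (fun y : EE N => y 0 ^ l) := fun l => (smooth_coord 0).pow l
    have s1 : ContDiff ℝ ∞ (fun y => lap g y * y 0 ^ k) := (smooth_lap hg).mul (hpow _)
    have s2 : ContDiff ℝ ∞ (fun y => pd 0 g y * y 0 ^ (k - 1)) := (smooth_pd 0 hg).mul (hpow _)
    have s3 : ContDiff ℝ ∞ (fun y => g y * y 0 ^ (k - 1 - 1)) := hg.mul (hpow _)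
    rw [Function.iterate_succ_apply, e, lap_iterate_add n (s1.add (contDiff_const.mul s2))
      (contDiff_const.mul s3), lap_iterate_add n s1 (contDiff_const.mul s2),
      lap_iterate_const_mul n _ s2, lap_iterate_const_mul n _ s3]
    have t1 : lap^[n] (fun y => lap g y * y 0 ^ k) x = 0 :=
      ih k j (lap g) (smooth_lap hg) (fun y hy => h0 y hy) (by omega) x hx
    have t2 : (2 * k : ℝ) * lap^[n] (fun y => pd 0 g y * y 0 ^ (k - 1)) x = 0 := by
      rcases Nat.eq_zero_or_pos k with rfl | hk
      · simp
      · rw [ih (k - 1) (j + 1) (pd 0 g) (smooth_pd 0 hg) (fun y hy => by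
          rw [lap_iterate_pd _ _ hg]; exact pd_eq_zero 0 hU h0 y hy) (by omega) x hx, mul_zero]
    have t3 : (k * (k - 1 : ℕ) : ℝ) * lap^[n] (fun y => g y * y 0 ^ (k - 1 - 1)) x = 0 := by
      rcases Nat.lt_or_ge k 2 with hk | hk
      · interval_cases k <;> simp
      · rw [ih (k - 1 - 1) (j + 1) g hg h0 (by omega) x hx, mul_zero]
    simp only [t1, t2, t3, add_zero]

/-- The operator `F ↦ 4ρF' + cF`. -/
noncomputable def LO (c : ℝ) (F : ℝ → ℝ) (ρ : ℝ) : ℝ := 4 * ρ * deriv F ρ + c * F ρ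

/-- The composition of `LO (2 * N + 4 * j)` over `j < m`, the largest `j` acting first. -/
noncomputable def LOs (N : ℕ) : ℕ → (ℝ → ℝ) → ℝ → ℝ
  | 0, F => F
  | m + 1, F => LOs N m (LO (2 * N + 4 * m) F)

/-- The Laplacian acting on functions of `|y - a|²`. -/
noncomputable def radL (N : ℕ) (g : ℝ → ℝ) : ℝ → ℝ := LO (2 * N) (deriv g)

lemma smooth_LO (c : ℝ) {F : ℝ → ℝ} (hF : ContDiff ℝ ∞ F) : ContDiff ℝ ∞ (LO c F) :=
  ((contDiff_const.mul contDiff_id).mul (smooth_deriv hF)).add (contDiff_const.mul hF)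

lemma smooth_radL (N : ℕ) {g : ℝ → ℝ} (hg : ContDiff ℝ ∞ g) : ContDiff ℝ ∞ (radL N g) :=
  smooth_LO _ (smooth_deriv hg)

lemma smooth_LOs (N m : ℕ) {F : ℝ → ℝ} (hF : ContDiff ℝ ∞ F) : ContDiff ℝ ∞ (LOs N m F) := by
  induction m generalizing F with
  | zero => exact hF
  | succ m ih => exact ih (smooth_LO _ hF)

lemma deriv_LO (c : ℝ) {F : ℝ → ℝ} (hF : ContDiff ℝ ∞ F) :
    deriv (LO c F) = LO (c + 4) (deriv F) := by
  funext ρ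
  have h1 := (smooth_differentiable hF ρ).hasDerivAt
  have h2 := (smooth_differentiable (smooth_deriv hF) ρ).hasDerivAt
  have h3 : HasDerivAt (fun ρ : ℝ => 4 * ρ) 4 ρ := by simpa using (hasDerivAt_id ρ).const_mul 4
  have := ((h3.mul h2).add (h1.const_mul c)).deriv
  unfold LO
  refine Eq.trans this ?_
  ring

lemma iteratedDeriv_LO (j : ℕ) (c : ℝ) {F : ℝ → ℝ} (hF : ContDiff ℝ ∞ F) :
    iteratedDeriv j (LO c F) = LO (c + 4 * j) (iteratedDeriv j F) := by
  induction j with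
  | zero => simp
  | succ j ih =>
    rw [iteratedDeriv_succ, ih, deriv_LO _ (smooth_iteratedDeriv hF j), iteratedDeriv_succ]
    push_cast; ring_nf

lemma iterate_radL (N m : ℕ) {g : ℝ → ℝ} (hg : ContDiff ℝ ∞ g) :
    (radL N)^[m] g = LOs N m (iteratedDeriv m g) := by
  induction m generalizing g with
  | zero => simp [LOs]
  | succ m ih =>
    rw [Function.iterate_succ_apply, ih (smooth_radL N hg), LOs, radL,
      iteratedDeriv_LO _ _ (smooth_deriv hg), iteratedDeriv_succ']

lemma LO_congr_ev (c : ℝ) {F G : ℝ → ℝ} {ρ : ℝ} (h : F =ᶠ[𝓝 ρ] G) :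
    LO c F =ᶠ[𝓝 ρ] LO c G := by
  filter_upwards [h.eventuallyEq_nhds] with x hx
  simp only [LO, hx.deriv_eq, hx.self_of_nhds]

lemma LOs_congr_ev (N m : ℕ) {F G : ℝ → ℝ} {ρ : ℝ} (h : F =ᶠ[𝓝 ρ] G) :
    LOs N m F =ᶠ[𝓝 ρ] LOs N m G := by
  induction m generalizing F G with
  | zero => exact h
  | succ m ih => exact ih (LO_congr_ev _ h)

lemma LO_const_mul (c a : ℝ) (F : ℝ → ℝ) : LO c (fun x => a * F x) = fun x => a * LO c F x := by
  funext ρ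
  simp only [LO, deriv_const_mul_field]
  ring

lemma LOs_const_mul (N m : ℕ) (a : ℝ) (F : ℝ → ℝ) :
    LOs N m (fun x => a * F x) = fun x => a * LOs N m F x := by
  induction m generalizing F with
  | zero => rfl
  | succ m ih => simp only [LOs, LO_const_mul, ih]

lemma LO_comp_mul (c b : ℝ) (F : ℝ → ℝ) : LO c (fun x => F (b * x)) = fun x => LO c F (b * x) := by
  funext ρ
  simp only [LO, deriv_comp_mul_left, smul_eq_mul]
  ring

lemma LOs_comp_mul (N m : ℕ) (b : ℝ) (F : ℝ → ℝ) :
    LOs N m (fun x => F (b * x)) = fun x => LOs N m F (b * x) := by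
  induction m generalizing F with
  | zero => rfl
  | succ m ih => simp only [LOs, LO_comp_mul, ih]

lemma LO_rpow_ev (N j : ℕ) {ρ : ℝ} (hρ : 0 < ρ) :
    LO (2 * N + 4 * j) (fun x : ℝ => x ^ (-(N:ℝ) / 2)) =ᶠ[𝓝 ρ]
      fun x => (4 * j) * x ^ (-(N:ℝ) / 2) := by
  filter_upwards [isOpen_Ioi.mem_nhds hρ] with x hx
  have hx : 0 < x := hx
  rw [LO, (Real.hasDerivAt_rpow_const (Or.inl hx.ne')).deriv, Real.rpow_sub_one hx.ne']
  field_simp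
  ring

lemma LOs_rpow_ev (N m : ℕ) {ρ : ℝ} (hρ : 0 < ρ) :
    LOs N m (fun x : ℝ => x ^ (-(N:ℝ) / 2)) =ᶠ[𝓝 ρ]
      fun x => (∏ j ∈ Finset.range m, (4 * j : ℝ)) * x ^ (-(N:ℝ) / 2) := by
  induction m with
  | zero => simp [LOs]
  | succ m ih =>
    refine (LOs_congr_ev N m (LO_rpow_ev N m hρ)).trans ?_
    rw [LOs_const_mul]
    filter_upwards [ih] with x hx
    rw [hx, Finset.prod_range_succ]; ring

lemma LOs_eq_zero_of_ev {N m : ℕ} (hm : 0 < m) {F : ℝ → ℝ} {ρ : ℝ} (hρ : 0 < ρ)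
    (h : F =ᶠ[𝓝 ρ] fun x => x ^ (-(N:ℝ) / 2)) : LOs N m F ρ = 0 := by
  rw [((LOs_congr_ev N m h).trans (LOs_rpow_ev N m hρ)).self_of_nhds]
  show (∏ j ∈ Finset.range m, (4 * j : ℝ)) * _ = 0
  rw [Finset.prod_eq_zero (Finset.mem_range.2 hm) (by simp), zero_mul]

lemma smooth_normsq_sub {N : ℕ} (a : EE N) {n : WithTop ℕ∞} :
    ContDiff ℝ n (fun y : EE N => ‖y - a‖ ^ 2) :=
  (contDiff_id.sub contDiff_const).norm_sq ℝ

lemma pd_normsq_sub {N : ℕ} (i : Fin N) (a x : EE N) :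
    pd i (fun y : EE N => ‖y - a‖ ^ 2) x = 2 * (x i - a i) := by
  have h1 := ((hasFDerivAt_id x).sub_const a).norm_sq
  unfold pd
  have h3 : fderiv ℝ (fun y : EE N => ‖y - a‖ ^ 2) x = _ := h1.fderiv
  rw [h3]
  simp [EuclideanSpace.inner_single_right]

lemma lap_radial {N : ℕ} (a : EE N) {g : ℝ → ℝ} (hg : ContDiff ℝ ∞ g) :
    lap (fun y : EE N => g (‖y - a‖ ^ 2)) = fun y => radL N g (‖y - a‖ ^ 2) := by
  have hcomp : ∀ (g : ℝ → ℝ), ContDiff ℝ ∞ g → ∀ i x,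
      pd i (fun y : EE N => g (‖y - a‖ ^ 2)) x =
        deriv g (‖x - a‖ ^ 2) * (2 * (x i - a i)) := fun g hg i x => by
    have h1 : HasFDerivAt (fun y : EE N => ‖y - a‖ ^ 2) _ x :=
      (smooth_differentiable (smooth_normsq_sub a) x).hasFDerivAt
    have h2 := (smooth_differentiable hg (‖x - a‖ ^ 2)).hasDerivAt.comp_hasFDerivAt x h1
    have h3 : fderiv ℝ (fun y : EE N => g (‖y - a‖ ^ 2)) x = _ := h2.fderiv
    rw [← pd_normsq_sub i a x]
    unfold pd
    rw [h3]; simp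
  have hs : ContDiff ℝ ∞ (fun y : EE N => g (‖y - a‖ ^ 2)) := hg.comp (smooth_normsq_sub a)
  have hs' : ContDiff ℝ ∞ (fun y : EE N => deriv g (‖y - a‖ ^ 2)) :=
    (smooth_deriv hg).comp (smooth_normsq_sub a)
  funext x
  rw [lap_eq_sum_pd (hs.of_le smooth_two_le).contDiffAt]
  have h2 : ∀ i, pd i (pd i fun y : EE N => g (‖y - a‖ ^ 2)) x =
      4 * (x i - a i) ^ 2 * deriv (deriv g) (‖x - a‖ ^ 2) + 2 * deriv g (‖x - a‖ ^ 2) := by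
    intro i
    rw [show (pd i fun y : EE N => g (‖y - a‖ ^ 2)) = fun x => deriv g (‖x - a‖ ^ 2) *
      (2 * (x i - a i)) from funext (hcomp g hg i), pd_mul i (smooth_differentiable hs' x)
        (by fun_prop), hcomp _ (smooth_deriv hg)]
    have := pd_comp_coord i i (ζ := fun z => 2 * (z - a i)) (by fun_prop) x
    rw [this]
    have hd : deriv (fun z : ℝ => 2 * (z - a i)) (x i) = 2 := by
      rw [deriv_const_mul _ (by fun_prop)]; simp
    simp only [if_true, hd]
    ring
  have hn : ‖x - a‖ ^ 2 = ∑ i, (x i - a i) ^ 2 := by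
    rw [EuclideanSpace.norm_sq_eq]; simp
  simp only [h2, Finset.sum_add_distrib, ← Finset.sum_mul, ← Finset.mul_sum, ← hn, radL, LO]
  simp only [Finset.sum_const, Finset.card_univ, Fintype.card_fin, nsmul_eq_mul]
  ring

lemma lap_iterate_radial {N : ℕ} (m : ℕ) (a : EE N) {g : ℝ → ℝ} (hg : ContDiff ℝ ∞ g) :
    lap^[m] (fun y : EE N => g (‖y - a‖ ^ 2)) = fun y => (radL N)^[m] g (‖y - a‖ ^ 2) := by
  induction m generalizing g with
  | zero => rfl
  | succ m ih => rw [Function.iterate_succ_apply, lap_radial a hg, ih (smooth_radL N hg),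
      Function.iterate_succ_apply]

/-- Smooth cutoff near the origin: `0` on `(-∞,1/2]` and `1` on `[1,∞)`. -/
noncomputable def cutLow (z : ℝ) : ℝ := Real.smoothTransition (2 * z - 1)

/-- Smooth cutoff at infinity: `1` on `(-∞,1]` and `0` on `[4,∞)`. -/
noncomputable def cutHigh (z : ℝ) : ℝ := Real.smoothTransition ((4 - z) / 3)

lemma smooth_cutLow : ContDiff ℝ ∞ cutLow :=
  Real.smoothTransition.contDiff.comp ((contDiff_const.mul contDiff_id).sub contDiff_const)

lemma smooth_cutHigh : ContDiff ℝ ∞ cutHigh :=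
  Real.smoothTransition.contDiff.comp ((contDiff_const.sub contDiff_id).div_const _)

lemma cutLow_of_le {z : ℝ} (hz : z ≤ 1 / 2) : cutLow z = 0 :=
  Real.smoothTransition.zero_of_nonpos (by linarith)

lemma cutLow_of_ge {z : ℝ} (hz : 1 ≤ z) : cutLow z = 1 :=
  Real.smoothTransition.one_of_one_le (by linarith)

lemma cutHigh_of_le {z : ℝ} (hz : z ≤ 1) : cutHigh z = 1 :=
  Real.smoothTransition.one_of_one_le (by linarith)

lemma cutHigh_of_ge {z : ℝ} (hz : 4 ≤ z) : cutHigh z = 0 :=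
  Real.smoothTransition.zero_of_nonpos (by linarith)

/-- The function `ρ^{-N/2}` smoothly cut off near `ρ = 0`. -/
noncomputable def cutRpow (N : ℕ) (ρ : ℝ) : ℝ := ρ ^ (-(N:ℝ) / 2) * cutLow ρ

lemma cutRpow_of_le {N : ℕ} {ρ : ℝ} (h : ρ ≤ 1 / 2) : cutRpow N ρ = 0 := by
  rw [cutRpow, cutLow_of_le h, mul_zero]

lemma cutRpow_of_ge {N : ℕ} {ρ : ℝ} (h : 1 ≤ ρ) : cutRpow N ρ = ρ ^ (-(N:ℝ) / 2) := by
  rw [cutRpow, cutLow_of_ge h, mul_one]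

lemma smooth_cutRpow (N : ℕ) : ContDiff ℝ ∞ (cutRpow N) := by
  refine contDiff_iff_contDiffAt.2 fun x => ?_
  rcases lt_or_ge 0 x with hx | hx
  · exact (Real.contDiffAt_rpow_const_of_ne hx.ne').mul smooth_cutLow.contDiffAt
  · refine (contDiffAt_const (c := (0:ℝ))).congr_of_eventuallyEq ?_
    filter_upwards [isOpen_Iio.mem_nhds (show x ∈ Iio (1/2:ℝ) from lt_of_le_of_lt hx (by norm_num))]
      with y hy using cutRpow_of_le (le_of_lt hy)

/-- The doubly truncated power `ρ^{-N/2} cutLow(n²ρ) cutHigh(ρ/n²)`. -/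
noncomputable def trunc (N : ℕ) (n ρ : ℝ) : ℝ :=
  n ^ N * cutRpow N (n ^ 2 * ρ) * cutHigh (ρ / n ^ 2)

lemma smooth_trunc (N : ℕ) (n : ℝ) : ContDiff ℝ ∞ (trunc N n) :=
  (contDiff_const.mul ((smooth_cutRpow N).comp (contDiff_const.mul contDiff_id))).mul
    (smooth_cutHigh.comp (contDiff_id.div_const _))

lemma rpow_sq_neg_half {N : ℕ} {n : ℝ} (hn : 0 < n) :
    (n ^ 2) ^ (-(N:ℝ) / 2) = (n ^ N)⁻¹ := by
  rw [← Real.rpow_natCast n 2, ← Real.rpow_mul hn.le, ← Real.rpow_natCast n N,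
    ← Real.rpow_neg hn.le]
  congr 1; push_cast; ring

lemma trunc_eq {N : ℕ} {n ρ : ℝ} (hn : 0 < n) (hρ : 0 < ρ) :
    trunc N n ρ = ρ ^ (-(N:ℝ) / 2) * (cutLow (n ^ 2 * ρ) * cutHigh (ρ / n ^ 2)) := by
  rw [trunc, cutRpow, Real.mul_rpow (by positivity) hρ.le, rpow_sq_neg_half hn]
  field_simp

lemma trunc_eq_rpow {N : ℕ} {n ρ : ℝ} (hn : 0 < n) (h1 : 1 ≤ n ^ 2 * ρ) (h2 : ρ ≤ n ^ 2) :
    trunc N n ρ = ρ ^ (-(N:ℝ) / 2) := by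
  have hρ : 0 < ρ := by
    by_contra h
    nlinarith [sq_nonneg n]
  rw [trunc_eq hn hρ, cutLow_of_ge h1, cutHigh_of_le (by rw [div_le_one (by positivity)]; exact h2)]
  ring

lemma trunc_nonneg {N : ℕ} {n ρ : ℝ} (hn : 0 < n) (hρ : 0 ≤ ρ) : 0 ≤ trunc N n ρ := by
  unfold trunc cutRpow
  have := Real.smoothTransition.nonneg (2 * (n ^ 2 * ρ) - 1)
  have := Real.smoothTransition.nonneg ((4 - ρ / n ^ 2) / 3)
  unfold cutLow cutHigh
  positivity

lemma trunc_le {N : ℕ} {n ρ : ℝ} (hn : 0 < n) (hρ : 0 < ρ) :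
    trunc N n ρ ≤ ρ ^ (-(N:ℝ) / 2) := by
  rw [trunc_eq hn hρ]
  refine mul_le_of_le_one_right (by positivity) ?_
  exact mul_le_one₀ (Real.smoothTransition.le_one _) (Real.smoothTransition.nonneg _)
    (Real.smoothTransition.le_one _)

lemma trunc_of_ge {N : ℕ} {n ρ : ℝ} (hn : 0 < n) (h : 4 * n ^ 2 ≤ ρ) : trunc N n ρ = 0 := by
  rw [trunc, cutHigh_of_ge (by rw [le_div_iff₀ (by positivity)]; exact h), mul_zero]

section

variable {N : ℕ} [NeZero N]

/-- Reflection in the boundary hyperplane. -/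
noncomputable def refl0 (x : EE N) : EE N := x - (2 * x 0) • e1 N

lemma normsq_sub_refl0 (x y : EE N) : ‖y - refl0 x‖ ^ 2 = ‖y - x‖ ^ 2 + 4 * x 0 * y 0 := by
  have : y - refl0 x = (y - x) + (2 * x 0) • e1 N := by simp only [refl0]; abel
  rw [this, norm_add_sq_real, norm_smul, real_inner_smul_right]
  simp [e1, EuclideanSpace.inner_single_right, mul_pow]
  ring

/-- The factor of the test function multiplying `y₁^m`. -/
noncomputable def testA (m : ℕ) (f : ℝ → ℝ) (x y : EE N) : ℝ :=
  (4 * x 0) ^ m * rI (m - 1) f (‖y - x‖ ^ 2, 4 * x 0 * y 0)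

lemma smooth_testA (m : ℕ) {f : ℝ → ℝ} (hf : ContDiff ℝ ∞ f) (x : EE N) :
    ContDiff ℝ ∞ (testA m f x) :=
  contDiff_const.mul ((smooth_rI _ hf).comp ((smooth_normsq_sub x).prodMk
    (contDiff_const.mul (smooth_coord 0))))

lemma testA_mul_pow {m : ℕ} (hm : 0 < m) (f : ℝ → ℝ) (x y : EE N) :
    testA m f x y * y 0 ^ m =
      ∫ τ in (0:ℝ)..(4 * x 0 * y 0), τ ^ (m - 1) * f (‖y - x‖ ^ 2 + τ) := by
  obtain ⟨k, rfl⟩ : ∃ k, m = k + 1 := ⟨m - 1, by omega⟩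
  rw [Nat.add_sub_cancel, ← pow_mul_rI, testA, Nat.add_sub_cancel, mul_pow (4 * x 0) (y 0)]
  ring

lemma testA_eq_zero {m : ℕ} {f : ℝ → ℝ} {R : ℝ} (hf : ∀ ρ, R ≤ ρ → f ρ = 0)
    {x y : EE N} (h1 : R ≤ ‖y - x‖ ^ 2) (h2 : R ≤ ‖y - refl0 x‖ ^ 2) : testA m f x y = 0 := by
  rw [testA, rI, intervalIntegral.integral_congr (g := fun _ => (0:ℝ))]
  · simp
  · intro σ hσ
    rw [uIcc_of_le zero_le_one] at hσ
    rw [normsq_sub_refl0] at h2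
    have : R ≤ ‖y - x‖ ^ 2 + 4 * x 0 * y 0 * σ := by
      have := mul_nonneg (sub_nonneg.2 hσ.2) (sub_nonneg.2 h1)
      have := mul_nonneg hσ.1 (sub_nonneg.2 h2)
      nlinarith
    simp [hf _ this]

lemma hasCompactSupport_testA {m : ℕ} {f : ℝ → ℝ} {R : ℝ} (hf : ∀ ρ, R ≤ ρ → f ρ = 0)
    (x : EE N) : HasCompactSupport (testA m f x) := by
  have key : ∀ z : EE N, ∀ᶠ y in cocompact (EE N), R ≤ ‖y - z‖ ^ 2 := fun z => by
    have h1 : Tendsto (fun y : EE N => ‖y - z‖) (cocompact _) atTop :=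
      tendsto_norm_cocompact_atTop.comp ((Homeomorph.subRight z).isClosedEmbedding.tendsto_cocompact)
    exact ((tendsto_pow_atTop two_ne_zero).comp h1).eventually_ge_atTop R
  rw [hasCompactSupport_iff_eventuallyEq]
  have : testA m f x =ᶠ[cocompact _] 0 := by
    filter_upwards [key x, key (refl0 x)] with y h1 h2 using testA_eq_zero hf h1 h2
  simpa [Filter.coclosedCompact_eq_cocompact] using this

/-- The iterated Laplacian of the test function where the profile is an exact power at the
reflected argument. -/
lemma lap_iterate_testA {m : ℕ} (hm : 0 < m) {f : ℝ → ℝ} (hf : ContDiff ℝ ∞ f) {V : Set ℝ}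
    (hV : IsOpen V) (hV0 : V ⊆ Ioi 0) (hfV : ∀ ρ ∈ V, f ρ = ρ ^ (-(N:ℝ) / 2)) {x y : EE N}
    (hy : ‖y - refl0 x‖ ^ 2 ∈ V) :
    lap^[m] (fun y => testA m f x y * y 0 ^ m) y =
      (-1) ^ m * (m - 1).factorial * LOs N m f (‖y - x‖ ^ 2) := by
  obtain ⟨h, hh, hhf⟩ := exists_iteratedDeriv_eq m hf
  obtain ⟨k, rfl⟩ : ∃ k, m = k + 1 := ⟨m - 1, by omega⟩
  rw [Nat.add_sub_cancel]
  set c : ℝ := (-1) ^ (k + 1) * k.factorial with hc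
  have hS : ∀ j, ContDiff ℝ ∞ (fun y : EE N => iteratedDeriv j h (‖y - refl0 x‖ ^ 2)) := fun j =>
    (smooth_iteratedDeriv hh j).comp (smooth_normsq_sub _)
  have hSj : ∀ j, ContDiff ℝ ∞
      (fun y : EE N => iteratedDeriv j h (‖y - refl0 x‖ ^ 2) * y 0 ^ j) := fun j =>
    (hS j).mul ((smooth_coord 0).pow j)
  have hs0 : ContDiff ℝ ∞ (fun y : EE N => h (‖y - x‖ ^ 2)) := hh.comp (smooth_normsq_sub _)
  have e : (fun y => testA (k + 1) f x y * y 0 ^ (k + 1)) = fun y : EE N => c * h (‖y - x‖ ^ 2) +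
      ∑ j ∈ Finset.range (k + 1), (-c * ((-(4 * x 0)) ^ j / j.factorial)) *
        (iteratedDeriv j h (‖y - refl0 x‖ ^ 2) * y 0 ^ j) := by
    funext y
    rw [testA_mul_pow hm, Nat.add_sub_cancel, ← hhf, integral_pow_mul_iteratedDeriv k hh,
      ← normsq_sub_refl0, mul_sub, sub_eq_add_neg, Finset.mul_sum, ← Finset.sum_neg_distrib]
    congr 1
    refine Finset.sum_congr rfl fun j _ => ?_
    rw [show -(4 * x 0 * y 0) = -(4 * x 0) * y 0 by ring, mul_pow]
    ring
  rw [e, lap_iterate_add _ (contDiff_const.mul hs0)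
    (ContDiff.sum fun j _ => contDiff_const.mul (hSj j)), lap_iterate_const_mul _ _ hs0,
    lap_iterate_sum _ _ (fun j _ => contDiff_const.mul (hSj j)), lap_iterate_radial _ _ hh,
    iterate_radL _ _ hh, hhf]
  simp only
  rw [Finset.sum_eq_zero, add_zero]
  intro j hj
  have hj : j < k + 1 := Finset.mem_range.1 hj
  rw [lap_iterate_const_mul _ _ (hSj j)]
  set U : Set (EE N) := (fun y : EE N => ‖y - refl0 x‖ ^ 2) ⁻¹' V with hU
  have hUo : IsOpen U := hV.preimage (smooth_normsq_sub (n := 0) (refl0 x)).continuous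
  have := lap_iterate_mul_pow_eq_zero hUo (k + 1) j (k + 1 - j)
    (fun y : EE N => iteratedDeriv j h (‖y - refl0 x‖ ^ 2)) (hS j) (fun z hz => by
      have hz : ‖z - refl0 x‖ ^ 2 ∈ V := hz
      rw [lap_iterate_radial _ _ (smooth_iteratedDeriv hh j),
        iterate_radL _ _ (smooth_iteratedDeriv hh j)]
      refine LOs_eq_zero_of_ev (by omega) (hV0 hz) ?_
      have e2 : iteratedDeriv (k + 1 - j) (iteratedDeriv j h) = f := by
        rw [← hhf, iteratedDeriv_eq_iterate, iteratedDeriv_eq_iterate, iteratedDeriv_eq_iterate,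
          ← Function.iterate_add_apply, Nat.sub_add_cancel hj.le]
      rw [e2]
      filter_upwards [hV.mem_nhds hz] with ρ hρ using hfV ρ hρ) (by omega) y hy
  simp only [this, mul_zero]

end

lemma LOs_succ' (N m : ℕ) (F : ℝ → ℝ) : LOs N (m + 1) F = LO (2 * N) (LOs (N + 2) m F) := by
  induction m generalizing F with
  | zero => simp [LOs]
  | succ m ih =>
    rw [LOs, ih, LOs]
    congr 3
    push_cast; ring_nf

lemma LO_rpow_ev' (N j : ℕ) {ρ : ℝ} (hρ : 0 < ρ) :
    LO (2 * (N + 2 : ℕ) + 4 * j) (fun x : ℝ => x ^ (-(N:ℝ) / 2)) =ᶠ[𝓝 ρ]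
      fun x => (4 * (j + 1)) * x ^ (-(N:ℝ) / 2) := by
  filter_upwards [isOpen_Ioi.mem_nhds hρ] with x hx
  have hx : 0 < x := hx
  rw [LO, (Real.hasDerivAt_rpow_const (Or.inl hx.ne')).deriv, Real.rpow_sub_one hx.ne']
  push_cast
  field_simp
  ring

lemma LOs_rpow_ev' (N m : ℕ) {ρ : ℝ} (hρ : 0 < ρ) :
    LOs (N + 2) m (fun x : ℝ => x ^ (-(N:ℝ) / 2)) =ᶠ[𝓝 ρ]
      fun x => (∏ j ∈ Finset.range m, (4 * (j + 1) : ℝ)) * x ^ (-(N:ℝ) / 2) := by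
  induction m with
  | zero => simp [LOs]
  | succ m ih =>
    refine (LOs_congr_ev (N + 2) m (LO_rpow_ev' N m hρ)).trans ?_
    rw [LOs_const_mul]
    filter_upwards [ih] with x hx
    rw [hx, Finset.prod_range_succ]; ring

/-- The concentrating kernel obtained by applying the polyharmonic operator to the truncated
fundamental solution. -/
noncomputable def bumpP (N m : ℕ) (z : EE N) : ℝ := LOs N m (cutRpow N) (‖z‖ ^ 2)

lemma LOs_cutRpow_of_gt {N m : ℕ} (hm : 0 < m) {ρ : ℝ} (h : 1 < ρ) :
    LOs N m (cutRpow N) ρ = 0 := by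
  refine LOs_eq_zero_of_ev hm (by linarith) ?_
  filter_upwards [isOpen_Ioi.mem_nhds h] with x hx using cutRpow_of_ge (le_of_lt hx)

lemma continuous_bumpP (N m : ℕ) : Continuous (bumpP N m) :=
  (smooth_LOs N m (smooth_cutRpow N)).continuous.comp (continuous_norm.pow 2)

lemma bumpP_of_gt {N m : ℕ} (hm : 0 < m) {z : EE N} (h : 1 < ‖z‖) : bumpP N m z = 0 :=
  LOs_cutRpow_of_gt hm (by nlinarith)

lemma hasCompactSupport_bumpP {N m : ℕ} (hm : 0 < m) : HasCompactSupport (bumpP N m) :=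
  HasCompactSupport.intro (isCompact_closedBall (0 : EE N) 1) fun z hz => bumpP_of_gt hm (by
    simpa using hz)

lemma integrable_bumpP {N m : ℕ} (hm : 0 < m) : Integrable (bumpP N m) :=
  (continuous_bumpP N m).integrable_of_hasCompactSupport (hasCompactSupport_bumpP hm)

lemma integral_bumpP_pos {N m : ℕ} [NeZero N] (hm : 0 < m) : 0 < ∫ z : EE N, bumpP N m z := by
  have hN : 0 < N := Nat.pos_of_ne_zero (NeZero.ne N)
  have : Nonempty (Fin N) := ⟨0⟩
  have h1 := integral_fun_norm_addHaar (volume : Measure (EE N))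
    (fun r => LOs N m (cutRpow N) (r ^ 2))
  have h2 : ∫ y in Ioi (0:ℝ), y ^ (Module.finrank ℝ (EE N) - 1) • LOs N m (cutRpow N) (y ^ 2) =
      ∫ y in (0:ℝ)..2, y ^ (N - 1) * LOs N m (cutRpow N) (y ^ 2) := by
    rw [intervalIntegral.integral_of_le (by norm_num), finrank_euclideanSpace, Fintype.card_fin]
    refine setIntegral_eq_of_subset_of_forall_sdiff_eq_zero measurableSet_Ioi
      (fun x hx => hx.1) fun x hx => ?_
    have : 2 < x := by
      by_contra hcon
      exact hx.2 ⟨hx.1, not_lt.1 hcon⟩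
    rw [LOs_cutRpow_of_gt hm (by nlinarith), smul_zero]
  obtain ⟨k, rfl⟩ : ∃ k, m = k + 1 := ⟨m - 1, by omega⟩
  set g := LOs (N + 2) k (cutRpow N) with hg
  have hgs : ContDiff ℝ ∞ g := smooth_LOs _ _ (smooth_cutRpow N)
  have h3 : ∫ y in (0:ℝ)..2, y ^ (N - 1) * LOs N (k + 1) (cutRpow N) (y ^ 2) =
      2 * 2 ^ N * g (2 ^ 2) := by
    rw [LOs_succ', ← hg, intervalIntegral.integral_eq_sub_of_hasDerivAt
      (f := fun y => 2 * y ^ N * g (y ^ 2))]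
    · simp [hN.ne']
    · intro y _
      have d1 := (smooth_differentiable hgs (y ^ 2)).hasDerivAt.comp y (hasDerivAt_pow 2 y)
      have d2 := ((hasDerivAt_pow N y).const_mul 2).mul d1
      refine d2.congr_deriv ?_
      obtain ⟨j, rfl⟩ : ∃ j, N = j + 1 := ⟨N - 1, by omega⟩
      simp only [LO, Function.comp, Nat.add_sub_cancel]
      push_cast
      ring
    · have := (smooth_LO (2 * N) hgs).continuous
      exact (by fun_prop : Continuous fun y : ℝ => y ^ (N - 1) * LO (2 * N) g (y ^ 2)).intervalIntegrable _ _
  have h4 : 0 < g (2 ^ 2) := by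
    have : cutRpow N =ᶠ[𝓝 (2 ^ 2 : ℝ)] fun x => x ^ (-(N:ℝ) / 2) := by
      filter_upwards [isOpen_Ioi.mem_nhds (show (2 ^ 2 : ℝ) ∈ Ioi 1 by
        rw [mem_Ioi]; norm_num)] with x hx using cutRpow_of_ge (le_of_lt hx)
    rw [hg, ((LOs_congr_ev (N + 2) k this).trans (LOs_rpow_ev' N k (by norm_num))).self_of_nhds]
    show 0 < (∏ j ∈ Finset.range k, (4 * (j + 1) : ℝ)) * (2 ^ 2 : ℝ) ^ (-(N:ℝ) / 2)
    have : 0 < ∏ j ∈ Finset.range k, (4 * (j + 1) : ℝ) := Finset.prod_pos fun j _ => by positivity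
    positivity
  have h5 : 0 < (volume : Measure (EE N)).real (Metric.ball 0 1) :=
    ENNReal.toReal_pos (Metric.measure_ball_pos _ _ one_pos).ne' measure_ball_lt_top.ne
  unfold bumpP
  rw [h1, h2, h3, finrank_euclideanSpace, Fintype.card_fin, nsmul_eq_mul, smul_eq_mul]
  have : (0:ℝ) < N := by exact_mod_cast hN
  positivity

lemma LOs_trunc {N m : ℕ} {n ρ : ℝ} (hn : 0 < n) (h : ρ < n ^ 2) :
    LOs N m (trunc N n) ρ = n ^ N * LOs N m (cutRpow N) (n ^ 2 * ρ) := by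
  have : trunc N n =ᶠ[𝓝 ρ] fun ρ => n ^ N * cutRpow N (n ^ 2 * ρ) := by
    filter_upwards [isOpen_Iio.mem_nhds h] with x hx
    rw [trunc, cutHigh_of_le (by rw [div_le_one (by positivity)]; exact le_of_lt hx), mul_one]
  rw [(LOs_congr_ev N m this).self_of_nhds, LOs_const_mul,
    LOs_comp_mul N m (n ^ 2) (cutRpow N)]

lemma lap_comp_smul {N : ℕ} (c : ℝ) {f : EE N → ℝ} (hf : ContDiff ℝ ∞ f) :
    lap (fun y => f (c • y)) = fun y => c ^ 2 * lap f (c • y) := by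
  have hp : ∀ {f : EE N → ℝ}, ContDiff ℝ ∞ f → ∀ i, pd i (fun y => f (c • y)) =
      fun y => c * pd i f (c • y) := fun {f} hf i => funext fun y => by
    unfold pd
    have h1 : HasFDerivAt (fun y : EE N => c • y) (c • ContinuousLinearMap.id ℝ (EE N)) y :=
      (hasFDerivAt_id y).const_smul c
    have h2 := (smooth_differentiable hf (c • y)).hasFDerivAt.comp y h1
    have h3 : fderiv ℝ (fun y : EE N => f (c • y)) y = _ := h2.fderiv
    rw [h3]; simp
  have hs : ∀ {f : EE N → ℝ}, ContDiff ℝ ∞ f → ContDiff ℝ ∞ (fun y => f (c • y)) := fun hf =>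
    hf.comp (contDiff_const_smul c)
  rw [lap_fun_eq ((hs hf).of_le smooth_two_le), lap_fun_eq (hf.of_le smooth_two_le)]
  funext x
  rw [Finset.mul_sum]
  refine Finset.sum_congr rfl fun i _ => ?_
  rw [hp hf, pd_const_mul _ _ _ (smooth_differentiable (hs (smooth_pd i hf)) x),
    hp (smooth_pd i hf)]
  ring

lemma lap_iterate_comp_smul {N : ℕ} (m : ℕ) (c : ℝ) {f : EE N → ℝ} (hf : ContDiff ℝ ∞ f) :
    lap^[m] (fun y => f (c • y)) = fun y => c ^ (2 * m) * lap^[m] f (c • y) := by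
  induction m with
  | zero => simp
  | succ m ih =>
    have hs : ContDiff ℝ ∞ (fun y => lap^[m] f (c • y)) :=
      (smooth_lap_iterate m hf).comp (contDiff_const_smul c)
    rw [Function.iterate_succ_apply', ih]
    funext y
    rw [lap_const_mul _ hs, lap_comp_smul c (smooth_lap_iterate m hf), Function.iterate_succ_apply']
    ring

/-- Iterated Laplacians of a jointly smooth family are jointly smooth. -/
lemma smooth_lap_iterate_param {N : ℕ} (m : ℕ) {Ψ : ℝ × EE N → ℝ} (hΨ : ContDiff ℝ ∞ Ψ) :
    ContDiff ℝ ∞ (fun p : ℝ × EE N => lap^[m] (fun y => Ψ (p.1, y)) p.2) := by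
  induction m with
  | zero => exact hΨ
  | succ m ih =>
    have hp : ∀ {Φ : ℝ × EE N → ℝ}, ContDiff ℝ ∞ Φ → ∀ i, ContDiff ℝ ∞
        (fun p : ℝ × EE N => pd i (fun y => Φ (p.1, y)) p.2) := fun {Φ} hΦ i => by
      have e : (fun p : ℝ × EE N => pd i (fun y => Φ (p.1, y)) p.2) =
          fun p => fderiv ℝ Φ p (0, EuclideanSpace.single i 1) := by
        funext p
        have h1 : HasFDerivAt (fun y : EE N => (p.1, y)) (ContinuousLinearMap.inr ℝ ℝ (EE N)) p.2 :=
          hasFDerivAt_prodMk_right p.1 p.2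
        have h2 := (smooth_differentiable hΦ (p.1, p.2)).hasFDerivAt.comp p.2 h1
        have h3 : fderiv ℝ (fun y : EE N => Φ (p.1, y)) p.2 = _ := h2.fderiv
        unfold pd
        rw [h3]; simp
      rw [e]
      exact ((contDiff_infty_iff_fderiv.1 hΦ).2).clm_apply contDiff_const
    have e : (fun p : ℝ × EE N => lap^[m + 1] (fun y => Ψ (p.1, y)) p.2) =
        fun p : ℝ × EE N => ∑ i, pd i (fun y => (fun p' : ℝ × EE N =>
          pd i (fun y => lap^[m] (fun y => Ψ (p'.1, y)) y) p'.2) (p.1, y)) p.2 := by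
      funext p
      have hs : ContDiff ℝ ∞ (fun y => Ψ (p.1, y)) := hΨ.comp (contDiff_prodMk_right p.1)
      rw [Function.iterate_succ_apply',
        lap_fun_eq ((smooth_lap_iterate m hs).of_le smooth_two_le)]
    rw [e]
    exact ContDiff.sum fun i _ => hp (hp ih i) i

/-- Rescaled profile governing the truncated kernel far from the pole. -/
noncomputable def farProfile (N : ℕ) (ρ : ℝ) : ℝ := 2 ^ N * cutRpow N (2 ^ 2 * ρ) * cutHigh ρ

lemma smooth_farProfile (N : ℕ) : ContDiff ℝ ∞ (farProfile N) :=
  (contDiff_const.mul ((smooth_cutRpow N).comp (contDiff_const.mul contDiff_id))).mul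
    smooth_cutHigh

lemma trunc_eq_farProfile {N : ℕ} {n ρ : ℝ} (hn : 2 ≤ n) (hρ : n ^ 2 / 4 ≤ ρ) :
    trunc N n ρ = (n ^ N)⁻¹ * farProfile N ((n⁻¹) ^ 2 * ρ) := by
  have hn0 : 0 < n := by linarith
  have hρ0 : 0 < ρ := lt_of_lt_of_le (by positivity) hρ
  have h1 : 1 ≤ n ^ 2 * ρ := by
    have h2 : 4 ≤ n ^ 2 := by nlinarith
    nlinarith
  have h2 : 1 ≤ 2 ^ 2 * ((n⁻¹) ^ 2 * ρ) := by
    rw [inv_pow, inv_mul_eq_div, ← mul_div_assoc, le_div_iff₀ (by positivity)]; linarith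
  rw [trunc_eq hn0 hρ0, farProfile, cutLow_of_ge h1, cutRpow_of_ge h2,
    Real.mul_rpow (by norm_num) (by positivity), rpow_sq_neg_half (by norm_num : (0:ℝ) < 2),
    Real.mul_rpow (by positivity) hρ0.le, rpow_sq_neg_half (by positivity : 0 < n⁻¹),
    div_eq_inv_mul, inv_pow, inv_pow]
  field_simp

section

variable {N : ℕ} [NeZero N]

lemma norm_e1 : ‖e1 N‖ = 1 := by simp [e1]

lemma norm_refl0_le {x : EE N} (hx : 0 ≤ x 0) : ‖refl0 x‖ ≤ ‖x‖ + 2 * x 0 := by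
  refine (norm_sub_le _ _).trans ?_
  rw [norm_smul, norm_e1, Real.norm_eq_abs, abs_of_nonneg (by positivity)]; simp

lemma norm_sub_refl0_le {x : EE N} (hx : 0 ≤ x 0) (y : EE N) :
    ‖y - refl0 x‖ ≤ ‖y - x‖ + 2 * x 0 := by
  have : y - refl0 x = (y - x) + (2 * x 0) • e1 N := by simp only [refl0]; abel
  rw [this]
  refine (norm_add_le _ _).trans ?_
  rw [norm_smul, norm_e1, Real.norm_eq_abs, abs_of_nonneg (by positivity)]; simp

lemma lt_norm_sub_refl0 {x y : EE N} (hx : 0 < x 0) (hy : 0 < y 0) : x 0 < ‖y - refl0 x‖ := by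
  have h := PiLp.norm_apply_le (y - refl0 x) (0 : Fin N)
  have : (y - refl0 x) 0 = y 0 + x 0 := by simp [refl0, e1]; ring
  rw [this, Real.norm_eq_abs, abs_of_pos (by positivity)] at h
  linarith

lemma exists_lap_iterate_testA_trunc_le {m : ℕ} (hm : 0 < m) {x : EE N} (hx : x ∈ hs N) :
    ∃ C n₀ : ℝ, 0 ≤ C ∧ 2 ≤ n₀ ∧ ∀ n, n₀ ≤ n → ∀ y ∈ hs N,
      |lap^[m] (fun y => testA m (trunc N n) x y * y 0 ^ m) y -
        (-1) ^ m * (m - 1).factorial * (n ^ N * bumpP N m (n • (y - x)))| ≤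
      (Metric.closedBall (0 : EE N) (4 * n)).indicator (fun _ => C * ((n ^ N)⁻¹ * (n ^ m)⁻¹)) y := by
  have hx0 : 0 < x 0 := hx
  let Ψ : ℝ × EE N → ℝ := fun p =>
    (4 * x 0) ^ m * rI (m - 1) (farProfile N) (‖p.2 - p.1 • x‖ ^ 2, 4 * (p.1 * x 0) * p.2 0) * p.2 0 ^ m
  have hΨ : ContDiff ℝ ∞ Ψ := by
    have h0 : ContDiff ℝ ∞ (fun p : ℝ × EE N => p.2 0) := (smooth_coord 0).comp contDiff_snd
    refine (contDiff_const.mul ((smooth_rI _ (smooth_farProfile N)).comp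
      (ContDiff.prodMk ?_ ?_))).mul (h0.pow m)
    · exact (contDiff_snd.sub (contDiff_fst.smul contDiff_const)).norm_sq ℝ
    · exact (contDiff_const.mul (contDiff_fst.mul contDiff_const)).mul h0
  obtain ⟨C, hC⟩ := ((isCompact_Icc (a := (0:ℝ)) (b := 1)).prod
    (isCompact_closedBall (0 : EE N) 4)).exists_bound_of_continuousOn
      (smooth_lap_iterate_param m hΨ).continuous.continuousOn
  refine ⟨max C 0, max 2 (1 / x 0 + 4 * x 0 + ‖x‖ + 1), le_max_right _ _, le_max_left _ _, ?_⟩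
  intro n hn y hy
  have hy0 : 0 < y 0 := hy
  have hn2 : 2 ≤ n := (le_max_left _ _).trans hn
  have hn0 : 0 < n := by linarith
  have hn3 := (le_max_right _ _).trans hn
  have hxi : 0 < 1 / x 0 := by positivity
  have hnx := norm_nonneg x
  have hn4 : 1 / x 0 < n := by linarith
  have hn5 : ‖x‖ + 4 * x 0 < n := by linarith
  have hS1 := lt_norm_sub_refl0 hx0 hy0
  have hrhs : 0 ≤ (Metric.closedBall (0 : EE N) (4 * n)).indicator
      (fun _ => max C 0 * ((n ^ N)⁻¹ * (n ^ m)⁻¹)) y :=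
    indicator_nonneg (fun _ _ => by positivity) _
  have hSs := normsq_sub_refl0 x y
  rcases lt_or_ge (‖y - refl0 x‖ ^ 2) (n ^ 2) with hS | hS
  · have hlow : 1 < n ^ 2 * ‖y - refl0 x‖ ^ 2 := by
      rw [← mul_pow]
      refine one_lt_pow₀ ?_ two_ne_zero
      rw [div_lt_iff₀ hx0] at hn4
      nlinarith
    have h1 := lap_iterate_testA hm (smooth_trunc N n)
      (V := {ρ | 1 < n ^ 2 * ρ} ∩ Iio (n ^ 2))
      ((isOpen_lt continuous_const (by fun_prop)).inter isOpen_Iio)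
      (fun ρ hρ => by
        have : 1 < n ^ 2 * ρ := hρ.1
        rw [mem_Ioi]; by_contra hcon; nlinarith [sq_nonneg n])
      (fun ρ hρ => trunc_eq_rpow hn0 (le_of_lt hρ.1) (le_of_lt hρ.2)) (x := x) (y := y)
      ⟨hlow, hS⟩
    rw [h1, LOs_trunc hn0 (by nlinarith [mul_pos hx0 hy0]), bumpP, norm_smul, mul_pow,
      Real.norm_eq_abs, sq_abs, sub_self, abs_zero]
    exact hrhs
  · have hS' : n ≤ ‖y - refl0 x‖ := (sq_le_sq₀ hn0.le (norm_nonneg _)).1 hS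
    have hyx : n / 2 < ‖y - x‖ := by
      have := norm_sub_refl0_le hx0.le y
      linarith
    have hb : bumpP N m (n • (y - x)) = 0 := by
      refine bumpP_of_gt hm ?_
      rw [norm_smul, Real.norm_eq_abs, abs_of_pos hn0]
      nlinarith
    rw [hb, mul_zero, mul_zero, sub_zero]
    by_cases hyn : ‖y‖ ≤ 4 * n
    · rw [indicator_of_mem (by simpa using hyn)]
      have hev : (fun y => testA m (trunc N n) x y * y 0 ^ m) =ᶠ[𝓝 y]
          fun y => ((n ^ N)⁻¹ * n ^ m) * Ψ (n⁻¹, n⁻¹ • y) := by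
        have ho : IsOpen ({y : EE N | n / 2 < ‖y - x‖} ∩ hs N) :=
          (isOpen_lt continuous_const (by fun_prop)).inter isOpen_hs
        filter_upwards [ho.mem_nhds ⟨hyx, hy⟩] with z hz
        have hz1 : n / 2 < ‖z - x‖ := hz.1
        have hz0 : 0 < z 0 := hz.2
        have e1 : rI (m - 1) (trunc N n) (‖z - x‖ ^ 2, 4 * x 0 * z 0) = (n ^ N)⁻¹ *
            rI (m - 1) (farProfile N) (‖n⁻¹ • z - n⁻¹ • x‖ ^ 2, 4 * (n⁻¹ * x 0) * (n⁻¹ • z) 0) := by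
          unfold rI
          rw [← intervalIntegral.integral_const_mul]
          refine intervalIntegral.integral_congr fun σ hσ => ?_
          rw [uIcc_of_le zero_le_one] at hσ
          have h4 : n ^ 2 / 4 ≤ ‖z - x‖ ^ 2 + 4 * x 0 * z 0 * σ := by
            have : 0 ≤ 4 * x 0 * z 0 * σ := mul_nonneg (by positivity) hσ.1
            nlinarith
          simp only
          rw [trunc_eq_farProfile hn2 h4, ← smul_sub, norm_smul, Real.norm_eq_abs, mul_pow,
            sq_abs, PiLp.smul_apply, smul_eq_mul]
          rw [show (n⁻¹) ^ 2 * (‖z - x‖ ^ 2 + 4 * x 0 * z 0 * σ) =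
            n⁻¹ ^ 2 * ‖z - x‖ ^ 2 + 4 * (n⁻¹ * x 0) * (n⁻¹ * z 0) * σ by ring]
          ring
        simp only [Ψ, testA]
        rw [e1, PiLp.smul_apply, smul_eq_mul, mul_pow (n⁻¹), inv_pow]
        field_simp
      have hs2 : ContDiff ℝ ∞ (fun Y : EE N => Ψ (n⁻¹, Y)) := hΨ.comp (contDiff_prodMk_right _)
      have hs3 : ContDiff ℝ ∞ (fun y : EE N => Ψ (n⁻¹, n⁻¹ • y)) :=
        hs2.comp (contDiff_const_smul _)
      rw [(lap_iterate_congr m hev).self_of_nhds, lap_iterate_const_mul _ _ hs3,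
        lap_iterate_comp_smul m n⁻¹ hs2]
      have hb := hC (n⁻¹, n⁻¹ • y) ⟨⟨by positivity, inv_le_one_of_one_le₀ (by linarith)⟩, by
        rw [mem_closedBall_zero_iff, norm_smul, Real.norm_eq_abs, abs_of_pos (by positivity),
          inv_mul_le_iff₀ hn0]; linarith⟩
      simp only [Real.norm_eq_abs] at hb
      rw [abs_mul, abs_of_pos (by positivity : 0 < (n ^ N)⁻¹ * n ^ m)]
      simp only []
      rw [abs_mul, abs_of_pos (by positivity : 0 < n⁻¹ ^ (2 * m))]
      calc _ ≤ (n ^ N)⁻¹ * n ^ m * (n⁻¹ ^ (2 * m) * max C 0) := by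
            gcongr
            exact hb.trans (le_max_left _ _)
        _ = _ := by
            rw [inv_pow, two_mul, pow_add]
            field_simp
    · have hz : lap^[m] (fun y => testA m (trunc N n) x y * y 0 ^ m) y = 0 := by
        refine lap_iterate_eq_zero m (U := {y : EE N | 4 * n < ‖y‖})
          (isOpen_lt continuous_const continuous_norm) (fun z hz => ?_) y (not_le.1 hyn)
        have hz : 4 * n < ‖z‖ := hz
        have hr := norm_refl0_le hx0.le
        have h1 := norm_sub_norm_le z x
        have h2 := norm_sub_norm_le z (refl0 x)
        rw [testA_eq_zero (R := 4 * n ^ 2) (fun ρ hρ => trunc_of_ge hn0 hρ), zero_mul]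
        · nlinarith
        · nlinarith
      rw [hz, abs_zero]
      exact hrhs

end

/-- Fatou's lemma combined with dominated convergence for sequences approximating from below. -/
lemma integrable_and_integral_eq_of_tendsto {α : Type*} [MeasurableSpace α] {μ : Measure α}
    {ψ : ℕ → α → ℝ} {G : α → ℝ} {L : ℝ} (h0 : ∀ n, ∀ᵐ x ∂μ, 0 ≤ ψ n x)
    (hle : ∀ n, ∀ᵐ x ∂μ, ψ n x ≤ G x) (hi : ∀ n, Integrable (ψ n) μ)
    (ht : ∀ᵐ x ∂μ, Tendsto (fun n => ψ n x) atTop (𝓝 (G x)))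
    (hL : Tendsto (fun n => ∫ x, ψ n x ∂μ) atTop (𝓝 L)) :
    Integrable G μ ∧ ∫ x, G x ∂μ = L := by
  have hG : Integrable G μ := by
    refine ⟨aestronglyMeasurable_of_tendsto_ae _ (fun n => (hi n).1) ht, ?_⟩
    have h1 : ∫⁻ x, ‖G x‖ₑ ∂μ ≤ liminf (fun n => ∫⁻ x, ‖ψ n x‖ₑ ∂μ) atTop := by
      refine le_trans (le_of_eq ?_) (lintegral_liminf_le' fun n => (hi n).1.enorm)
      exact lintegral_congr_ae (by filter_upwards [ht] with x hx using hx.enorm.liminf_eq.symm)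
    have h2 : ∀ n, ∫⁻ x, ‖ψ n x‖ₑ ∂μ = ENNReal.ofReal (∫ x, ψ n x ∂μ) := fun n => by
      rw [ofReal_integral_eq_lintegral_ofReal (hi n) (h0 n)]
      refine lintegral_congr_ae ?_
      filter_upwards [h0 n] with x hx
      rw [Real.enorm_eq_ofReal hx]
    simp only [h2] at h1
    rw [(ENNReal.tendsto_ofReal hL).liminf_eq] at h1
    exact h1.trans_lt ENNReal.ofReal_lt_top
  refine ⟨hG, tendsto_nhds_unique (tendsto_integral_of_dominated_convergence (fun x => |G x|)
    (fun n => (hi n).1) hG.abs (fun n => ?_) ht) hL⟩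
  filter_upwards [h0 n, hle n] with x h1 h2
  rw [Real.norm_eq_abs, abs_of_nonneg h1]
  exact h2.trans (le_abs_self _)

/-- The profile of the Dirichlet Green function of the half-space. -/
noncomputable def greenF (N m : ℕ) (s t : ℝ) : ℝ :=
  ∫ τ in (0:ℝ)..t, τ ^ (m - 1) * (s + τ) ^ (-(N:ℝ) / 2)

lemma intervalIntegrable_greenF (N m : ℕ) {s t : ℝ} (hs : 0 < s) (ht : 0 ≤ t) :
    IntervalIntegrable (fun τ => τ ^ (m - 1) * (s + τ) ^ (-(N:ℝ) / 2)) volume 0 t := by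
  refine ContinuousOn.intervalIntegrable ?_
  refine (continuous_pow _).continuousOn.mul
    (ContinuousOn.rpow_const (by fun_prop) fun τ hτ => Or.inl ?_)
  rw [uIcc_of_le ht] at hτ
  have := hτ.1
  positivity

lemma intervalIntegrable_trunc (N m : ℕ) (n s t : ℝ) :
    IntervalIntegrable (fun τ => τ ^ (m - 1) * trunc N n (s + τ)) volume 0 t :=
  Continuous.intervalIntegrable ((continuous_pow _).mul
    ((smooth_trunc N n).continuous.comp (by fun_prop))) _ _

section

variable {N : ℕ} [NeZero N]

/-- A multiple of the Dirichlet Green function of the polyharmonic operator on the half-space. -/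
noncomputable def green (m : ℕ) (x y : EE N) : ℝ := greenF N m (‖y - x‖ ^ 2) (4 * x 0 * y 0)

lemma testA_trunc_nonneg {m : ℕ} (hm : 0 < m) {n : ℝ} (hn : 0 < n) {x y : EE N}
    (hx : 0 ≤ x 0) (hy : 0 ≤ y 0) : 0 ≤ testA m (trunc N n) x y * y 0 ^ m := by
  rw [testA_mul_pow hm]
  refine intervalIntegral.integral_nonneg (by positivity) fun τ hτ => ?_
  have := hτ.1
  exact mul_nonneg (by positivity) (trunc_nonneg hn (by positivity))

lemma testA_trunc_le {m : ℕ} (hm : 0 < m) {n : ℝ} (hn : 0 < n) {x y : EE N}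
    (hx : 0 ≤ x 0) (hy : 0 ≤ y 0) (hxy : y ≠ x) :
    testA m (trunc N n) x y * y 0 ^ m ≤ green m x y := by
  have h : 0 < ‖y - x‖ := norm_pos_iff.2 (sub_ne_zero.2 hxy)
  rw [testA_mul_pow hm]
  refine intervalIntegral.integral_mono_on (by positivity) (intervalIntegrable_trunc _ _ _ _ _)
    (intervalIntegrable_greenF _ _ (by positivity) (by positivity)) fun τ hτ => ?_
  have := hτ.1
  exact mul_le_mul_of_nonneg_left (trunc_le hn (by positivity)) (by positivity)

lemma testA_trunc_eq {m : ℕ} (hm : 0 < m) {n : ℝ} (hn : 0 < n) {x y : EE N}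
    (hx : 0 ≤ x 0) (hy : 0 ≤ y 0) (h1 : 1 ≤ n ^ 2 * ‖y - x‖ ^ 2)
    (h2 : ‖y - x‖ ^ 2 + 4 * x 0 * y 0 ≤ n ^ 2) :
    testA m (trunc N n) x y * y 0 ^ m = green m x y := by
  rw [testA_mul_pow hm, green, greenF]
  refine intervalIntegral.integral_congr fun τ hτ => ?_
  rw [uIcc_of_le (by positivity)] at hτ
  have h3 := hτ.1
  have h4 := hτ.2
  rw [trunc_eq_rpow hn]
  · nlinarith [mul_nonneg (sq_nonneg n) h3]
  · linarith

lemma tendsto_testA_trunc {m : ℕ} (hm : 0 < m) {x y : EE N}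
    (hx : 0 ≤ x 0) (hy : 0 ≤ y 0) (hxy : y ≠ x) :
    Tendsto (fun n : ℕ => testA m (trunc N n) x y * y 0 ^ m) atTop (𝓝 (green m x y)) := by
  have h : 0 < ‖y - x‖ := norm_pos_iff.2 (sub_ne_zero.2 hxy)
  have ht : Tendsto (fun n : ℕ => (n:ℝ) ^ 2) atTop atTop :=
    (tendsto_pow_atTop two_ne_zero).comp tendsto_natCast_atTop_atTop
  refine tendsto_const_nhds.congr' ?_
  filter_upwards [ht.eventually_ge_atTop (1 / ‖y - x‖ ^ 2),
    ht.eventually_ge_atTop (‖y - x‖ ^ 2 + 4 * x 0 * y 0), eventually_gt_atTop 0] with n h1 h2 h3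
  rw [testA_trunc_eq hm (by exact_mod_cast h3) hx hy _ h2]
  rwa [div_le_iff₀ (by positivity)] at h1

end

lemma tendsto_integral_mul_bumpP {N m : ℕ} (hm : 0 < m) {w : EE N → ℝ} (hw : Measurable w) {M : ℝ}
    (hM : ∀ y, |w y| ≤ M) {x : EE N} (hx : ContinuousAt w x) :
    Tendsto (fun n : ℕ => ∫ y, w y * ((n:ℝ) ^ N * bumpP N m ((n:ℝ) • (y - x)))) atTop
      (𝓝 (w x * ∫ z : EE N, bumpP N m z)) := by
  have h1 : ∀ n : ℕ, 0 < n → ∫ y, w y * ((n:ℝ) ^ N * bumpP N m ((n:ℝ) • (y - x))) =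
      ∫ z, w (x + (n:ℝ)⁻¹ • z) * bumpP N m z := fun n hn => by
    have hn' : (0:ℝ) < n := by exact_mod_cast hn
    rw [← integral_add_right_eq_self _ x]
    have := Measure.integral_comp_smul (volume : Measure (EE N))
      (fun z => w (x + (n:ℝ)⁻¹ • z) * bumpP N m z) (n:ℝ)
    simp only [smul_smul, inv_mul_cancel₀ hn'.ne', one_smul, finrank_euclideanSpace,
      Fintype.card_fin] at this
    rw [abs_of_pos (by positivity), smul_eq_mul, eq_inv_mul_iff_mul_eq₀ (by positivity)] at this
    rw [← this, ← integral_const_mul]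
    refine integral_congr_ae (ae_of_all _ fun z => ?_)
    simp only [add_comm z x, add_sub_cancel_left]
    ring
  have h2 : Tendsto (fun n : ℕ => ∫ z, w (x + (n:ℝ)⁻¹ • z) * bumpP N m z) atTop
      (𝓝 (∫ z, w x * bumpP N m z)) := by
    refine tendsto_integral_of_dominated_convergence (fun z => M * |bumpP N m z|)
      (fun n => ((hw.comp (by fun_prop)).mul (continuous_bumpP N m).measurable).aestronglyMeasurable)
      ((integrable_bumpP hm).abs.const_mul M) (fun n => ae_of_all _ fun z => ?_)
      (ae_of_all _ fun z => ?_)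
    · rw [Real.norm_eq_abs, abs_mul]
      exact mul_le_mul_of_nonneg_right (hM _) (abs_nonneg _)
    · refine Tendsto.mul_const _ (hx.tendsto.comp ?_)
      have : Tendsto (fun n : ℕ => x + (n:ℝ)⁻¹ • z) atTop (𝓝 (x + (0:ℝ) • z)) :=
        tendsto_const_nhds.add (tendsto_inv_atTop_nhds_zero_nat.smul_const z)
      simpa using this
  rw [integral_const_mul] at h2
  refine h2.congr' ?_
  filter_upwards [eventually_gt_atTop 0] with n hn using (h1 n hn).symm

namespace IsBCSol

variable {N m : ℕ} [NeZero N] {q : ℝ} {u : EE N → ℝ}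

lemma measurable_indicator (h : IsBCSol N m q u) : Measurable ((hs N).indicator u) := by
  classical
  rw [← piecewise_eq_indicator]
  exact (h.continuousOn.mono hs_subset_chs).measurable_piecewise continuousOn_const measurableSet_hs

lemma continuousAt (h : IsBCSol N m q u) {x : EE N} (hx : x ∈ hs N) : ContinuousAt u x :=
  (h.continuousOn.mono hs_subset_chs).continuousAt (isOpen_hs.mem_nhds hx)

lemma continuousAt_indicator (h : IsBCSol N m q u) {x : EE N} (hx : x ∈ hs N) :
    ContinuousAt ((hs N).indicator u) x := by
  refine (h.continuousAt hx).congr ?_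
  filter_upwards [isOpen_hs.mem_nhds hx] with y hy
  rw [indicator_of_mem hy]

lemma integrableOn_mul (h : IsBCSol N m q u) {g : EE N → ℝ} (hg : IntegrableOn g (hs N)) :
    IntegrableOn (fun y => u y * g y) (hs N) := by
  obtain ⟨M, hM0, hM⟩ := h.exists_bound
  refine hg.bdd_mul (c := M) h.aestronglyMeasurable ?_
  filter_upwards [ae_restrict_mem measurableSet_hs] with y hy using hM y (hs_subset_chs hy)

lemma rpow_bound (hq : 0 ≤ q) {M : ℝ} (hM : ∀ x ∈ chs N, |u x| ≤ M)
    (hpos : ∀ x : EE N, 0 ≤ x 0 → 0 ≤ u x) {x : EE N} (hx : x ∈ chs N) : |u x ^ q| ≤ M ^ q := by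
  rw [abs_of_nonneg (Real.rpow_nonneg (hpos x hx) _)]
  exact Real.rpow_le_rpow (hpos x hx) ((le_abs_self _).trans (hM x hx)) hq

lemma tendsto_integral_mul_lap (h : IsBCSol N m q u) (hm : 0 < m) {x : EE N} (hx : x ∈ hs N) :
    Tendsto (fun n : ℕ => ∫ y in hs N, u y * lap^[m] (fun y => testA m (trunc N n) x y * y 0 ^ m) y)
      atTop (𝓝 ((-1) ^ m * (m - 1).factorial * (u x * ∫ z : EE N, bumpP N m z))) := by
  obtain ⟨M, hM0, hM⟩ := h.exists_bound
  obtain ⟨C, n₀, hC, hn₀, hE⟩ := exists_lap_iterate_testA_trunc_le hm hx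
  set κ : ℝ := (-1) ^ m * (m - 1).factorial
  let P : ℕ → EE N → ℝ := fun n y => (n:ℝ) ^ N * bumpP N m ((n:ℝ) • (y - x))
  let ψ : ℕ → EE N → ℝ := fun n y => lap^[m] (fun y => testA m (trunc N n) x y * y 0 ^ m) y
  have hPi : ∀ n : ℕ, 0 < n → Integrable (P n) := fun n hn => by
    have hn' : (n:ℝ) ≠ 0 := by exact_mod_cast hn.ne'
    exact (((integrable_bumpP hm).comp_smul hn').comp_sub_right x).const_mul _
  have hPl : Tendsto (fun n : ℕ => ∫ y in hs N, u y * P n y) atTop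
      (𝓝 (u x * ∫ z : EE N, bumpP N m z)) := by
    have h1 := tendsto_integral_mul_bumpP hm h.measurable_indicator (M := M) (fun y => by
      by_cases hy : y ∈ hs N
      · rw [indicator_of_mem hy]; exact hM y (hs_subset_chs hy)
      · rw [indicator_of_notMem hy, abs_zero]; exact hM0.le) (h.continuousAt_indicator hx)
    rw [indicator_of_mem hx] at h1
    refine h1.congr fun n => ?_
    rw [← integral_indicator measurableSet_hs]
    refine integral_congr_ae (ae_of_all _ fun y => ?_)
    by_cases hy : y ∈ hs N <;> simp [hy, P]
  have hψi : ∀ n : ℕ, 0 < n → IntegrableOn (ψ n) (hs N) := fun n hn => by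
    have hn' : (0:ℝ) < n := by exact_mod_cast hn
    have hs1 : ContDiff ℝ ∞ (fun y => testA m (trunc N n) x y * y 0 ^ m) :=
      (smooth_testA m (smooth_trunc N n) x).mul ((smooth_coord 0).pow m)
    have hc : HasCompactSupport (fun y => testA m (trunc N n) x y * y 0 ^ m) :=
      (hasCompactSupport_testA (fun ρ hρ => trunc_of_ge hn' hρ) x).mul_right
    exact ((smooth_lap_iterate m hs1).continuous.integrable_of_hasCompactSupport
      (hasCompactSupport_lap_iterate m hc)).integrableOn
  have hdiff : Tendsto (fun n : ℕ => ∫ y in hs N, u y * (ψ n y - κ * P n y)) atTop (𝓝 0) := by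
    have hlim : Tendsto (fun n : ℕ => M * C * 4 ^ N * volume.real (Metric.closedBall (0 : EE N) 1) *
        ((n:ℝ) ^ m)⁻¹) atTop (𝓝 0) := by
      have := (tendsto_inv_atTop_zero.comp ((tendsto_pow_atTop hm.ne').comp
        tendsto_natCast_atTop_atTop)).const_mul
          (M * C * 4 ^ N * volume.real (Metric.closedBall (0 : EE N) 1))
      simpa using this
    refine squeeze_zero_norm' ?_ hlim
    have := tendsto_natCast_atTop_atTop (R := ℝ)
    filter_upwards [this.eventually_ge_atTop n₀] with n hn
    have hn0 : (0:ℝ) < n := by linarith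
    have hb : Integrable ((Metric.closedBall (0 : EE N) (4 * n)).indicator
        (fun _ => M * (C * (((n:ℝ) ^ N)⁻¹ * ((n:ℝ) ^ m)⁻¹)))) :=
      (integrable_indicator_iff Metric.isClosed_closedBall.measurableSet).2
        (integrableOn_const (by exact measure_closedBall_lt_top.ne))
    refine (norm_integral_le_of_norm_le hb.integrableOn ?_).trans ?_
    · filter_upwards [ae_restrict_mem measurableSet_hs] with y hy
      rw [Real.norm_eq_abs, abs_mul]
      refine (mul_le_mul (hM y (hs_subset_chs hy)) (hE n hn y hy) (abs_nonneg _) hM0.le).trans ?_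
      by_cases hyb : y ∈ Metric.closedBall (0 : EE N) (4 * n) <;> simp [hyb]
    · refine (setIntegral_le_integral hb (ae_of_all _ fun y =>
        indicator_nonneg (fun _ _ => by positivity) _)).trans (le_of_eq ?_)
      rw [integral_indicator Metric.isClosed_closedBall.measurableSet, setIntegral_const,
        Measure.real, Measure.addHaar_closedBall _ _ (by positivity)]
      simp only [finrank_euclideanSpace, Fintype.card_fin, smul_eq_mul, Measure.real]
      rw [ENNReal.toReal_mul, ENNReal.toReal_ofReal (by positivity), mul_pow,
        ← Measure.addHaar_closedBall_eq_addHaar_ball]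
      field_simp
  have := hdiff.add (hPl.const_mul κ)
  rw [zero_add] at this
  refine this.congr' ?_
  filter_upwards [eventually_gt_atTop 0] with n hn
  have i1 := h.integrableOn_mul (hψi n hn)
  have i2 := h.integrableOn_mul ((hPi n hn).integrableOn)
  have e1 : ∀ y, u y * (ψ n y - κ * P n y) = u y * ψ n y - κ * (u y * P n y) := fun y => by ring
  simp only [e1]
  rw [integral_sub i1 (i2.const_mul κ), integral_const_mul, sub_add_cancel]

theorem exists_green_representation (h : IsBCSol N m q u) (hm : 0 < m) (hq : 0 ≤ q)
    (hpos : ∀ x : EE N, 0 ≤ x 0 → 0 ≤ u x) :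
    ∃ c : ℝ, 0 < c ∧ ∀ x ∈ hs N, IntegrableOn (fun y => green m x y * u y ^ q) (hs N) ∧
      u x = c * ∫ y in hs N, green m x y * u y ^ q := by
  have hb := integral_bumpP_pos (N := N) hm
  set b := ∫ z : EE N, bumpP N m z
  have hf : (0:ℝ) < (m - 1).factorial := by exact_mod_cast Nat.factorial_pos _
  refine ⟨((m - 1).factorial * b)⁻¹, by positivity, fun x hx => ?_⟩
  obtain ⟨M, hM0, hM⟩ := h.exists_bound
  have hx0 : 0 < x 0 := hx
  let ψ : ℕ → EE N → ℝ := fun n y => testA m (trunc N (n + 1 : ℕ)) x y * y 0 ^ m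
  have hne : ∀ᵐ y ∂(volume.restrict (hs N)), y ≠ x := by
    have : Nontrivial (EE N) := by
      have : Nonempty (Fin N) := ⟨0⟩
      infer_instance
    exact ae_restrict_of_ae (compl_mem_ae_iff.2 (measure_singleton x))
  have hmem := ae_restrict_mem (μ := (volume : Measure (EE N))) (measurableSet_hs (N := N))
  have hn0 : ∀ n : ℕ, (0:ℝ) < ((n + 1 : ℕ) : ℝ) := fun n => by positivity
  have key := integrable_and_integral_eq_of_tendsto (μ := volume.restrict (hs N))
    (ψ := fun n y => ψ n y * u y ^ q) (G := fun y => green m x y * u y ^ q)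
    (L := (m - 1).factorial * (u x * b)) ?_ ?_ ?_ ?_ ?_
  · refine ⟨key.1, ?_⟩
    rw [key.2]
    field_simp
  · intro n
    filter_upwards [hmem] with y hy
    have hy0 : 0 < y 0 := hy
    exact mul_nonneg (testA_trunc_nonneg hm (hn0 n) hx0.le hy0.le)
      (Real.rpow_nonneg (hpos y hy0.le) _)
  · intro n
    filter_upwards [hmem, hne] with y hy hyx
    have hy0 : 0 < y 0 := hy
    exact mul_le_mul_of_nonneg_right (testA_trunc_le hm (hn0 n) hx0.le hy0.le hyx)
      (Real.rpow_nonneg (hpos y hy0.le) _)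
  · intro n
    have hs1 : ContDiff ℝ ∞ (ψ n) :=
      (smooth_testA m (smooth_trunc N _) x).mul ((smooth_coord 0).pow m)
    have hc : HasCompactSupport (ψ n) :=
      (hasCompactSupport_testA (fun ρ hρ => trunc_of_ge (hn0 n) hρ) x).mul_right
    refine (hs1.continuous.integrable_of_hasCompactSupport hc).integrableOn.mul_bdd (c := M ^ q)
      (h.aestronglyMeasurable_rpow hq) ?_
    filter_upwards [hmem] with y hy using rpow_bound hq hM hpos (hs_subset_chs hy)
  · filter_upwards [hmem, hne] with y hy hyx
    have hy0 : 0 < y 0 := hy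
    exact Tendsto.mul_const _ ((tendsto_add_atTop_iff_nat 1).2
      (tendsto_testA_trunc hm hx0.le hy0.le hyx))
  · have h1 := (tendsto_add_atTop_iff_nat 1).2 (h.tendsto_integral_mul_lap hm hx)
    have h2 := h1.const_mul ((-1:ℝ) ^ m)
    have e : ((-1:ℝ) ^ m) * ((-1) ^ m) = 1 := by rw [← mul_pow]; simp
    rw [show (-1:ℝ) ^ m * ((-1) ^ m * (m - 1).factorial * (u x * b)) =
      ((-1) ^ m * (-1) ^ m) * ((m - 1).factorial * (u x * b)) by ring, e, one_mul] at h2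
    refine h2.congr fun n => ?_
    rw [h.setIntegral_mul_lap_iterate hm hq hpos (smooth_testA m (smooth_trunc N _) x)
      (hasCompactSupport_testA (fun ρ hρ => trunc_of_ge (hn0 n) hρ) x), ← mul_assoc, e, one_mul]
    refine integral_congr_ae (ae_of_all _ fun y => ?_)
    simp only [ψ]
    ring

end IsBCSol

section

variable {N m : ℕ} {s s' t t' : ℝ}

lemma greenF_nonneg (hs : 0 ≤ s) (ht : 0 ≤ t) : 0 ≤ greenF N m s t :=
  intervalIntegral.integral_nonneg ht fun _ hτ =>
    mul_nonneg (pow_nonneg hτ.1 _) (Real.rpow_nonneg (add_nonneg hs hτ.1) _)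

lemma greenF_sub_greenF (hs : 0 < s) (ht : 0 ≤ t) (ht' : 0 ≤ t') :
    greenF N m s t' - greenF N m s t =
      ∫ τ in t..t', τ ^ (m - 1) * (s + τ) ^ (-(N:ℝ) / 2) :=
  intervalIntegral.integral_interval_sub_left (intervalIntegrable_greenF N m hs ht')
    (intervalIntegrable_greenF N m hs ht)

lemma intervalIntegrable_greenF_of_le (hs : 0 < s) (ht : 0 ≤ t) (ht' : 0 ≤ t') :
    IntervalIntegrable (fun τ => τ ^ (m - 1) * (s + τ) ^ (-(N:ℝ) / 2)) volume t t' :=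
  (intervalIntegrable_greenF N m hs ht).symm.trans (intervalIntegrable_greenF N m hs ht')

lemma greenF_mono_right (hs : 0 < s) (ht : 0 ≤ t) (htt' : t ≤ t') :
    greenF N m s t ≤ greenF N m s t' := by
  rw [← sub_nonneg, greenF_sub_greenF hs ht (ht.trans htt')]
  refine intervalIntegral.integral_nonneg htt' fun τ hτ => ?_
  have : 0 ≤ τ := ht.trans hτ.1
  positivity

lemma greenF_strictMono_right (hs : 0 < s) (ht : 0 ≤ t) (htt' : t < t') :
    greenF N m s t < greenF N m s t' := by
  rw [← sub_pos, greenF_sub_greenF hs ht (ht.trans htt'.le)]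
  refine intervalIntegral.intervalIntegral_pos_of_pos_on
    (intervalIntegrable_greenF_of_le hs ht (ht.trans htt'.le)) (fun τ hτ => ?_) htt'
  have : 0 < τ := ht.trans_lt hτ.1
  positivity

lemma greenF_pos (hs : 0 < s) (ht : 0 < t) : 0 < greenF N m s t :=
  (greenF_nonneg hs.le le_rfl).trans_lt (greenF_strictMono_right hs le_rfl ht)

lemma integral_greenF_anti (hs : 0 < s) (hss' : s ≤ s') (ht : 0 ≤ t) (htt' : t ≤ t') :
    ∫ τ in t..t', τ ^ (m - 1) * (s' + τ) ^ (-(N:ℝ) / 2) ≤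
      ∫ τ in t..t', τ ^ (m - 1) * (s + τ) ^ (-(N:ℝ) / 2) := by
  refine intervalIntegral.integral_mono_on htt'
    (intervalIntegrable_greenF_of_le (hs.trans_le hss') ht (ht.trans htt'))
    (intervalIntegrable_greenF_of_le hs ht (ht.trans htt')) fun τ hτ => ?_
  have hτ0 : 0 ≤ τ := ht.trans hτ.1
  refine mul_le_mul_of_nonneg_left (Real.rpow_le_rpow_of_nonpos (by positivity) (by linarith) ?_)
    (by positivity)
  have : (0:ℝ) ≤ N := N.cast_nonneg
  linarith

lemma greenF_anti_left (hs : 0 < s) (hss' : s ≤ s') (ht : 0 ≤ t) :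
    greenF N m s' t ≤ greenF N m s t :=
  integral_greenF_anti hs hss' le_rfl ht

lemma greenF_add_le (hs : 0 < s) (hss' : s ≤ s') {t₁₁ t₁₂ t₂₁ t₂₂ : ℝ} (h0 : 0 ≤ t₁₁)
    (h1 : t₁₁ ≤ t₁₂) (h2 : t₁₁ ≤ t₂₁) (h3 : t₁₂ ≤ t₂₂) :
    greenF N m s t₁₁ + greenF N m s' t₁₂ ≤ greenF N m s t₂₂ + greenF N m s' t₂₁ := by
  have hs' := hs.trans_le hss'
  rcases le_total t₁₂ t₂₁ with h | h
  · have := greenF_mono_right (N := N) (m := m) hs h0 (h1.trans h3)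
    have := greenF_mono_right (N := N) (m := m) hs' (h0.trans h1) h
    linarith
  · have e1 := greenF_sub_greenF (N := N) (m := m) hs' (h0.trans h2) (h0.trans h1)
    have e2 := greenF_sub_greenF (N := N) (m := m) hs (h0.trans h2) (h0.trans h1)
    have := integral_greenF_anti (N := N) (m := m) hs hss' (h0.trans h2) h
    have := greenF_mono_right (N := N) (m := m) hs h0 h2
    have := greenF_mono_right (N := N) (m := m) hs (h0.trans h1) h3
    linarith

lemma greenF_mul (hm : 0 < m) {l : ℝ} (hl : 0 < l) (hs : 0 ≤ s) (ht : 0 ≤ t) :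
    greenF N m (l * s) (l * t) = l ^ ((m:ℝ) - N / 2) * greenF N m s t := by
  have h := intervalIntegral.mul_integral_comp_mul_left (a := 0) (b := t)
    (f := fun τ => τ ^ (m - 1) * (l * s + τ) ^ (-(N:ℝ) / 2)) l
  rw [mul_zero] at h
  rw [greenF, ← h, greenF, ← intervalIntegral.integral_const_mul,
    ← intervalIntegral.integral_const_mul]
  refine intervalIntegral.integral_congr fun τ hτ => ?_
  rw [uIcc_of_le ht] at hτ
  have hτ0 := hτ.1
  have e : l ^ ((m:ℝ) - N / 2) = l ^ m * l ^ (-(N:ℝ) / 2) := by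
    rw [← Real.rpow_natCast l m, ← Real.rpow_add hl]; ring_nf
  obtain ⟨k, rfl⟩ : ∃ k, m = k + 1 := ⟨m - 1, (Nat.sub_add_cancel hm).symm⟩
  simp only [Nat.add_sub_cancel]
  rw [e, ← mul_add, Real.mul_rpow hl.le (by positivity), mul_pow, pow_succ]
  ring

lemma greenF_le (hN : 0 < N) (hs : 0 < s) (ht : 0 ≤ t) :
    greenF N m s t ≤ t ^ (m - 1) * s ^ (-((N:ℝ) - 1) / 2) * (2 * t ^ (1 / 2 : ℝ)) := by
  have e : ∫ τ in (0:ℝ)..t, τ ^ (-(1 / 2) : ℝ) = 2 * t ^ (1 / 2 : ℝ) := by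
    rw [integral_rpow (Or.inl (by norm_num)), Real.zero_rpow (by norm_num)]
    norm_num
    ring
  rw [← e, ← intervalIntegral.integral_const_mul]
  refine intervalIntegral.integral_mono_on_of_le_Ioo ht (intervalIntegrable_greenF N m hs ht)
    ((intervalIntegral.intervalIntegrable_rpow' (by norm_num)).const_mul _) fun τ hτ => ?_
  have hτ0 := hτ.1
  have hN1 : (1:ℝ) ≤ N := by exact_mod_cast hN
  have e1 : (s + τ) ^ (-(N:ℝ) / 2) = (s + τ) ^ (-((N:ℝ) - 1) / 2) * (s + τ) ^ (-(1 / 2) : ℝ) := by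
    rw [← Real.rpow_add (by positivity)]; ring_nf
  rw [e1, mul_assoc]
  have h1 : (s + τ) ^ (-((N:ℝ) - 1) / 2) ≤ s ^ (-((N:ℝ) - 1) / 2) :=
    Real.rpow_le_rpow_of_nonpos hs (by linarith) (by linarith)
  have h2 : (s + τ) ^ (-(1 / 2) : ℝ) ≤ τ ^ (-(1 / 2) : ℝ) :=
    Real.rpow_le_rpow_of_nonpos hτ0 (by linarith) (by norm_num)
  have h3 := pow_le_pow_left₀ hτ0.le hτ.2.le (m - 1)
  gcongr

end

section

variable {N : ℕ} {p : EE N} {r : ℝ}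

lemma abs_det_fderiv_inversion (y : EE N) :
    |(((r / dist y p) ^ 2 • ((ℝ ∙ (y - p))ᗮ.reflection : EE N →L[ℝ] EE N))).det| =
      (r / ‖y - p‖) ^ (2 * N) := by
  have h : (((ℝ ∙ (y - p))ᗮ.reflection : EE N →L[ℝ] EE N) : EE N →ₗ[ℝ] EE N) =
    (ℝ ∙ (y - p))ᗮ.reflection.toLinearMap := rfl
  rw [ContinuousLinearMap.det, ContinuousLinearMap.toLinearMap_smul, LinearMap.det_smul, h,
    Submodule.det_reflection, abs_mul, abs_pow (-1), abs_neg, abs_one, one_pow, mul_one,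
    finrank_euclideanSpace, Fintype.card_fin, ← pow_mul, dist_eq_norm,
    abs_of_nonneg ((even_two_mul N).pow_nonneg _)]

lemma integrableOn_image_inversion_iff (hr : r ≠ 0) {T : Set (EE N)} (hT : MeasurableSet T)
    (hp : p ∉ T) (g : EE N → ℝ) :
    IntegrableOn g (inversion p r '' T) ↔
      IntegrableOn (fun y => (r / ‖y - p‖) ^ (2 * N) * g (inversion p r y)) T := by
  rw [integrableOn_image_iff_integrableOn_abs_det_fderiv_smul volume hT
    (fun y hy => (hasFDerivAt_inversion (ne_of_mem_of_not_mem hy hp)).hasFDerivWithinAt)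
    (inversion_injective p hr).injOn]
  simp only [abs_det_fderiv_inversion, smul_eq_mul]

lemma setIntegral_image_inversion (hr : r ≠ 0) {T : Set (EE N)} (hT : MeasurableSet T)
    (hp : p ∉ T) (g : EE N → ℝ) :
    ∫ y in inversion p r '' T, g y =
      ∫ y in T, (r / ‖y - p‖) ^ (2 * N) * g (inversion p r y) := by
  rw [integral_image_eq_integral_abs_det_fderiv_smul volume hT
    (fun y hy => (hasFDerivAt_inversion (ne_of_mem_of_not_mem hy hp)).hasFDerivWithinAt)
    (inversion_injective p hr).injOn]
  simp only [abs_det_fderiv_inversion, smul_eq_mul]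

lemma inversion_eq (z : EE N) : inversion p r z = (r / ‖z - p‖) ^ 2 • (z - p) + p := by
  rw [inversion, dist_eq_norm]; rfl

/-- The symmetric expression `|z - y|²` turns into under inversion in one of the variables. -/
noncomputable def sphDist (p : EE N) (r : ℝ) (z y : EE N) : ℝ :=
  ‖y - z‖ ^ 2 + (r ^ 2 - ‖z - p‖ ^ 2) * (r ^ 2 - ‖y - p‖ ^ 2) / r ^ 2

lemma sphDist_comm (z y : EE N) : sphDist p r z y = sphDist p r y z := by
  rw [sphDist, sphDist, norm_sub_rev]; ring

lemma normsq_inversion_sub (hr : r ≠ 0) {y : EE N} (hy : y ≠ p) (z : EE N) :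
    ‖inversion p r y - z‖ ^ 2 = (r / ‖y - p‖) ^ 2 * sphDist p r z y := by
  have hd : ‖y - p‖ ≠ 0 := norm_ne_zero_iff.2 (sub_ne_zero.2 hy)
  have e1 : inversion p r y - z = (r / ‖y - p‖) ^ 2 • (y - p) - (z - p) := by
    rw [inversion_eq]; abel
  have e2 : y - z = (y - p) - (z - p) := by abel
  rw [e1, sphDist, e2, norm_sub_sq_real ((r / ‖y - p‖) ^ 2 • (y - p)),
    norm_sub_sq_real (y - p), real_inner_smul_left, norm_smul, Real.norm_eq_abs, mul_pow, sq_abs]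
  field_simp
  ring

lemma sphDist_of_cap {z y : EE N} (hr : 0 < r) (hz : ‖z - p‖ < r) (hy : ‖y - p‖ < r) :
    ‖y - z‖ ^ 2 ≤ sphDist p r z y := by
  rw [sphDist, le_add_iff_nonneg_right]
  have h1 : 0 < r ^ 2 - ‖z - p‖ ^ 2 := by nlinarith [norm_nonneg (z - p)]
  have h2 : 0 < r ^ 2 - ‖y - p‖ ^ 2 := by nlinarith [norm_nonneg (y - p)]
  positivity

lemma sphDist_of_not_cap {z y : EE N} (hr : 0 < r) (hz : ‖z - p‖ < r) (hy : r ≤ ‖y - p‖) :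
    sphDist p r z y ≤ ‖y - z‖ ^ 2 := by
  rw [sphDist, add_le_iff_nonpos_right]
  have h1 : 0 < r ^ 2 - ‖z - p‖ ^ 2 := by nlinarith [norm_nonneg (z - p)]
  have h2 : r ^ 2 - ‖y - p‖ ^ 2 ≤ 0 := by nlinarith
  exact div_nonpos_of_nonpos_of_nonneg (mul_nonpos_of_nonneg_of_nonpos h1.le h2) (sq_nonneg r)

lemma rpow_conformal {m : ℕ} {J : ℝ} (hJ : 0 < J) :
    J ^ ((N:ℝ) - 2 * m) * (J ^ 2) ^ ((m:ℝ) - N / 2) = 1 := by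
  rw [← Real.rpow_natCast J 2, ← Real.rpow_mul hJ.le, ← Real.rpow_add hJ]
  convert Real.rpow_zero J using 2
  push_cast
  ring

end

section

variable {N : ℕ} [NeZero N] {m : ℕ} {p : EE N} {r : ℝ}

/-- The height of `inversion p r z`, normalized by the conformal factor of the inversion. -/
noncomputable def invHeight (p : EE N) (r : ℝ) (z : EE N) : ℝ :=
  z 0 + -p 0 * (1 - (‖z - p‖ / r) ^ 2)

lemma inversion_coord (hr : r ≠ 0) {z : EE N} (hz : z ≠ p) :
    inversion p r z 0 = (r / ‖z - p‖) ^ 2 * invHeight p r z := by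
  have hd : ‖z - p‖ ≠ 0 := norm_ne_zero_iff.2 (sub_ne_zero.2 hz)
  rw [inversion_eq, PiLp.add_apply, PiLp.smul_apply, PiLp.sub_apply, invHeight, smul_eq_mul]
  field_simp
  ring

lemma rpow_mul_green_inversion_right (hm : 0 < m) (hr : 0 < r) {z y : EE N} (hy : y ≠ p)
    (hz0 : 0 ≤ z 0) (hyh : 0 ≤ invHeight p r y) :
    (r / ‖y - p‖) ^ ((N:ℝ) - 2 * m) * green m z (inversion p r y) =
      greenF N m (sphDist p r z y) (4 * z 0 * invHeight p r y) := by
  have hd : 0 < ‖y - p‖ := norm_pos_iff.2 (sub_ne_zero.2 hy)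
  have hJ : 0 < r / ‖y - p‖ := by positivity
  have h1 := normsq_inversion_sub hr.ne' hy z
  have hs : 0 ≤ sphDist p r z y := by
    have : 0 ≤ (r / ‖y - p‖) ^ 2 * sphDist p r z y := h1 ▸ sq_nonneg _
    exact nonneg_of_mul_nonneg_right this (by positivity)
  rw [green, h1, inversion_coord hr.ne' hy,
    show 4 * z 0 * ((r / ‖y - p‖) ^ 2 * invHeight p r y) =
      (r / ‖y - p‖) ^ 2 * (4 * z 0 * invHeight p r y) by ring,
    greenF_mul hm (by positivity) hs (by positivity), ← mul_assoc, rpow_conformal hJ, one_mul]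

lemma green_comm (x y : EE N) : green m x y = green m y x := by
  rw [green, green, norm_sub_rev]; ring_nf

lemma rpow_mul_green_inversion_left (hm : 0 < m) (hr : 0 < r) {z y : EE N} (hz : z ≠ p)
    (hy0 : 0 ≤ y 0) (hzh : 0 ≤ invHeight p r z) :
    (r / ‖z - p‖) ^ ((N:ℝ) - 2 * m) * green m (inversion p r z) y =
      greenF N m (sphDist p r z y) (4 * invHeight p r z * y 0) := by
  rw [green_comm, rpow_mul_green_inversion_right hm hr hz hy0 hzh, sphDist_comm]
  ring_nf

lemma rpow_mul_green_inversion_inversion (hm : 0 < m) (hr : 0 < r) {z y : EE N} (hz : z ≠ p)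
    (hy : y ≠ p) (hyh : 0 ≤ invHeight p r y) (hzh : 0 ≤ invHeight p r z) :
    (r / ‖z - p‖) ^ ((N:ℝ) - 2 * m) * ((r / ‖y - p‖) ^ ((N:ℝ) - 2 * m) *
      green m (inversion p r z) (inversion p r y)) =
      greenF N m (‖y - z‖ ^ 2) (4 * invHeight p r z * invHeight p r y) := by
  have hd : 0 < ‖y - p‖ := norm_pos_iff.2 (sub_ne_zero.2 hy)
  have hd' : 0 < ‖z - p‖ := norm_pos_iff.2 (sub_ne_zero.2 hz)
  have hJ : 0 < r / ‖y - p‖ := by positivity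
  have hJ' : 0 < r / ‖z - p‖ := by positivity
  have h1 : ‖inversion p r y - inversion p r z‖ ^ 2 =
      (r / ‖z - p‖) ^ 2 * ((r / ‖y - p‖) ^ 2 * ‖y - z‖ ^ 2) := by
    rw [← dist_eq_norm, dist_inversion_inversion hy hz, dist_eq_norm, dist_eq_norm, dist_eq_norm]
    field_simp
  rw [green, h1, inversion_coord hr.ne' hy, inversion_coord hr.ne' hz,
    show 4 * ((r / ‖z - p‖) ^ 2 * invHeight p r z) * ((r / ‖y - p‖) ^ 2 * invHeight p r y) =
      (r / ‖z - p‖) ^ 2 * ((r / ‖y - p‖) ^ 2 * (4 * invHeight p r z * invHeight p r y)) by ring,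
    greenF_mul hm (by positivity) (by positivity) (by positivity),
    greenF_mul hm (by positivity) (by positivity) (by positivity)]
  have e1 := rpow_conformal (N := N) (m := m) hJ
  have e2 := rpow_conformal (N := N) (m := m) hJ'
  linear_combination (greenF N m (‖y - z‖ ^ 2) (4 * invHeight p r z * invHeight p r y)) *
    ((r / ‖z - p‖) ^ ((N:ℝ) - 2 * m) * ((r / ‖z - p‖) ^ 2) ^ ((m:ℝ) - N / 2) * e1 + e2)

end

/-- Positive bounded solutions of the integral equation with the half-space Green function. -/
structure IsGreenSol (N m : ℕ) [NeZero N] (q : ℝ) (u : EE N → ℝ) (c M : ℝ) : Prop where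
  c_pos : 0 < c
  pos : ∀ x ∈ hs N, 0 < u x
  le : ∀ x ∈ hs N, u x ≤ M
  continuousOn : ContinuousOn u (hs N)
  integrableOn : ∀ x ∈ hs N, IntegrableOn (fun y => green m x y * u y ^ q) (hs N)
  eq_integral : ∀ x ∈ hs N, u x = c * ∫ y in hs N, green m x y * u y ^ q

section

variable {N : ℕ} [NeZero N] {m : ℕ} {p : EE N} {r : ℝ}

/-- The part of the half-space inside a ball. -/
def cap (p : EE N) (r : ℝ) : Set (EE N) := hs N ∩ Metric.ball p r

lemma isOpen_cap : IsOpen (cap p r) := isOpen_hs.inter Metric.isOpen_ball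

lemma ne_center_of_mem_hs (hp : p 0 < 0) {z : EE N} (hz : z ∈ hs N) : z ≠ p := by
  rintro rfl
  exact lt_asymm hp hz

lemma lt_invHeight (hp : p 0 < 0) (hr : 0 < r) {z : EE N} (hz : z ∈ cap p r) :
    z 0 < invHeight p r z := by
  have h1 : ‖z - p‖ < r := by rw [← dist_eq_norm]; exact hz.2
  have h2 : (‖z - p‖ / r) ^ 2 < 1 :=
    pow_lt_one₀ (by positivity) ((div_lt_one hr).2 h1) two_ne_zero
  rw [invHeight, lt_add_iff_pos_right]
  exact mul_pos (by linarith) (by linarith)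

lemma invHeight_pos (hp : p 0 < 0) (hr : 0 < r) {z : EE N} (hz : z ∈ cap p r) :
    0 < invHeight p r z := lt_trans hz.1 (lt_invHeight hp hr hz)

lemma inversion_mem_hs (hp : p 0 < 0) (hr : 0 < r) {z : EE N} (hz : z ∈ cap p r) :
    inversion p r z ∈ hs N := by
  have hzp := ne_center_of_mem_hs hp hz.1
  have hd : 0 < ‖z - p‖ := norm_pos_iff.2 (sub_ne_zero.2 hzp)
  have h := invHeight_pos hp hr hz
  rw [mem_hs, inversion_coord hr.ne' hzp]
  positivity

lemma lt_norm_inversion_sub (hp : p 0 < 0) (hr : 0 < r) {z : EE N} (hz : z ∈ cap p r) :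
    r < ‖inversion p r z - p‖ := by
  have hd : 0 < dist z p := dist_pos.2 (ne_center_of_mem_hs hp hz.1)
  rw [← dist_eq_norm, dist_inversion_center, lt_div_iff₀ hd]
  have : dist z p < r := hz.2
  nlinarith

lemma measurableSet_image_cap (hp : p 0 < 0) (hr : 0 < r) :
    MeasurableSet (inversion p r '' cap p r) :=
  measurable_image_of_fderivWithin isOpen_cap.measurableSet
    (fun _ hy => (hasFDerivAt_inversion (ne_center_of_mem_hs hp hy.1)).hasFDerivWithinAt)
    (inversion_injective p hr.ne').injOn

/-- The part of the half-space that is covered neither by a cap nor by its inversion. -/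
def capRest (p : EE N) (r : ℝ) : Set (EE N) := hs N \ (cap p r ∪ inversion p r '' cap p r)

lemma measurableSet_capRest (hp : p 0 < 0) (hr : 0 < r) : MeasurableSet (capRest p r) :=
  measurableSet_hs.diff (isOpen_cap.measurableSet.union (measurableSet_image_cap hp hr))

lemma integral_hs_eq (hp : p 0 < 0) (hr : 0 < r) {g : EE N → ℝ} (hg : IntegrableOn g (hs N)) :
    IntegrableOn (fun y => g y + (r / ‖y - p‖) ^ (2 * N) * g (inversion p r y)) (cap p r) ∧
    ∫ y in hs N, g y =
      (∫ y in cap p r, (g y + (r / ‖y - p‖) ^ (2 * N) * g (inversion p r y))) +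
        ∫ y in capRest p r, g y := by
  have hsub : cap p r ∪ inversion p r '' cap p r ⊆ hs N := by
    rintro y (hy | ⟨z, hz, rfl⟩)
    · exact hy.1
    · exact inversion_mem_hs hp hr hz
  have hdis : Disjoint (cap p r) (inversion p r '' cap p r) := by
    rw [disjoint_right]
    rintro _ ⟨z, hz, rfl⟩ h
    have h1 := lt_norm_inversion_sub hp hr hz
    rw [← dist_eq_norm] at h1
    exact lt_asymm h1 h.2
  have hpc : p ∉ cap p r := fun h => lt_asymm hp h.1
  have hmi := measurableSet_image_cap hp hr
  have hmc := (isOpen_cap (p := p) (r := r)).measurableSet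
  have i1 := hg.mono_set (subset_union_left.trans hsub)
  have i2 := hg.mono_set (subset_union_right.trans hsub)
  have i2' := (integrableOn_image_inversion_iff hr.ne' hmc hpc g).1 i2
  refine ⟨i1.add i2', ?_⟩
  rw [integral_add i1 i2', ← setIntegral_image_inversion hr.ne' hmc hpc,
    ← setIntegral_union hdis hmi i1 i2, capRest, setIntegral_sdiff (hmc.union hmi) hg hsub]
  ring

lemma volume_capRest_pos (hp : p 0 < 0) (hr : 0 < r) : 0 < volume (capRest p r) := by
  have hcont : Continuous (invHeight p r) := by
    unfold invHeight
    have := continuous_coord (N := N) 0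
    fun_prop
  have hopen : IsOpen (hs N ∩ ({y | r < ‖y - p‖} ∩ {y | invHeight p r y < 0})) :=
    isOpen_hs.inter ((isOpen_lt continuous_const (by fun_prop)).inter
      (isOpen_lt hcont continuous_const))
  have hsub : hs N ∩ ({y | r < ‖y - p‖} ∩ {y | invHeight p r y < 0}) ⊆ capRest p r := by
    rintro y ⟨hy, hy1, hy2⟩
    have hy1 : r < ‖y - p‖ := hy1
    have hy2 : invHeight p r y < 0 := hy2
    refine ⟨hy, ?_⟩
    rintro (h | ⟨z, hz, rfl⟩)
    · have : dist y p < r := h.2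
      rw [dist_eq_norm] at this
      exact lt_asymm hy1 this
    · have h1 := inversion_coord (r := r) hr.ne' (ne_center_of_mem_hs hp hy)
      rw [inversion_inversion p hr.ne'] at h1
      have h2 : 0 < z 0 := hz.1
      have := mul_nonpos_of_nonneg_of_nonpos (sq_nonneg (r / ‖inversion p r z - p‖)) hy2.le
      linarith
  refine (hopen.measure_pos volume ?_).trans_le (measure_mono hsub)
  set a := -p 0 with ha
  have ha0 : 0 < a := by linarith
  set L := r + a + r ^ 2 / a with hL
  have hra : 0 < r ^ 2 / a := by positivity
  have hn : ‖p + L • e1 N - p‖ = L := by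
    rw [add_sub_cancel_left, norm_smul, norm_e1, mul_one, Real.norm_eq_abs,
      abs_of_pos (by positivity)]
  have hc : (p + L • e1 N) 0 = L - a := by simp [e1, ha]; ring
  refine ⟨p + L • e1 N, ?_, ?_, ?_⟩
  · rw [mem_hs, hc]; linarith
  · show r < _
    rw [hn]; linarith
  · show _ < (0:ℝ)
    rw [invHeight, hc, hn, ← ha]
    have h1 : r ^ 2 / a * a = r ^ 2 := by field_simp
    have h2 : L - a + a * (1 - (L / r) ^ 2) = L * (r ^ 2 - a * L) / r ^ 2 := by
      field_simp; ring
    rw [h2]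
    refine div_neg_of_neg_of_pos (mul_neg_of_pos_of_neg (by positivity) ?_) (by positivity)
    nlinarith

/-- The inverted Green function `J(z)^(N-2m) G(z*, y)`. -/
noncomputable def greenInv (m : ℕ) (p : EE N) (r : ℝ) (z y : EE N) : ℝ :=
  greenF N m (sphDist p r z y) (4 * invHeight p r z * y 0)

lemma green_lt_greenInv (hp : p 0 < 0) (hr : 0 < r) {z y : EE N} (hz : z ∈ cap p r)
    (hy : y ∈ capRest p r) : green m z y < greenInv m p r z y := by
  have hz0 : 0 < z 0 := hz.1
  have hy0 : 0 < y 0 := hy.1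
  have hzr : ‖z - p‖ < r := by rw [← dist_eq_norm]; exact hz.2
  have hyr : r ≤ ‖y - p‖ := by
    by_contra h
    exact hy.2 (Or.inl ⟨hy.1, by rw [Metric.mem_ball, dist_eq_norm]; exact not_le.1 h⟩)
  have hzp := ne_center_of_mem_hs hp hz.1
  have hd : 0 < ‖z - p‖ := norm_pos_iff.2 (sub_ne_zero.2 hzp)
  have hs' : 0 < sphDist p r z y := by
    have h1 := normsq_inversion_sub hr.ne' hzp y
    have h2 : inversion p r z ≠ y := fun h => hy.2 (Or.inr ⟨z, hz, h⟩)
    have h3 : 0 < ‖inversion p r z - y‖ := norm_pos_iff.2 (sub_ne_zero.2 h2)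
    rw [sphDist_comm] at h1
    have h4 : 0 < (r / ‖z - p‖) ^ 2 * sphDist p r z y := h1 ▸ pow_pos h3 2
    exact pos_of_mul_pos_right h4 (by positivity)
  have hle := sphDist_of_not_cap hr hzr hyr
  have hh := lt_invHeight hp hr hz
  have hlt : 4 * z 0 * y 0 < 4 * invHeight p r z * y 0 := by nlinarith
  exact (greenF_strictMono_right (hs'.trans_le hle) (by positivity) hlt).trans_le
    (greenF_anti_left hs' hle (le_trans (by positivity) hlt.le))

end

lemma rpow_sub_rpow_le {q a b M : ℝ} (hq : 1 ≤ q) (hb : 0 ≤ b) (hba : b ≤ a) (ha : 0 < a)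
    (haM : a ≤ M) : a ^ q - b ^ q ≤ q * M ^ (q - 1) * (a - b) := by
  have h := one_add_mul_self_le_rpow_one_add (s := b / a - 1) (by linarith [div_nonneg hb ha.le]) hq
  rw [add_sub_cancel, Real.div_rpow hb ha.le] at h
  have h1 : a ^ q = a ^ (q - 1) * a := by
    rw [← Real.rpow_add_one ha.ne', sub_add_cancel]
  have h2 := mul_le_mul_of_nonneg_right h (Real.rpow_nonneg ha.le q)
  rw [div_mul_cancel₀ _ (Real.rpow_pos_of_pos ha q).ne'] at h2
  have h3 : (1 + q * (b / a - 1)) * a ^ q = a ^ q + q * a ^ (q - 1) * (b - a) := by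
    rw [h1]; field_simp
  have h4 : a ^ (q - 1) ≤ M ^ (q - 1) := Real.rpow_le_rpow ha.le haM (by linarith)
  have h5 : q * a ^ (q - 1) * (a - b) ≤ q * M ^ (q - 1) * (a - b) :=
    mul_le_mul_of_nonneg_right (mul_le_mul_of_nonneg_left h4 (by linarith)) (by linarith)
  linarith

section

variable {N : ℕ} [NeZero N] {m : ℕ} {p : EE N} {r : ℝ} {q : ℝ} {u : EE N → ℝ} {c M : ℝ}

/-- The difference between `u` and its Kelvin transform with respect to a sphere. -/
noncomputable def sphDiff (m : ℕ) (u : EE N → ℝ) (p : EE N) (r : ℝ) (z : EE N) : ℝ :=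
  u z - (r / ‖z - p‖) ^ ((N:ℝ) - 2 * m) * u (inversion p r z)

lemma one_lt_conformal (hp : p 0 < 0) {z : EE N} (hz : z ∈ cap p r) : 1 < r / ‖z - p‖ := by
  have hd : 0 < ‖z - p‖ := norm_pos_iff.2 (sub_ne_zero.2 (ne_center_of_mem_hs hp hz.1))
  rw [one_lt_div hd, ← dist_eq_norm]
  exact hz.2

lemma continuousOn_sphDiff (hu : ContinuousOn u (hs N)) (hp : p 0 < 0) (hr : 0 < r) :
    ContinuousOn (sphDiff m u p r) (cap p r) := by
  intro z hz
  have hd : 0 < ‖z - p‖ := norm_pos_iff.2 (sub_ne_zero.2 (ne_center_of_mem_hs hp hz.1))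
  have h1 : ContinuousAt u z := hu.continuousAt (isOpen_hs.mem_nhds hz.1)
  have h2 : ContinuousAt u (inversion p r z) :=
    hu.continuousAt (isOpen_hs.mem_nhds (inversion_mem_hs hp hr hz))
  have h3 : ContinuousAt (inversion p r) z :=
    (hasFDerivAt_inversion (ne_center_of_mem_hs hp hz.1)).continuousAt
  have h4 : ContinuousAt (fun z => r / ‖z - p‖) z :=
    continuousAt_const.div (by fun_prop) hd.ne'
  have h5 : ContinuousAt (fun z => (r / ‖z - p‖) ^ ((N:ℝ) - 2 * m)) z :=
    h4.rpow_const (Or.inl (by positivity))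
  exact (h1.sub (h5.mul (ContinuousAt.comp (g := u) h2 h3))).continuousWithinAt

/-- The set in the cap where `u` exceeds its Kelvin transform. -/
def badSet (m : ℕ) (u : EE N → ℝ) (p : EE N) (r : ℝ) : Set (EE N) :=
  cap p r ∩ sphDiff m u p r ⁻¹' Ioi 0

lemma measurableSet_badSet (hu : ContinuousOn u (hs N)) (hp : p 0 < 0) (hr : 0 < r) :
    MeasurableSet (badSet m u p r) :=
  ((continuousOn_sphDiff hu hp hr).isOpen_inter_preimage isOpen_cap isOpen_Ioi).measurableSet

namespace IsGreenSol

lemma integrand_le (h : IsGreenSol N m q u c M) (hq : 1 < q)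
    (hcrit : ((N:ℝ) - 2 * m) * q ≤ N + 2 * m) (hm : 0 < m) (hp : p 0 < 0) (hr : 0 < r)
    {z y : EE N} (hz : z ∈ cap p r) (hy : y ∈ cap p r) (hyz : y ≠ z) {S : ℝ}
    (hDS : sphDiff m u p r y ≤ S) {G : EE N → ℝ}
    (hG : ∀ y, G y = green m z y * u y ^ q -
      (r / ‖z - p‖) ^ ((N:ℝ) - 2 * m) * (green m (inversion p r z) y * u y ^ q)) :
    G y + (r / ‖y - p‖) ^ (2 * N) * G (inversion p r y) ≤
      (badSet m u p r).indicator (fun y => q * M ^ (q - 1) * S * green m z y) y := by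
  have hzp := ne_center_of_mem_hs hp hz.1
  have hyp := ne_center_of_mem_hs hp hy.1
  have hz0 : 0 < z 0 := hz.1
  have hy0 : 0 < y 0 := hy.1
  have hzh := lt_invHeight hp hr hz
  have hyh := lt_invHeight hp hr hy
  have hzr : ‖z - p‖ < r := by rw [← dist_eq_norm]; exact hz.2
  have hyr : ‖y - p‖ < r := by rw [← dist_eq_norm]; exact hy.2
  have e12 := rpow_mul_green_inversion_right hm hr hyp hz0.le (hy0.trans hyh).le
  have e21 := rpow_mul_green_inversion_left hm hr hzp hy0.le (hz0.trans hzh).le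
  have e22 := rpow_mul_green_inversion_inversion hm hr hzp hyp (hy0.trans hyh).le (hz0.trans hzh).le
  have hs0 : 0 < ‖y - z‖ ^ 2 := pow_pos (norm_pos_iff.2 (sub_ne_zero.2 hyz)) 2
  have hss := sphDist_of_cap hr hzr hyr
  have k1 := greenF_add_le (N := N) (m := m) (t₁₁ := 4 * z 0 * y 0)
    (t₁₂ := 4 * z 0 * invHeight p r y) (t₂₁ := 4 * invHeight p r z * y 0)
    (t₂₂ := 4 * invHeight p r z * invHeight p r y) hs0 hss (by positivity)
    (by nlinarith) (by nlinarith) (by nlinarith [hy0.trans hyh])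
  have k2 := greenF_anti_left (N := N) (m := m) (t := 4 * z 0 * invHeight p r y) hs0 hss
    (by nlinarith [mul_pos hz0 (hy0.trans hyh)])
  have k3 := greenF_mono_right (N := N) (m := m) (t := 4 * z 0 * invHeight p r y)
    (t' := 4 * invHeight p r z * invHeight p r y) hs0
    (by nlinarith [mul_pos hz0 (hy0.trans hyh)]) (by nlinarith [hy0.trans hyh])
  have k4 := greenF_nonneg (N := N) (m := m) (t := 4 * invHeight p r z * y 0) (hs0.trans_le hss).le
    (by nlinarith [mul_pos hy0 (hz0.trans hzh)])
  have k5 := greenF_nonneg (N := N) (m := m) (t := 4 * z 0 * y 0) hs0.le (by positivity)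
  set J := r / ‖y - p‖ with hJ
  set L := (r / ‖z - p‖) ^ ((N:ℝ) - 2 * m) with hL
  have hJ1 : 1 < J := one_lt_conformal hp hy
  have hJ0 : 0 < J := zero_lt_one.trans hJ1
  have hJN : J ^ (2 * N) = J ^ ((N:ℝ) - 2 * m) * J ^ ((N:ℝ) + 2 * m) := by
    rw [← Real.rpow_add hJ0, ← Real.rpow_natCast]
    push_cast
    ring_nf
  have hui := h.pos _ (inversion_mem_hs hp hr hy)
  set w := J ^ ((N:ℝ) - 2 * m) * u (inversion p r y) with hw
  have hw0 : 0 < w := mul_pos (Real.rpow_pos_of_pos hJ0 _) hui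
  have hb : w ^ q ≤ J ^ ((N:ℝ) + 2 * m) * u (inversion p r y) ^ q := by
    rw [hw, Real.mul_rpow (by positivity) hui.le, ← Real.rpow_mul hJ0.le]
    exact mul_le_mul_of_nonneg_right (Real.rpow_le_rpow_of_exponent_le hJ1.le hcrit)
      (by positivity)
  have hD : sphDiff m u p r y = u y - w := rfl
  have hu := h.pos y hy.1
  have hM := h.le y hy.1
  have e11 : green m z y = greenF N m (‖y - z‖ ^ 2) (4 * z 0 * y 0) := rfl
  rw [hD] at hDS
  set K11 := greenF N m (‖y - z‖ ^ 2) (4 * z 0 * y 0)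
  set K12 := greenF N m (sphDist p r z y) (4 * z 0 * invHeight p r y)
  set K21 := greenF N m (sphDist p r z y) (4 * invHeight p r z * y 0)
  set K22 := greenF N m (‖y - z‖ ^ 2) (4 * invHeight p r z * invHeight p r y)
  set b := J ^ ((N:ℝ) + 2 * m) * u (inversion p r y) ^ q with hbdef
  have heq : G y + J ^ (2 * N) * G (inversion p r y) =
      (K11 - K21) * u y ^ q - (K22 - K12) * b := by
    rw [hG, hG, e11, ← e12, ← e21, ← e22, hJN, hbdef]
    ring
  rw [heq]
  have hwq : 0 < w ^ q := Real.rpow_pos_of_pos hw0 q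
  have h1 : 0 ≤ (K22 - K12) * (b - w ^ q) := mul_nonneg (by linarith) (by linarith)
  by_cases hA : y ∈ badSet m u p r
  · rw [indicator_of_mem hA, e11]
    have hwu : w < u y := sub_pos.1 (show 0 < u y - w from hA.2)
    have h2 := rpow_sub_rpow_le hq.le hw0.le hwu.le hu hM
    have hM0 : 0 ≤ q * M ^ (q - 1) := mul_nonneg (by linarith) (Real.rpow_nonneg (by linarith) _)
    have h3 := mul_le_mul_of_nonneg_left hDS hM0
    have h4 : w ^ q ≤ u y ^ q := Real.rpow_le_rpow hw0.le hwu.le (by linarith)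
    have h5 := mul_le_mul_of_nonneg_right (h2.trans h3) k5
    have h6 := mul_nonneg k4 (sub_nonneg.2 h4)
    have h7 : 0 ≤ (K22 + K21 - K11 - K12) * w ^ q := mul_nonneg (by linarith) hwq.le
    linarith
  · rw [indicator_of_notMem hA]
    have hwu : u y ≤ w := by
      by_contra h'
      exact hA ⟨hy, show 0 < u y - w by linarith⟩
    have h4 : u y ^ q ≤ w ^ q := Real.rpow_le_rpow hu.le hwu (by linarith)
    have h5 : 0 ≤ (K22 - K12) * (w ^ q - u y ^ q) := mul_nonneg (by linarith) (by linarith)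
    have h6 : 0 ≤ (K22 + K21 - K11 - K12) * u y ^ q :=
      mul_nonneg (by linarith) (Real.rpow_nonneg hu.le q)
    linarith

lemma sphDiff_lt (h : IsGreenSol N m q u c M) (hq : 1 < q)
    (hcrit : ((N:ℝ) - 2 * m) * q ≤ N + 2 * m) (hm : 0 < m) (hp : p 0 < 0) (hr : 0 < r)
    {z : EE N} (hz : z ∈ cap p r) {S : ℝ} (hDS : ∀ y ∈ cap p r, sphDiff m u p r y ≤ S)
    (hi : IntegrableOn (green m z) (badSet m u p r)) :
    sphDiff m u p r z < c * (q * M ^ (q - 1) * S * ∫ y in badSet m u p r, green m z y) := by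
  have hzp := ne_center_of_mem_hs hp hz.1
  have hzi := inversion_mem_hs hp hr hz
  set G : EE N → ℝ := fun y => green m z y * u y ^ q -
      (r / ‖z - p‖) ^ ((N:ℝ) - 2 * m) * (green m (inversion p r z) y * u y ^ q) with hG
  have hGi : IntegrableOn G (hs N) :=
    (h.integrableOn z hz.1).sub ((h.integrableOn _ hzi).const_mul _)
  have hD : sphDiff m u p r z = c * ∫ y in hs N, G y := by
    rw [hG, integral_sub (h.integrableOn z hz.1) ((h.integrableOn _ hzi).const_mul _),
      integral_const_mul, sphDiff, h.eq_integral z hz.1, h.eq_integral _ hzi]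
    ring
  obtain ⟨h1, h2⟩ := integral_hs_eq hp hr hGi
  rw [hD, h2]
  refine mul_lt_mul_of_pos_left ?_ h.c_pos
  have hmb := measurableSet_badSet (m := m) (u := u) h.continuousOn hp hr
  have h3 : ∫ y in cap p r, (G y + (r / ‖y - p‖) ^ (2 * N) * G (inversion p r y)) ≤
      q * M ^ (q - 1) * S * ∫ y in badSet m u p r, green m z y := by
    have e : cap p r ∩ badSet m u p r = badSet m u p r :=
      inter_eq_self_of_subset_right inter_subset_left
    rw [← integral_const_mul, ← e, ← setIntegral_indicator hmb]
    refine integral_mono_ae h1 ?_ ?_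
    · exact ((integrable_indicator_iff hmb).2 (hi.const_mul _)).integrableOn
    · have hne : ∀ᵐ y ∂(volume.restrict (cap p r)), y ≠ z :=
        ae_restrict_of_ae (Measure.ae_ne volume z)
      filter_upwards [hne, ae_restrict_mem isOpen_cap.measurableSet] with y hyz hy
      exact h.integrand_le hq hcrit hm hp hr hz hy hyz (hDS y hy) fun _ => rfl
  have h4 : ∫ y in capRest p r, G y < 0 := by
    have hneg : ∀ y ∈ capRest p r, G y < 0 := fun y hy => by
      have e21 := rpow_mul_green_inversion_left hm hr hzp (le_of_lt hy.1)
        (invHeight_pos hp hr hz).le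
      have hlt := green_lt_greenInv (m := m) hp hr hz hy
      rw [greenInv] at hlt
      have hu := Real.rpow_pos_of_pos (h.pos y hy.1) q
      simp only [hG]
      rw [← mul_assoc, e21, ← sub_mul]
      exact mul_neg_of_neg_of_pos (sub_neg.2 hlt) hu
    have hmR := measurableSet_capRest (p := p) hp hr
    have hpos : 0 < ∫ y in capRest p r, -G y := by
      rw [setIntegral_pos_iff_support_of_nonneg_ae]
      · refine (volume_capRest_pos hp hr).trans_le (measure_mono fun y hy => ⟨?_, hy⟩)
        exact (neg_pos.2 (hneg y hy)).ne'
      · filter_upwards [ae_restrict_mem hmR] with y hy using (neg_pos.2 (hneg y hy)).le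
      · exact (hGi.mono_set sdiff_subset).neg
    rw [integral_neg] at hpos
    linarith
  linarith

end IsGreenSol

end

section

variable {N : ℕ} [NeZero N] {m : ℕ} {p : EE N} {r : ℝ} {q : ℝ} {u : EE N → ℝ} {c M : ℝ}

lemma integrable_indicator_norm_rpow (C R : ℝ) :
    Integrable (fun w : EE N => (Iio R).indicator (fun t : ℝ => C * t ^ (1 - (N:ℝ))) ‖w‖) := by
  have : Nontrivial (EE N) := Module.nontrivial_of_finrank_pos (R := ℝ) (by
    rw [finrank_euclideanSpace, Fintype.card_fin]; exact NeZero.pos N)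
  rw [integrable_fun_norm_addHaar volume
    (f := (Iio R).indicator (fun t : ℝ => C * t ^ (1 - (N:ℝ))))]
  have h1 : IntegrableOn ((Iio R).indicator fun _ : ℝ => C) (Ioi 0) := by
    rw [integrableOn_indicator_iff measurableSet_Iio]
    refine integrableOn_const ?_
    rw [Iio_inter_Ioi, Real.volume_Ioo]
    exact ENNReal.ofReal_ne_top
  refine h1.congr_fun (fun t ht => ?_) measurableSet_Ioi
  have ht : 0 < t := ht
  by_cases htR : t ∈ Iio R
  · simp only [indicator_of_mem htR]
    rw [finrank_euclideanSpace, Fintype.card_fin, smul_eq_mul, ← Real.rpow_natCast,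
      mul_left_comm, ← Real.rpow_add ht, Nat.cast_sub (NeZero.pos N), Nat.cast_one,
      sub_add_sub_cancel, sub_self, Real.rpow_zero, mul_one]
  · simp [indicator_of_notMem htR]

lemma aestronglyMeasurable_green (hm : 0 < m) {z : EE N} (hz : 0 ≤ z 0) :
    AEStronglyMeasurable (green m z) (volume.restrict (hs N)) := by
  refine aestronglyMeasurable_of_tendsto_ae atTop
    (f := fun (n : ℕ) y => testA m (trunc N n) z y * y 0 ^ m) (fun n => ?_) ?_
  · exact (((smooth_testA m (smooth_trunc N n) z).mul
      ((smooth_coord 0).pow m)).continuous).aestronglyMeasurable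
  · have hne : ∀ᵐ y ∂(volume.restrict (hs N)), y ≠ z :=
      ae_restrict_of_ae (Measure.ae_ne volume z)
    filter_upwards [hne, ae_restrict_mem measurableSet_hs] with y hyz hy
    exact tendsto_testA_trunc hm hz (le_of_lt hy) hyz

lemma green_le_of_mem_cap {R : ℝ} (hp : p 0 < 0) (hr : 0 < r) (hrR : r ≤ R) {z y : EE N}
    (hz : z ∈ cap p r) (hy : y ∈ cap p r) (hyz : y ≠ z) :
    green m z y ≤ (Iio (2 * R)).indicator (fun t : ℝ =>
      ((4 * R ^ 2) ^ (m - 1) * (2 * (4 * R ^ 2) ^ (1 / 2 : ℝ))) * t ^ (1 - (N:ℝ))) ‖y - z‖ := by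
  have hz0 : 0 < z 0 := hz.1
  have hy0 : 0 < y 0 := hy.1
  have hzr : ‖z - p‖ < r := by rw [← dist_eq_norm]; exact hz.2
  have hyr : ‖y - p‖ < r := by rw [← dist_eq_norm]; exact hy.2
  have hd : ‖y - z‖ < 2 * R := by
    have := norm_sub_le_norm_sub_add_norm_sub y p z
    rw [norm_sub_rev p z] at this
    linarith
  have hs0 : 0 < ‖y - z‖ := norm_pos_iff.2 (sub_ne_zero.2 hyz)
  have hc (w : EE N) (hw : ‖w - p‖ < r) : w 0 ≤ R := by
    have h1 := (le_abs_self _).trans (PiLp.norm_apply_le (w - p) 0)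
    rw [PiLp.sub_apply] at h1
    linarith
  have h1 := hc z hzr
  have h2 := hc y hyr
  have ht : 4 * z 0 * y 0 ≤ 4 * R ^ 2 := by nlinarith
  rw [indicator_of_mem (show ‖y - z‖ ∈ Iio (2 * R) from hd)]
  refine (greenF_le (NeZero.pos N) (pow_pos hs0 2) (by positivity)).trans ?_
  have e : (‖y - z‖ ^ 2) ^ (-((N:ℝ) - 1) / 2) = ‖y - z‖ ^ (1 - (N:ℝ)) := by
    rw [← Real.rpow_natCast, ← Real.rpow_mul hs0.le]
    push_cast
    ring_nf
  rw [e, mul_right_comm]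
  have h3 : 0 ≤ 4 * z 0 * y 0 := by positivity
  gcongr

lemma exists_integral_green_le (hm : 0 < m) (R : ℝ) {ε : ℝ} (hε : 0 < ε) :
    ∃ δ > 0, ∀ (p : EE N) (r : ℝ), p 0 < 0 → 0 < r → r ≤ R → ∀ z ∈ cap p r, ∀ A ⊆ cap p r,
      MeasurableSet A → volume A < δ →
        IntegrableOn (green m z) A ∧ ∫ y in A, green m z y ≤ ε := by
  set C := (4 * R ^ 2) ^ (m - 1) * (2 * (4 * R ^ 2) ^ (1 / 2 : ℝ)) with hC
  set g : EE N → ℝ := fun w => (Iio (2 * R)).indicator (fun t : ℝ => C * t ^ (1 - (N:ℝ))) ‖w‖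
    with hg
  have hgi : Integrable g := integrable_indicator_norm_rpow C (2 * R)
  obtain ⟨δ, hδ, h⟩ := exists_pos_setLIntegral_lt_of_measure_lt (μ := volume)
    (f := fun w => ‖g w‖ₑ) hgi.2.ne (ε := ENNReal.ofReal ε) (ENNReal.ofReal_pos.2 hε).ne'
  refine ⟨δ, hδ, fun p r hp hr hrR z hz A hA hAm hAδ => ?_⟩
  have hgz : Integrable (fun y => g (y - z)) := hgi.comp_sub_right z
  have hle : ∀ᵐ y ∂(volume.restrict A), ‖green m z y‖ ≤ g (y - z) := by
    have hne : ∀ᵐ y ∂(volume.restrict A), y ≠ z := ae_restrict_of_ae (Measure.ae_ne volume z)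
    filter_upwards [hne, ae_restrict_mem hAm] with y hyz hy
    have h0 : 0 ≤ green m z y := greenF_nonneg (sq_nonneg _)
      (mul_nonneg (mul_nonneg (by norm_num) (le_of_lt hz.1)) (le_of_lt (hA hy).1))
    rw [Real.norm_of_nonneg h0]
    exact green_le_of_mem_cap hp hr hrR hz (hA hy) hyz
  have hi : IntegrableOn (green m z) A :=
    hgz.integrableOn.mono' ((aestronglyMeasurable_green hm (le_of_lt hz.1)).mono_set
      (hA.trans inter_subset_left)) hle
  refine ⟨hi, ?_⟩
  have h1 : ∫ y in A, green m z y ≤ ∫ y in A, g (y - z) :=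
    integral_mono_ae hi hgz.integrableOn (hle.mono fun y hy => (le_abs_self _).trans hy)
  refine h1.trans ((le_abs_self _).trans ?_)
  rw [← Real.norm_eq_abs, ← ENNReal.ofReal_le_ofReal_iff hε.le, ofReal_norm]
  refine (enorm_integral_le_lintegral_enorm _).trans ?_
  have hpre : A = (fun y => y - z) ⁻¹' ((fun y => y + z) ⁻¹' A) := by
    ext y; simp
  have hmp := measurePreserving_sub_right (volume : Measure (EE N)) z
  have hemb : MeasurableEmbedding (fun y : EE N => y - z) := measurableEmbedding_subRight z
  rw [hpre, hmp.setLIntegral_comp_preimage_emb hemb (fun w => ‖g w‖ₑ)]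
  refine (h _ ?_).le
  rw [measure_preimage_add_right]
  exact hAδ

namespace IsGreenSol

lemma bound_pos (h : IsGreenSol N m q u c M) : 0 < M := by
  have he : e1 N ∈ hs N := by rw [mem_hs]; simp [e1]
  exact (h.pos _ he).trans_le (h.le _ he)

lemma exists_sphDiff_nonpos (h : IsGreenSol N m q u c M) (hq : 1 < q)
    (hcrit : ((N:ℝ) - 2 * m) * q ≤ N + 2 * m) (hm : 0 < m) (R : ℝ) :
    ∃ δ > 0, ∀ (p : EE N) (r : ℝ), p 0 < 0 → 0 < r → r ≤ R → volume (badSet m u p r) < δ →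
      ∀ z ∈ cap p r, sphDiff m u p r z ≤ 0 := by
  have hM := h.bound_pos
  have hc := h.c_pos
  have hq0 : 0 < q := by linarith
  set K := c * (q * M ^ (q - 1)) with hK
  have hK0 : 0 < K := by positivity
  obtain ⟨δ, hδ, hA⟩ := exists_integral_green_le (N := N) hm R (ε := 1 / (2 * K)) (by positivity)
  refine ⟨δ, hδ, fun p r hp hr hrR hv => ?_⟩
  have key : ∀ k : ℕ, ∀ z ∈ cap p r, sphDiff m u p r z ≤ M * (1 / 2) ^ k := by
    intro k
    induction k with
    | zero =>
      intro z hz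
      rw [pow_zero, mul_one]
      have h1 := h.le z hz.1
      have h2 := h.pos _ (inversion_mem_hs hp hr hz)
      have h3 := one_lt_conformal hp hz
      have h4 : 0 ≤ (r / ‖z - p‖) ^ ((N:ℝ) - 2 * m) * u (inversion p r z) := by positivity
      rw [sphDiff]
      linarith
    | succ k ih =>
      intro z hz
      obtain ⟨hi, hint⟩ := hA p r hp hr hrR z hz (badSet m u p r) inter_subset_left
        (measurableSet_badSet h.continuousOn hp hr) hv
      have h1 := h.sphDiff_lt hq hcrit hm hp hr hz ih hi
      refine h1.le.trans ?_
      have h2 : 0 ≤ K * (M * (1 / 2) ^ k) := by positivity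
      have h3 := mul_le_mul_of_nonneg_left hint h2
      have h4 : K * (M * (1 / 2) ^ k) * (1 / (2 * K)) = M * (1 / 2) ^ (k + 1) := by
        field_simp
        ring
      rw [← h4]
      refine le_trans (le_of_eq ?_) h3
      rw [hK]
      ring
  intro z hz
  have ht : Tendsto (fun k : ℕ => M * (1 / 2 : ℝ) ^ k) atTop (𝓝 (M * 0)) :=
    (tendsto_pow_atTop_nhds_zero_of_lt_one (by norm_num) (by norm_num)).const_mul M
  rw [mul_zero] at ht
  exact ge_of_tendsto' ht fun k => key k z hz

lemma continuousAt_sphDiff_radius (h : IsGreenSol N m q u c M) (hp : p 0 < 0) (hr : 0 < r)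
    {z : EE N} (hz : z ∈ cap p r) : ContinuousAt (fun r => sphDiff m u p r z) r := by
  have hd : 0 < ‖z - p‖ := norm_pos_iff.2 (sub_ne_zero.2 (ne_center_of_mem_hs hp hz.1))
  have h2 : ContinuousAt u (inversion p r z) :=
    h.continuousOn.continuousAt (isOpen_hs.mem_nhds (inversion_mem_hs hp hr hz))
  have h3 : ContinuousAt (fun r => inversion p r z) r := by
    simp only [inversion_eq]
    fun_prop
  have h5 : ContinuousAt (fun r => (r / ‖z - p‖) ^ ((N:ℝ) - 2 * m)) r :=
    (continuousAt_id.div_const _).rpow_const (Or.inl (by simp only [id]; positivity))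
  exact continuousAt_const.sub
    (h5.mul (ContinuousAt.comp (g := u) (f := fun r => inversion p r z) h2 h3))

theorem sphDiff_nonpos (h : IsGreenSol N m q u c M) (hq : 1 < q)
    (hcrit : ((N:ℝ) - 2 * m) * q ≤ N + 2 * m) (hm : 0 < m) (hp : p 0 < 0) (hr : 0 < r)
    {z : EE N} (hz : z ∈ cap p r) : sphDiff m u p r z ≤ 0 := by
  let bad : Set ℝ := {r | 0 < r ∧ ∃ z ∈ cap p r, 0 < sphDiff m u p r z}
  by_contra hcon
  have hne : bad.Nonempty := ⟨r, hr, z, hz, not_le.1 hcon⟩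
  have hbdd : BddBelow bad := ⟨0, fun r hr => hr.1.le⟩
  set ρ := sInf bad with hρ
  have hρ0 : 0 < ρ := by
    refine lt_of_lt_of_le (neg_pos.2 hp) (le_csInf hne ?_)
    rintro r ⟨_, z, hz, _⟩
    have h1 := (le_abs_self _).trans (PiLp.norm_apply_le (z - p) 0)
    have h2 : dist z p < r := hz.2
    have h3 : 0 < z 0 := hz.1
    rw [dist_eq_norm] at h2
    rw [PiLp.sub_apply] at h1
    linarith
  have hcap {z : EE N} {r : ℝ} (hz : z ∈ hs N) (hr : dist z p < r) : z ∈ cap p r := ⟨hz, hr⟩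
  have hgood : ∀ z ∈ cap p ρ, sphDiff m u p ρ z ≤ 0 := by
    intro z hz
    by_contra hcon
    have h1 := (h.continuousAt_sphDiff_radius hp hρ0 hz).eventually (lt_mem_nhds (not_le.1 hcon))
    have h2 : ∀ᶠ r in 𝓝 ρ, dist z p < r := lt_mem_nhds (show dist z p < ρ from hz.2)
    have h3 : ∀ᶠ r in 𝓝 ρ, 0 < r := lt_mem_nhds hρ0
    obtain ⟨r, ⟨h1, h2, h3⟩, hr⟩ :=
      (((h1.and (h2.and h3)).filter_mono (nhdsWithin_le_nhds (s := Iio ρ))).and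
        self_mem_nhdsWithin).exists
    exact (not_lt.2 (csInf_le hbdd (⟨h3, z, hcap hz.1 h2, h1⟩ : r ∈ bad))) hr
  have hempty : badSet m u p ρ = ∅ :=
    eq_empty_of_forall_notMem fun z hz => (not_lt.2 (hgood z hz.1)) hz.2
  have hneg : ∀ z ∈ cap p ρ, sphDiff m u p ρ z < 0 := by
    intro z hz
    have h1 := h.sphDiff_lt hq hcrit hm hp hρ0 hz hgood (by rw [hempty]; exact integrableOn_empty)
    simpa using h1
  have hmeas : ∀ r, MeasurableSet (badSet m u p r) := fun r => by
    rcases lt_or_ge 0 r with hr | hr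
    · exact measurableSet_badSet h.continuousOn hp hr
    · rw [badSet, cap, Metric.ball_eq_empty.2 hr]
      simp
  have hlim : Tendsto (fun r => volume (badSet m u p r)) (𝓝[>] ρ) (𝓝 (volume (∅ : Set (EE N)))) := by
    refine tendsto_measure_of_ae_tendsto_indicator (𝓝[>] ρ) MeasurableSet.empty hmeas
      (B := Metric.ball p (ρ + 1)) measurableSet_ball measure_ball_lt_top.ne ?_ ?_
    · filter_upwards [nhdsWithin_le_nhds (gt_mem_nhds (lt_add_one ρ))] with r hr z hz
      exact Metric.ball_subset_ball hr.le hz.1.2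
    · have hsph : ∀ᵐ z : EE N, z ∉ Metric.sphere p ρ :=
        measure_eq_zero_iff_ae_notMem.1 (Measure.addHaar_sphere_of_ne_zero volume p hρ0.ne')
      filter_upwards [hsph] with z hz
      simp only [mem_empty_iff_false, iff_false]
      refine Filter.Eventually.filter_mono nhdsWithin_le_nhds ?_
      by_cases hz0 : z ∈ hs N
      · rcases lt_or_gt_of_ne (show dist z p ≠ ρ from hz) with hlt | hlt
        · filter_upwards [(h.continuousAt_sphDiff_radius hp hρ0 (hcap hz0 hlt)).eventually
            (gt_mem_nhds (hneg z (hcap hz0 hlt)))] with r hr hb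
          exact lt_asymm hr hb.2
        · filter_upwards [gt_mem_nhds hlt] with r hr hb
          exact lt_asymm hr hb.1.2
      · exact Eventually.of_forall fun r hb => hz0 hb.1.1
  rw [measure_empty] at hlim
  obtain ⟨δ, hδ, hsmall⟩ := h.exists_sphDiff_nonpos hq hcrit hm (ρ + 1)
  have hev : ∀ᶠ r in 𝓝[>] ρ, r ∉ bad := by
    filter_upwards [hlim (gt_mem_nhds hδ), nhdsWithin_le_nhds (gt_mem_nhds (lt_add_one ρ))]
      with r hv hr hb
    obtain ⟨hr0, z, hz, hD⟩ := hb
    exact not_lt.2 (hsmall p r hp hr0 hr.le hv z hz) hD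
  obtain ⟨ρ', hρ', hsub⟩ := mem_nhdsGT_iff_exists_Ioo_subset.1 hev
  refine not_lt.2 (le_csInf hne fun r hr => ?_) hρ'
  by_contra hlt
  rcases (csInf_le hbdd hr).lt_or_eq with hlt' | heq
  · exact hsub ⟨hlt', not_le.1 hlt⟩ hr
  · obtain ⟨_, z, hz, hD⟩ := hr
    rw [← heq] at hz hD
    exact not_lt.2 (hgood z hz) hD

end IsGreenSol

end

section

variable {N : ℕ} [NeZero N] {m : ℕ} {q : ℝ} {u : EE N → ℝ} {c M : ℝ}

lemma IsGreenSol.le_of_coord_eq (h : IsGreenSol N m q u c M) (hq : 1 < q)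
    (hcrit : ((N:ℝ) - 2 * m) * q ≤ N + 2 * m) (hm : 0 < m) {x y : EE N} (hx : x ∈ hs N)
    (hy : y ∈ hs N) (hxy : x 0 = y 0) : u x ≤ u y := by
  have hx0 : 0 < x 0 := hx
  have hlim : Tendsto (fun ε : ℝ => √(1 + ε) ^ ((N:ℝ) - 2 * m) * u (y + (ε * (x 0 + 1)) • e1 N))
      (𝓝[>] 0) (𝓝 (u y)) := by
    have h1 : ContinuousAt (fun ε : ℝ => √(1 + ε) ^ ((N:ℝ) - 2 * m)) 0 :=
      ContinuousAt.rpow_const (by fun_prop) (Or.inl (by simp))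
    have h2 : ContinuousAt (fun ε : ℝ => y + (ε * (x 0 + 1)) • e1 N) 0 := by fun_prop
    have h3 : ContinuousAt u ((fun ε : ℝ => y + (ε * (x 0 + 1)) • e1 N) 0) := by
      simpa using h.continuousOn.continuousAt (isOpen_hs.mem_nhds hy)
    have h4 := (h1.mul (ContinuousAt.comp (g := u) h3 h2)).tendsto
    have e : √(1 + 0) ^ ((N:ℝ) - 2 * m) * u (y + ((0:ℝ) * (x 0 + 1)) • e1 N) = u y := by simp
    rw [← e]
    exact h4.mono_left nhdsWithin_le_nhds
  refine ge_of_tendsto hlim ?_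
  filter_upwards [self_mem_nhdsWithin] with ε hε
  have hε : 0 < ε := hε
  set d : EE N := ε⁻¹ • (y - x) + (x 0 + 1) • e1 N with hd
  have hd0 : d 0 = x 0 + 1 := by simp [hd, e1, hxy]
  have hdn : 0 < ‖d‖ := norm_pos_iff.2 fun h0 => by
    rw [h0, PiLp.zero_apply] at hd0
    linarith
  have hs1 : 1 < √(1 + ε) := Real.lt_sqrt_of_sq_lt (by linarith)
  set r := ‖d‖ * √(1 + ε) with hr
  have hp : (x - d) 0 < 0 := by rw [PiLp.sub_apply, hd0]; linarith
  have hxp : x - (x - d) = d := by abel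
  have hJ : r / ‖x - (x - d)‖ = √(1 + ε) := by
    rw [hxp, hr, mul_div_cancel_left₀ _ hdn.ne']
  have hcap : x ∈ cap (x - d) r := by
    refine ⟨hx, ?_⟩
    rw [Metric.mem_ball, dist_eq_norm, hxp]
    exact lt_mul_of_one_lt_right hdn hs1
  have hinv : inversion (x - d) r x = y + (ε * (x 0 + 1)) • e1 N := by
    rw [inversion_eq, hJ, hxp, Real.sq_sqrt (by linarith), add_smul, one_smul, mul_smul]
    have : ε • d = y - x + ε • (x 0 + 1) • e1 N := by
      rw [hd, smul_add, smul_inv_smul₀ hε.ne']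
    rw [this]
    abel
  have key := h.sphDiff_nonpos hq hcrit hm hp (by positivity) hcap
  rw [sphDiff, hJ, hinv] at key
  linarith

lemma IsBCSol.exists_isGreenSol (h : IsBCSol N m q u) (hm : 0 < m) (hq : 0 ≤ q)
    (hpos : ∀ x : EE N, 0 ≤ x 0 → 0 ≤ u x) {x₀ : EE N} (hx₀ : x₀ ∈ hs N) (hux₀ : u x₀ ≠ 0) :
    ∃ c M, IsGreenSol N m q u c M := by
  obtain ⟨M, -, hM⟩ := h.exists_bound
  obtain ⟨c, hc, hrep⟩ := h.exists_green_representation hm hq hpos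
  have hcont : ContinuousOn u (hs N) := h.continuousOn.mono hs_subset_chs
  have hopen : IsOpen (hs N ∩ u ⁻¹' Ioi 0) := hcont.isOpen_inter_preimage isOpen_hs isOpen_Ioi
  have hvol : 0 < volume (hs N ∩ u ⁻¹' Ioi 0) :=
    hopen.measure_pos volume ⟨x₀, hx₀, lt_of_le_of_ne (hpos _ (le_of_lt hx₀)) hux₀.symm⟩
  refine ⟨c, M, hc, fun x hx => ?_, fun x hx => (le_abs_self _).trans (hM x (hs_subset_chs hx)),
    hcont, fun x hx => (hrep x hx).1, fun x hx => (hrep x hx).2⟩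
  rw [(hrep x hx).2]
  refine mul_pos hc ((setIntegral_pos_iff_support_of_nonneg_ae ?_ (hrep x hx).1).2 ?_)
  · filter_upwards [ae_restrict_mem measurableSet_hs] with y hy
    exact mul_nonneg (greenF_nonneg (sq_nonneg _)
      (mul_nonneg (mul_nonneg (by norm_num) (le_of_lt hx)) (le_of_lt hy)))
      (Real.rpow_nonneg (hpos y (le_of_lt hy)) _)
  · rw [← measure_sdiff_null (s := hs N ∩ u ⁻¹' Ioi 0) (measure_singleton x)] at hvol
    refine hvol.trans_le (measure_mono ?_)
    rintro y ⟨⟨hy, huy⟩, hyx⟩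
    have hx0 : 0 < x 0 := hx
    have hy0 : 0 < y 0 := hy
    have huy : 0 < u y := huy
    refine ⟨(mul_pos (greenF_pos (pow_pos (norm_pos_iff.2 (sub_ne_zero.2 hyx)) 2) ?_)
      (Real.rpow_pos_of_pos huy q)).ne', hy⟩
    positivity

lemma normsq_add_e1 (x : EE N) : ‖x + e1 N‖ ^ 2 = ‖x‖ ^ 2 + 2 * x 0 + 1 := by
  rw [norm_add_sq_real, norm_e1, e1, EuclideanSpace.inner_single_right]
  simp

lemma norm_add_e1_pos {x : EE N} (hx : x ∈ Metric.ball 0 1) : 0 < ‖x + e1 N‖ := by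
  rw [mem_ball_zero_iff] at hx
  refine norm_pos_iff.2 fun h => ?_
  rw [eq_neg_of_add_eq_zero_left h, norm_neg, norm_e1] at hx
  exact lt_irrefl _ hx

lemma kelvin_coord (x : EE N) : kelvin N x 0 = 2 / ‖x + e1 N‖ ^ 2 * (x 0 + 1) - 1 := by
  simp [kelvin, e1]
  ring

lemma kelvin_mem_hs {x : EE N} (hx : x ∈ Metric.ball 0 1) : kelvin N x ∈ hs N := by
  have h1 := norm_add_e1_pos hx
  have h2 := normsq_add_e1 x
  rw [mem_ball_zero_iff] at hx
  have h3 : ‖x‖ ^ 2 < 1 := pow_lt_one₀ (norm_nonneg _) hx two_ne_zero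
  rw [mem_hs, kelvin_coord, sub_pos, div_mul_eq_mul_div, one_lt_div (by positivity)]
  linarith

end

end

/-- Axial symmetry: the Kelvin transform `v(x) = |x+e₁|^{2m-N} u(φ(x))` of a nonnegative
bounded classical solution of the half-space Dirichlet problem is axially symmetric with
respect to the `x₁`-axis: `v(x) = v(y)` whenever `x₁ = y₁` and `|x| = |y|`. -/
theorem stmt_11 {N m : ℕ} [NeZero N] (hN : 2 ≤ N) (hm : 0 < m) (q : ℝ)
    (hq1 : 1 < q) (hq2 : 2 * m < N → q ≤ ((N : ℝ) + 2 * m) / ((N : ℝ) - 2 * m))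
    (u : EuclideanSpace ℝ (Fin N) → ℝ)
    (hsol : IsBCSol N m q u)
    (hpos : ∀ x : EuclideanSpace ℝ (Fin N), 0 ≤ x 0 → 0 ≤ u x) :
    ∀ x ∈ Metric.ball (0 : EuclideanSpace ℝ (Fin N)) 1,
      ∀ y ∈ Metric.ball (0 : EuclideanSpace ℝ (Fin N)) 1,
        x 0 = y 0 → ‖x‖ = ‖y‖ →
          ‖x + e1 N‖ ^ (2 * (m : ℝ) - N) * u (kelvin N x) =
            ‖y + e1 N‖ ^ (2 * (m : ℝ) - N) * u (kelvin N y) := by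
  intro x hx y hy hxy hnorm
  have hkx := kelvin_mem_hs hx
  have hky := kelvin_mem_hs hy
  have hn : ‖x + e1 N‖ = ‖y + e1 N‖ := by
    rw [← pow_left_inj₀ (norm_nonneg _) (norm_nonneg _) two_ne_zero, normsq_add_e1,
      normsq_add_e1, hnorm, hxy]
  have hk : kelvin N x 0 = kelvin N y 0 := by rw [kelvin_coord, kelvin_coord, hn, hxy]
  have hcrit : ((N:ℝ) - 2 * m) * q ≤ N + 2 * m := by
    rcases lt_or_ge (2 * m) N with h | h
    · have h' : (2 * m : ℝ) < N := by exact_mod_cast h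
      have := (le_div_iff₀ (sub_pos.2 h')).1 (hq2 h)
      linarith
    · have h' : (N:ℝ) ≤ 2 * m := by exact_mod_cast h
      have : ((N:ℝ) - 2 * m) * q ≤ 0 := mul_nonpos_of_nonpos_of_nonneg (by linarith) (by linarith)
      have : (0:ℝ) ≤ N + 2 * m := by positivity
      linarith
  rw [hn]
  congr 1
  by_cases hzero : ∃ x₀ ∈ hs N, u x₀ ≠ 0
  · obtain ⟨x₀, hx₀, hux₀⟩ := hzero
    obtain ⟨c, M, hG⟩ := hsol.exists_isGreenSol hm (by linarith) hpos hx₀ hux₀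
    exact le_antisymm (hG.le_of_coord_eq hq1 hcrit hm hkx hky hk)
      (hG.le_of_coord_eq hq1 hcrit hm hky hkx hk.symm)
  · push Not at hzero
    rw [hzero _ hkx, hzero _ hky]
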